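/- Let G be a connected, locally finite, vertex-transitive graph of polynomial growth, and let Γ ≤ Aut(G) be a subgroup acting transitively on the vertices of G. Then there is a normal subgroup H ⊴ Γ, all of whose orbits on the vertex set of G are finite, such that Γ_{G/H} contains a normal subgroup N of finite index which is torsion-free, nilpotent, and acts freely on the vertex set of the quotient graph G/H. -/

import Mathlib

namespace PercStmt

variable {V : Type*}

/-- A graph is vertex-transitive if any vertex can be mapped to any other by an automorphism. -/
def VertexTransitive (G : SimpleGraph V) : Prop :=
  ∀ u v : V, ∃ φ : G ≃g G, φ u = v

/-- `β_G(r)`: the number of vertices at distance at most `r` from `v`. -/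
noncomputable def ballCard (G : SimpleGraph V) (v : V) (r : ℕ) : ℕ :=
  Nat.card {u : V | G.Reachable v u ∧ G.dist v u ≤ r}

/-- Polynomial growth: `β_G(n) ≤ C n^d` for some `C, d > 0`. -/
def PolyGrowth (G : SimpleGraph V) (v : V) : Prop :=
  ∃ C d : ℝ, 0 < C ∧ 0 < d ∧ ∀ n : ℕ, 0 < n → (ballCard G v n : ℝ) ≤ C * (n : ℝ) ^ d

variable {Γ : Type*} [Group Γ] [MulAction Γ V]

/-- The kernel of the action of `Γ` on the set of `H`-orbits of `V`; the quotient
`Γ ⧸ actionKernel V Γ H` is the image `Γ_{G/H}` of `Γ` in the symmetry group of `G/H`. -/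
def actionKernel (V : Type*) (Γ : Type*) [Group Γ] [MulAction Γ V] (H : Subgroup Γ) :
    Subgroup Γ where
  carrier := {g : Γ | ∀ v : V,
    Quotient.mk (MulAction.orbitRel H V) (g • v) = Quotient.mk (MulAction.orbitRel H V) v}
  one_mem' := by intro v; rw [one_smul]
  mul_mem' := by
    intro a b ha hb v
    rw [mul_smul, ha (b • v), hb v]
  inv_mem' := by
    intro a ha v
    have h := ha (a⁻¹ • v)
    rw [smul_inv_smul] at h
    exact h.symm

end PercStmt

namespace TransGrowth

open Finset

section Graph

variable {V : Type*} [DecidableEq V]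

/-- The ball of radius `n` around `x` for the neighbourhood map `nb`. -/
def ball (nb : V → Finset V) : ℕ → V → Finset V
  | 0, x => {x}
  | n + 1, x => (nb x).biUnion (ball nb n)

/-- The number of walks of length `n` from `x` to `y`. -/
def walks (nb : V → Finset V) : ℕ → V → V → ℝ
  | 0, x, y => if x = y then 1 else 0
  | n + 1, x, y => ∑ z ∈ nb x, walks nb n z y

/-- A reflexive, symmetric, connected, locally finite graph of polynomial growth with a transitive
action of `Γ`, encoded by its closed neighbourhoods. -/
structure Homog (Γ : Type*) [Group Γ] [MulAction Γ V] (nb : V → Finset V) : Prop where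
  self_mem : ∀ x, x ∈ nb x
  symm : ∀ x y, y ∈ nb x → x ∈ nb y
  smul_mem : ∀ (g : Γ) x y, y ∈ nb x → g • y ∈ nb (g • x)
  trans : ∀ x y : V, ∃ g : Γ, g • x = y
  conn : ∀ x y, ∃ n, y ∈ ball nb n x
  growth : ∃ C d : ℕ, ∀ n, 1 ≤ n → ∀ x, (ball nb n x).card ≤ C * n ^ d

variable {Γ : Type*} [Group Γ] [MulAction Γ V] {nb : V → Finset V}

theorem mem_ball_zero {x y : V} : y ∈ ball nb 0 x ↔ y = x := by simp [ball]

theorem mem_ball_succ {n : ℕ} {x y : V} :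
    y ∈ ball nb (n + 1) x ↔ ∃ z ∈ nb x, y ∈ ball nb n z := by simp [ball]

theorem ball_one (x : V) : ball nb 1 x = nb x := by
  ext y; simp [mem_ball_succ, mem_ball_zero]

theorem mem_ball_add {m n : ℕ} {x y : V} :
    y ∈ ball nb (m + n) x ↔ ∃ z ∈ ball nb m x, y ∈ ball nb n z := by
  induction m generalizing x with
  | zero => simp [mem_ball_zero]
  | succ m ih =>
    rw [show m + 1 + n = (m + n) + 1 by ring, mem_ball_succ]
    constructor
    · rintro ⟨z, hz, hy⟩
      obtain ⟨u, hu, hy⟩ := ih.1 hy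
      exact ⟨u, mem_ball_succ.2 ⟨z, hz, hu⟩, hy⟩
    · rintro ⟨u, hu, hy⟩
      obtain ⟨z, hz, hu⟩ := mem_ball_succ.1 hu
      exact ⟨z, hz, ih.2 ⟨u, hu, hy⟩⟩

theorem ball_trans {m n : ℕ} {x y z : V} (h₁ : y ∈ ball nb m x) (h₂ : z ∈ ball nb n y) :
    z ∈ ball nb (m + n) x := mem_ball_add.2 ⟨y, h₁, h₂⟩

theorem walks_nonneg (n : ℕ) (x y : V) : 0 ≤ walks nb n x y := by
  induction n generalizing x with
  | zero => simp only [walks]; split_ifs <;> norm_num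
  | succ n ih => exact sum_nonneg fun z _ => ih z

theorem walks_eq_zero {n : ℕ} {x y : V} (h : y ∉ ball nb n x) : walks nb n x y = 0 := by
  induction n generalizing x with
  | zero =>
    rw [mem_ball_zero] at h
    simp only [walks]; rw [if_neg]; exact fun e => h e.symm
  | succ n ih =>
    refine sum_eq_zero fun z hz => ih fun hy => h (mem_ball_succ.2 ⟨z, hz, hy⟩)

theorem one_le_walks {n : ℕ} {x y : V} (h : y ∈ ball nb n x) : 1 ≤ walks nb n x y := by
  induction n generalizing x with
  | zero =>
    rw [mem_ball_zero] at h
    simp [walks, h]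
  | succ n ih =>
    obtain ⟨z, hz, hy⟩ := mem_ball_succ.1 h
    exact (ih hy).trans (single_le_sum (f := fun z => walks nb n z y)
      (fun z _ => walks_nonneg n z y) hz)

theorem walks_add_of_subset (m n : ℕ) {x y : V} {S : Finset V} (hS : ball nb m x ⊆ S) :
    walks nb (m + n) x y = ∑ z ∈ S, walks nb m x z * walks nb n z y := by
  induction m generalizing x with
  | zero =>
    rw [sum_eq_single x]
    · simp [walks]
    · intro z _ hz; simp [walks, hz.symm]
    · intro h; exact absurd (hS (mem_ball_zero.2 rfl)) h
  | succ m ih =>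
    rw [show m + 1 + n = (m + n) + 1 by ring]
    simp only [walks, sum_mul]
    rw [sum_comm]
    refine sum_congr rfl fun u hu => ih ?_
    exact fun z hz => hS (mem_ball_succ.2 ⟨u, hu, hz⟩)

theorem walks_one (x y : V) : walks nb 1 x y = if y ∈ nb x then 1 else 0 := by
  simp [walks]

namespace Homog

variable (hG : Homog Γ nb)
include hG

theorem mem_ball_self (n : ℕ) (x : V) : x ∈ ball nb n x := by
  induction n with
  | zero => simp [mem_ball_zero]
  | succ n ih => exact mem_ball_succ.2 ⟨x, hG.self_mem x, ih⟩

theorem ball_mono {m n : ℕ} (h : m ≤ n) (x : V) : ball nb m x ⊆ ball nb n x := by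
  obtain ⟨k, rfl⟩ := Nat.exists_eq_add_of_le h
  exact fun y hy => ball_trans hy (hG.mem_ball_self k y)

theorem mem_ball_comm {n : ℕ} {x y : V} : y ∈ ball nb n x ↔ x ∈ ball nb n y := by
  have key : ∀ n (x y : V), y ∈ ball nb n x → x ∈ ball nb n y := by
    intro n
    induction n with
    | zero => intro x y h; rw [mem_ball_zero] at *; exact h.symm
    | succ n ih =>
      intro x y h
      obtain ⟨z, hz, hy⟩ := mem_ball_succ.1 h
      refine mem_ball_add.2 ⟨z, ih _ _ hy, ?_⟩
      rw [ball_one]; exact hG.symm _ _ hz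
  exact ⟨key n x y, key n y x⟩

theorem nb_smul (g : Γ) (x : V) : nb (g • x) = (nb x).map ⟨(g • ·), MulAction.injective g⟩ := by
  ext y
  simp only [mem_map, Function.Embedding.coeFn_mk]
  constructor
  · intro h
    refine ⟨g⁻¹ • y, ?_, smul_inv_smul g y⟩
    simpa using hG.smul_mem g⁻¹ _ _ h
  · rintro ⟨z, hz, rfl⟩
    exact hG.smul_mem g _ _ hz

theorem ball_smul (n : ℕ) (g : Γ) (x : V) :
    ball nb n (g • x) = (ball nb n x).map ⟨(g • ·), MulAction.injective g⟩ := by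
  induction n generalizing x with
  | zero => simp [ball]
  | succ n ih =>
    ext y
    simp only [mem_ball_succ, mem_map, hG.nb_smul, Function.Embedding.coeFn_mk]
    constructor
    · rintro ⟨_, ⟨z, hz, rfl⟩, hy⟩
      rw [ih] at hy
      obtain ⟨w, hw, rfl⟩ := mem_map.1 hy
      exact ⟨w, ⟨z, hz, hw⟩, rfl⟩
    · rintro ⟨w, ⟨z, hz, hw⟩, rfl⟩
      refine ⟨g • z, ⟨z, hz, rfl⟩, ?_⟩
      rw [ih]
      exact mem_map.2 ⟨w, hw, rfl⟩

theorem smul_mem_ball {n : ℕ} (g : Γ) {x y : V} :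
    g • y ∈ ball nb n (g • x) ↔ y ∈ ball nb n x := by
  rw [hG.ball_smul]
  simp

theorem sum_ball_smul {M : Type*} [AddCommMonoid M] (n : ℕ) (g : Γ) (x : V) (F : V → M) :
    ∑ y ∈ ball nb n (g • x), F y = ∑ y ∈ ball nb n x, F (g • y) := by
  rw [hG.ball_smul, sum_map]; rfl

theorem sum_ball_const {M : Type*} [AddCommMonoid M] (n : ℕ) (F : V → V → M)
    (hF : ∀ (g : Γ) x y, F (g • x) (g • y) = F x y) (x x' : V) :
    ∑ y ∈ ball nb n x, F x y = ∑ y ∈ ball nb n x', F x' y := by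
  obtain ⟨g, rfl⟩ := hG.trans x x'
  rw [hG.sum_ball_smul]
  exact sum_congr rfl fun y _ => (hF g x y).symm

theorem card_ball_eq (n : ℕ) (x y : V) : (ball nb n x).card = (ball nb n y).card := by
  obtain ⟨g, rfl⟩ := hG.trans x y
  rw [hG.ball_smul, card_map]

theorem card_nb_eq (x y : V) : (nb x).card = (nb y).card := by
  have := hG.card_ball_eq 1 x y
  rwa [ball_one, ball_one] at this

theorem card_ball_pos (n : ℕ) (x : V) : 0 < (ball nb n x).card :=
  card_pos.2 ⟨x, hG.mem_ball_self n x⟩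

theorem walks_smul (n : ℕ) (g : Γ) (x y : V) :
    walks nb n (g • x) (g • y) = walks nb n x y := by
  induction n generalizing x with
  | zero => simp [walks]
  | succ n ih =>
    simp only [walks, hG.nb_smul, sum_map, Function.Embedding.coeFn_mk, ih]

theorem walks_comm (n : ℕ) (x y : V) : walks nb n x y = walks nb n y x := by
  induction n generalizing x y with
  | zero => simp [walks, eq_comm]
  | succ n ih =>
    have h1 : walks nb (n + 1) y x
        = ∑ z ∈ ball nb n y ∪ nb x, walks nb n y z * walks nb 1 z x :=
      walks_add_of_subset n 1 subset_union_left
    rw [h1]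
    simp only [walks_one, mul_ite, mul_one, mul_zero]
    rw [← sum_filter]
    simp only [walks]
    have : filter (fun z => x ∈ nb z) (ball nb n y ∪ nb x) = nb x := by
      ext z
      simp only [mem_filter, mem_union]
      refine ⟨fun h => hG.symm _ _ h.2, fun h => ⟨Or.inr h, hG.symm _ _ h⟩⟩
    rw [this]
    exact sum_congr rfl fun z _ => ih z y

theorem sum_walks_of_subset (n : ℕ) {x : V} {S : Finset V} (hS : ball nb n x ⊆ S) :
    ∑ y ∈ S, walks nb n x y = ((nb x).card : ℝ) ^ n := by
  induction n generalizing x with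
  | zero =>
    rw [sum_eq_single x]
    · simp [walks]
    · intro z _ hz; simp [walks, hz.symm]
    · intro h; exact absurd (hS (mem_ball_zero.2 rfl)) h
  | succ n ih =>
    simp only [walks]
    rw [sum_comm]
    have : ∀ z ∈ nb x, ∑ y ∈ S, walks nb n z y = ((nb x).card : ℝ) ^ n := fun z hz => by
      rw [ih fun y hy => hS (mem_ball_succ.2 ⟨z, hz, hy⟩), hG.card_nb_eq z x]
    rw [sum_congr rfl this, sum_const, nsmul_eq_mul, pow_succ]
    ring

end Homog

/-- If `a ^ n ≤ C n ^ d b ^ n` for all `n ≥ 1` then `a ≤ b`. -/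
theorem le_of_pow_le_poly_mul_pow {a b C : ℝ} {d : ℕ} (hb : 0 ≤ b)
    (h : ∀ n : ℕ, 1 ≤ n → a ^ n ≤ C * (n : ℝ) ^ d * b ^ n) : a ≤ b := by
  by_contra! hab
  rcases hb.eq_or_lt with rfl | hb
  · have := h 1 le_rfl
    simp at this
    linarith
  have hr : 1 < a / b := (one_lt_div hb).2 hab
  have ht := (tendsto_pow_const_div_const_pow_of_one_lt d hr).const_mul C
  rw [mul_zero] at ht
  obtain ⟨n, hn, hn1⟩ := ((ht.eventually (gt_mem_nhds one_pos)).and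
    (Filter.eventually_ge_atTop 1)).exists
  have h2 := h n hn1
  have hpos : 0 < (a / b) ^ n := by positivity
  rw [← mul_div_assoc, div_lt_one hpos, div_pow, lt_div_iff₀ (by positivity)] at hn
  linarith

namespace Homog

variable (hG : Homog Γ nb)
include hG

/-- Mass transport: for an invariant finite range kernel, column sums are at most row sums. -/
theorem mass_transport (m : V → V → ℝ) (R : ℕ) (h0 : ∀ x y, 0 ≤ m x y)
    (hinv : ∀ (g : Γ) x y, m (g • x) (g • y) = m x y)
    (hR : ∀ x y, y ∉ ball nb R x → m x y = 0) (S : Finset V) (o z : V) :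
    ∑ x ∈ S, m x z ≤ ∑ y ∈ ball nb R o, m o y := by
  -- it suffices to treat full columns
  set a := ∑ y ∈ ball nb R o, m o y
  set b := ∑ y ∈ ball nb R o, m y o
  have hrow : ∀ x, ∑ y ∈ ball nb R x, m x y = a := fun x => hG.sum_ball_const R m hinv x o
  have hcol : ∀ x, ∑ y ∈ ball nb R x, m y x = b := fun x =>
    hG.sum_ball_const R (fun x y => m y x) (fun g x y => hinv g y x) x o
  have ha0 : 0 ≤ a := sum_nonneg fun _ _ => h0 _ _
  have hb0 : 0 ≤ b := sum_nonneg fun _ _ => h0 _ _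
  have hcolS : ∀ (S : Finset V) z, ∑ x ∈ S, m x z ≤ b := by
    intro S z
    rw [← hcol z]
    calc ∑ x ∈ S, m x z ≤ ∑ x ∈ S ∪ ball nb R z, m x z :=
          sum_le_sum_of_subset_of_nonneg subset_union_left fun _ _ _ => h0 _ _
      _ = ∑ x ∈ ball nb R z, m x z := by
          symm
          refine sum_subset subset_union_right fun x _ hx => hR _ _ fun h => hx ?_
          exact hG.mem_ball_comm.1 h
  -- the mirrored statement `b ≤ a` follows from counting weighted walks
  suffices hba : b ≤ a from (hcolS S z).trans hba
  let M : ℕ → V → V → ℝ := fun n => Nat.rec (fun x y => if x = y then 1 else 0)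
    (fun _ M x y => ∑ z ∈ ball nb R x, m z x * M z y) n
  have M0 : ∀ x y, M 0 x y = if x = y then 1 else 0 := fun _ _ => rfl
  have MS : ∀ n x y, M (n + 1) x y = ∑ z ∈ ball nb R x, m z x * M n z y := fun _ _ _ => rfl
  have Mnn : ∀ n x y, 0 ≤ M n x y := by
    intro n
    induction n with
    | zero => intro x y; rw [M0]; split_ifs <;> norm_num
    | succ n ih => intro x y; rw [MS]; exact sum_nonneg fun _ _ => mul_nonneg (h0 _ _) (ih _ _)
  have Mcol : ∀ n (S : Finset V) y, ∑ x ∈ S, M n x y ≤ a ^ n := by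
    intro n
    induction n with
    | zero =>
      intro S y
      simp only [M0]
      rw [sum_ite_eq' S y]
      split_ifs <;> norm_num
    | succ n ih =>
      intro S y
      set T := S.biUnion (ball nb R)
      calc ∑ x ∈ S, M (n + 1) x y = ∑ x ∈ S, ∑ z ∈ ball nb R x, m z x * M n z y := rfl
        _ ≤ ∑ x ∈ S, ∑ z ∈ T, m z x * M n z y := by
            refine sum_le_sum fun x hx => sum_le_sum_of_subset_of_nonneg ?_
              fun _ _ _ => mul_nonneg (h0 _ _) (Mnn _ _ _)
            exact fun z hz => mem_biUnion.2 ⟨x, hx, hz⟩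
        _ = ∑ z ∈ T, (∑ x ∈ S, m z x) * M n z y := by
            rw [sum_comm]; exact sum_congr rfl fun z _ => (sum_mul _ _ _).symm
        _ ≤ ∑ z ∈ T, a * M n z y := by
            refine sum_le_sum fun z _ => mul_le_mul_of_nonneg_right ?_ (Mnn _ _ _)
            rw [← hrow z]
            calc ∑ x ∈ S, m z x ≤ ∑ x ∈ S ∪ ball nb R z, m z x :=
                  sum_le_sum_of_subset_of_nonneg subset_union_left fun _ _ _ => h0 _ _
              _ = ∑ x ∈ ball nb R z, m z x :=
                  (sum_subset subset_union_right fun x _ hx => hR _ _ hx).symm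
        _ = a * ∑ z ∈ T, M n z y := (mul_sum _ _ _).symm
        _ ≤ a * a ^ n := mul_le_mul_of_nonneg_left (ih T y) ha0
        _ = a ^ (n + 1) := by ring
  have Mpt : ∀ n x y, M n x y ≤ a ^ n := fun n x y => by simpa using Mcol n {x} y
  have Mrow : ∀ n x (S : Finset V), ball nb (n * R) x ⊆ S → ∑ y ∈ S, M n x y = b ^ n := by
    intro n
    induction n with
    | zero =>
      intro x S hS
      simp only [M0]
      rw [sum_ite_eq S x, if_pos (hS (hG.mem_ball_self _ _)), pow_zero]
    | succ n ih =>
      intro x S hS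
      simp only [MS]
      rw [sum_comm]
      have : ∀ z ∈ ball nb R x, ∑ y ∈ S, m z x * M n z y = m z x * b ^ n := by
        intro z hz
        rw [← mul_sum, ih z S]
        intro w hw
        apply hS
        have := ball_trans hz hw
        rwa [show R + n * R = (n + 1) * R by ring] at this
      rw [sum_congr rfl this, ← sum_mul, hcol x]
      ring
  obtain ⟨C, d, hC⟩ := hG.growth
  refine le_of_pow_le_poly_mul_pow (C := C * ((R + 1 : ℕ) : ℝ) ^ d) (d := d) ha0 fun n hn => ?_
  have hn' : 1 ≤ n * (R + 1) := Nat.one_le_iff_ne_zero.2 (by positivity)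
  have hcard : ((ball nb (n * (R + 1)) o).card : ℝ) ≤ C * ((n * (R + 1) : ℕ) : ℝ) ^ d := by
    exact_mod_cast hC _ hn' o
  calc b ^ n = ∑ y ∈ ball nb (n * (R + 1)) o, M n o y :=
        (Mrow n o _ (hG.ball_mono (by nlinarith) o)).symm
    _ ≤ ∑ y ∈ ball nb (n * (R + 1)) o, a ^ n := sum_le_sum fun y _ => Mpt n o y
    _ = (ball nb (n * (R + 1)) o).card * a ^ n := by rw [sum_const, nsmul_eq_mul]
    _ ≤ (C * ((n * (R + 1) : ℕ) : ℝ) ^ d) * a ^ n :=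
        mul_le_mul_of_nonneg_right hcard (pow_nonneg ha0 n)
    _ = C * ((R + 1 : ℕ) : ℝ) ^ d * (n : ℝ) ^ d * a ^ n := by
        push_cast; rw [mul_pow]; ring

end Homog

/-- The squared gradient of `f`. -/
def energy (nb : V → Finset V) (f : V → ℝ) (x : V) : ℝ := ∑ y ∈ nb x, (f x - f y) ^ 2

omit [DecidableEq V] in
theorem energy_nonneg (f : V → ℝ) (x : V) : 0 ≤ energy nb f x :=
  sum_nonneg fun _ _ => sq_nonneg _

omit [DecidableEq V] in
theorem sq_le_energy (f : V → ℝ) {x y : V} (h : y ∈ nb x) : (f x - f y) ^ 2 ≤ energy nb f x :=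
  single_le_sum (f := fun y => (f x - f y) ^ 2) (fun _ _ => sq_nonneg _) h

namespace Homog

variable (hG : Homog Γ nb)
include hG

theorem walks_mul_sq_le (f : V → ℝ) (s : ℕ) {x y : V} {S : Finset V} (hS : ball nb s x ⊆ S) :
    walks nb s x y * (f x - f y) ^ 2 ≤
      s * ∑ i ∈ range s, ∑ z ∈ S, walks nb i x z * walks nb (s - i) z y * energy nb f z := by
  induction s generalizing x with
  | zero =>
    simp only [walks]
    split_ifs with h <;> simp [h]
  | succ s ih =>
    set K : V → ℝ := fun x' =>
      ∑ i ∈ range s, ∑ z ∈ S, walks nb i x' z * walks nb (s - i) z y * energy nb f z with hK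
    have hx : x ∈ S := hS (hG.mem_ball_self _ _)
    have hKeq : ∑ i ∈ range (s + 1), ∑ z ∈ S,
          walks nb i x z * walks nb (s + 1 - i) z y * energy nb f z
        = (∑ x' ∈ nb x, K x') + walks nb (s + 1) x y * energy nb f x := by
      rw [sum_range_succ']
      congr 1
      · simp only [hK]
        conv_rhs => rw [sum_comm]
        refine sum_congr rfl fun i _ => ?_
        conv_rhs => rw [sum_comm]
        refine sum_congr rfl fun z _ => ?_
        rw [Nat.add_sub_add_right]
        simp only [walks, sum_mul]
      · rw [sum_eq_single x]
        · simp [walks]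
        · intro z _ hz; simp [walks, hz.symm]
        · intro h; exact absurd hx h
    rw [hKeq]
    have hstep : ∀ x' ∈ nb x, walks nb s x' y * (f x - f y) ^ 2 ≤
        (s + 1) * (K x' + walks nb s x' y * energy nb f x) := by
      intro x' hx'
      have h1 := ih (x := x') fun z hz => hS (mem_ball_succ.2 ⟨x', hx', hz⟩)
      have h2 := sq_le_energy f hx'
      have hw := walks_nonneg (nb := nb) s x' y
      rcases Nat.eq_zero_or_pos s with rfl | hs
      · simp only [walks]
        split_ifs with h
        · subst h; simpa [hK] using h2
        · simp [hK]
      · have hs' : (0 : ℝ) < s := by exact_mod_cast hs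
        have h3 : s * (f x - f y) ^ 2 ≤
            s * (s + 1) * (f x - f x') ^ 2 + (s + 1) * (f x' - f y) ^ 2 := by
          nlinarith [sq_nonneg (s * (f x - f x') - (f x' - f y))]
        have h4 := mul_le_mul_of_nonneg_left h3 hw
        have h5 : walks nb s x' y * (f x - f x') ^ 2 ≤ walks nb s x' y * energy nb f x :=
          mul_le_mul_of_nonneg_left h2 hw
        have h6 := mul_le_mul_of_nonneg_left h1 (by positivity : (0 : ℝ) ≤ s + 1)
        have h7 := mul_le_mul_of_nonneg_left h5 (by positivity : (0 : ℝ) ≤ s * (s + 1))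
        refine le_of_mul_le_mul_left ?_ hs'
        change (s + 1 : ℝ) * _ ≤ (s + 1 : ℝ) * (s * K x') at h6
        linarith
    calc walks nb (s + 1) x y * (f x - f y) ^ 2
        = ∑ x' ∈ nb x, walks nb s x' y * (f x - f y) ^ 2 := by simp only [walks, sum_mul]
      _ ≤ ∑ x' ∈ nb x, (s + 1) * (K x' + walks nb s x' y * energy nb f x) := sum_le_sum hstep
      _ = _ := by
        rw [← mul_sum, sum_add_distrib, ← sum_mul]
        simp only [walks]; push_cast; ring

/-- A Poincaré inequality at scale `s` on a ball of radius `r`. -/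
theorem poincare (f : V → ℝ) (r s : ℕ) (o : V) :
    ∑ x ∈ ball nb r o, ∑ y ∈ ball nb s x, (f x - f y) ^ 2 ≤
      (s : ℝ) ^ 2 * (ball nb s o).card * ∑ z ∈ ball nb (r + s) o, energy nb f z := by
  set S := ball nb (r + s) o
  set m : ℕ → V → V → ℝ := fun i x z =>
    ∑ y ∈ ball nb s x, walks nb i x z * walks nb (s - i) z y / walks nb s x y with hm
  have hsub : ∀ x ∈ ball nb r o, ball nb s x ⊆ S := fun x hx y hy => ball_trans hx hy
  have hpt : ∀ x ∈ ball nb r o, ∀ y ∈ ball nb s x, (f x - f y) ^ 2 ≤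
      s * ∑ i ∈ range s, ∑ z ∈ S,
        walks nb i x z * walks nb (s - i) z y / walks nb s x y * energy nb f z := by
    intro x hx y hy
    have hw : 0 < walks nb s x y := one_pos.trans_le (one_le_walks hy)
    have h := hG.walks_mul_sq_le f s (y := y) (hsub x hx)
    refine le_of_mul_le_mul_left (h.trans_eq ?_) hw
    rw [mul_left_comm]
    congr 1
    rw [mul_sum]
    refine sum_congr rfl fun i _ => ?_
    rw [mul_sum]
    refine sum_congr rfl fun z _ => ?_
    field_simp
  have hrow : ∀ i ∈ range s, ∑ z ∈ ball nb s o, m i o z = (ball nb s o).card := by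
    intro i hi
    have hi' : i ≤ s := (mem_range.1 hi).le
    simp only [hm]
    rw [sum_comm, card_eq_sum_ones, Nat.cast_sum]
    refine sum_congr rfl fun y hy => ?_
    rw [← sum_div, ← walks_add_of_subset i (s - i) (hG.ball_mono hi' o), Nat.add_sub_cancel' hi',
      div_self (one_pos.trans_le (one_le_walks hy)).ne', Nat.cast_one]
  have hcol : ∀ i ∈ range s, ∀ z, ∑ x ∈ ball nb r o, m i x z ≤ (ball nb s o).card := by
    intro i hi z
    rw [← hrow i hi]
    have hi' : i ≤ s := (mem_range.1 hi).le
    refine hG.mass_transport (m i) s ?_ ?_ ?_ _ _ _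
    · intro x y
      simp only [hm]
      exact sum_nonneg fun _ _ => div_nonneg (mul_nonneg (walks_nonneg _ _ _)
        (walks_nonneg _ _ _)) (walks_nonneg _ _ _)
    · intro g x y
      simp only [hm]
      rw [hG.sum_ball_smul]
      simp only [hG.walks_smul]
    · intro x y hy
      refine sum_eq_zero fun u _ => ?_
      rw [walks_eq_zero fun h => hy (hG.ball_mono hi' x h)]
      simp
  calc ∑ x ∈ ball nb r o, ∑ y ∈ ball nb s x, (f x - f y) ^ 2
      ≤ ∑ x ∈ ball nb r o, ∑ y ∈ ball nb s x, s * ∑ i ∈ range s, ∑ z ∈ S,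
        walks nb i x z * walks nb (s - i) z y / walks nb s x y * energy nb f z :=
        sum_le_sum fun x hx => sum_le_sum fun y hy => hpt x hx y hy
    _ = s * ∑ i ∈ range s, ∑ z ∈ S, (∑ x ∈ ball nb r o, m i x z) * energy nb f z := by
        simp only [hm, sum_mul]
        have e1 : ∀ F : V → V → ℕ → V → ℝ,
            ∑ x ∈ ball nb r o, ∑ y ∈ ball nb s x, ∑ i ∈ range s, ∑ z ∈ S, F x y i z =
            ∑ i ∈ range s, ∑ z ∈ S, ∑ x ∈ ball nb r o, ∑ y ∈ ball nb s x, F x y i z := fun F =>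
          calc _ = ∑ x ∈ ball nb r o, ∑ i ∈ range s, ∑ y ∈ ball nb s x, ∑ z ∈ S, F x y i z :=
                sum_congr rfl fun x _ => sum_comm
            _ = ∑ i ∈ range s, ∑ x ∈ ball nb r o, ∑ y ∈ ball nb s x, ∑ z ∈ S, F x y i z :=
                sum_comm
            _ = ∑ i ∈ range s, ∑ x ∈ ball nb r o, ∑ z ∈ S, ∑ y ∈ ball nb s x, F x y i z :=
                sum_congr rfl fun _ _ => sum_congr rfl fun _ _ => sum_comm
            _ = _ := sum_congr rfl fun _ _ => sum_comm
        rw [← e1, mul_sum]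
        exact sum_congr rfl fun x _ => (mul_sum _ _ _).symm
    _ ≤ s * ∑ i ∈ range s, ∑ z ∈ S, ((ball nb s o).card : ℝ) * energy nb f z := by
        refine mul_le_mul_of_nonneg_left ?_ (Nat.cast_nonneg s)
        exact sum_le_sum fun i hi => sum_le_sum fun z _ =>
          mul_le_mul_of_nonneg_right (hcol i hi z) (energy_nonneg _ _)
    _ = _ := by
        rw [sum_const, card_range, nsmul_eq_mul, ← mul_sum]; ring

end Homog

end Graph

section Caccioppoli

variable {V : Type*} [DecidableEq V]

/-- Harmonicity for the two-step simple random walk of the reflexive graph `nb`. -/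
def Harmonic (nb : V → Finset V) (f : V → ℝ) : Prop :=
  ∀ x, ∑ y ∈ ball nb 2 x, walks nb 2 x y * (f x - f y) = 0

/-- The graph distance. -/
noncomputable def gdist (nb : V → Finset V) (x y : V) : ℕ := sInf {n | y ∈ ball nb n x}

variable {Γ : Type*} [Group Γ] [MulAction Γ V] {nb : V → Finset V}

namespace Homog

variable (hG : Homog Γ nb)
include hG

theorem mem_ball_gdist (x y : V) : y ∈ ball nb (gdist nb x y) x := Nat.sInf_mem (hG.conn x y)

omit [DecidableEq V] in
omit hG in
theorem gdist_le [DecidableEq V] {n : ℕ} {x y : V} (h : y ∈ ball nb n x) : gdist nb x y ≤ n :=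
  Nat.sInf_le h

theorem mem_ball_iff_gdist_le {n : ℕ} {x y : V} : y ∈ ball nb n x ↔ gdist nb x y ≤ n :=
  ⟨gdist_le, fun h => hG.ball_mono h x (hG.mem_ball_gdist x y)⟩

theorem gdist_le_add {n : ℕ} {o x y : V} (h : y ∈ ball nb n x) :
    gdist nb o y ≤ gdist nb o x + n :=
  gdist_le (ball_trans (hG.mem_ball_gdist o x) h)

/-- A Lipschitz cutoff function. -/
theorem exists_cutoff (R : ℕ) (hR : 1 ≤ R) (o : V) : ∃ η : V → ℝ, (∀ x ∈ ball nb R o, η x = 1) ∧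
    (∀ x, x ∉ ball nb (2 * R) o → η x = 0) ∧
    ∀ x y, y ∈ ball nb 2 x → (η x - η y) ^ 2 ≤ 4 / (R : ℝ) ^ 2 := by
  have hR0 : (0 : ℝ) < R := by exact_mod_cast hR
  refine ⟨fun x => max 0 (min 1 (2 - gdist nb o x / (R : ℝ))), ?_, ?_, ?_⟩
  · intro x hx
    have : (gdist nb o x : ℝ) ≤ R := by exact_mod_cast gdist_le hx
    have h2 : (gdist nb o x : ℝ) / R ≤ 1 := (div_le_one hR0).2 this
    simp only
    rw [min_eq_left (by linarith), max_eq_right zero_le_one]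
  · intro x hx
    rw [hG.mem_ball_iff_gdist_le, not_le] at hx
    have : (2 * R : ℝ) ≤ gdist nb o x := by exact_mod_cast hx.le
    have h2 : 2 ≤ (gdist nb o x : ℝ) / R := (le_div_iff₀ hR0).2 this
    simp only
    rw [min_eq_right (by linarith), max_eq_left (by linarith)]
  · intro x y h
    have h1 : (gdist nb o y : ℝ) ≤ gdist nb o x + 2 := by exact_mod_cast hG.gdist_le_add h
    have h2 : (gdist nb o x : ℝ) ≤ gdist nb o y + 2 := by
      exact_mod_cast hG.gdist_le_add (hG.mem_ball_comm.1 h)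
    have h3 : |max 0 (min 1 (2 - gdist nb o x / (R : ℝ))) -
        max 0 (min 1 (2 - gdist nb o y / (R : ℝ)))| ≤ 2 / R := by
      refine (abs_max_sub_max_le_max _ _ _ _).trans (max_le (by simp; positivity) ?_)
      refine (abs_min_sub_min_le_max _ _ _ _).trans (max_le (by simp; positivity) ?_)
      rw [show (2 - (gdist nb o x : ℝ) / R - (2 - gdist nb o y / R)) =
        (gdist nb o y - gdist nb o x) / R by ring, abs_div, abs_of_pos hR0]
      gcongr
      rw [abs_le]; constructor <;> linarith
    have := sq_le_sq' (by linarith [neg_abs_le (max 0 (min 1 (2 - gdist nb o x / (R : ℝ))) -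
        max 0 (min 1 (2 - gdist nb o y / (R : ℝ))))]) ((le_abs_self _).trans h3)
    simp only
    refine this.trans_eq ?_
    rw [div_pow]; norm_num

omit hG in
omit [DecidableEq V] in
theorem cutoff_ineq (a b p q : ℝ) :
    1 / 4 * (p ^ 2 + q ^ 2) * (a - b) ^ 2 - (p - q) ^ 2 * (a ^ 2 + b ^ 2) ≤
      (a - b) * (p ^ 2 * a - q ^ 2 * b) := by
  nlinarith [sq_nonneg ((p + q) * (a - b) + 2 * ((p - q) * (a + b))),
    sq_nonneg ((p - q) * (a - b)), mul_nonneg (sq_nonneg (p - q)) (sq_nonneg (a - b))]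

/-- The Caccioppoli inequality for harmonic functions. -/
theorem caccioppoli {f : V → ℝ} (hf : Harmonic nb f) (R : ℕ) (hR : 1 ≤ R) (o : V) :
    ∑ x ∈ ball nb R o, energy nb f x ≤
      32 * ((nb o).card : ℝ) ^ 2 / (R : ℝ) ^ 2 * ∑ x ∈ ball nb (4 * R) o, f x ^ 2 := by
  obtain ⟨η, h1, h0, hη⟩ := hG.exists_cutoff R hR o
  set S := ball nb (4 * R) o
  set w : V → V → ℝ := fun x y => walks nb 2 x y
  have hw0 : ∀ x y, 0 ≤ w x y := fun x y => walks_nonneg 2 x y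
  have hwc : ∀ x y, w x y = w y x := fun x y => hG.walks_comm 2 x y
  have hrow : ∀ x, ∑ y ∈ S, w x y ≤ ((nb o).card : ℝ) ^ 2 := by
    intro x
    rw [hG.card_nb_eq o x, ← hG.sum_walks_of_subset 2 (subset_union_left (s₂ := S))]
    exact sum_le_sum_of_subset_of_nonneg subset_union_right fun _ _ _ => hw0 _ _
  have hSx : ∀ x, η x ≠ 0 → ball nb 2 x ⊆ S := by
    intro x hx y hy
    have hx' : x ∈ ball nb (2 * R) o := by
      by_contra h; exact hx (h0 x h)
    exact hG.ball_mono (by omega) o (ball_trans hx' hy)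
  have hharm : ∀ x, ∑ y ∈ S, w x y * ((f x - f y) * (η x ^ 2 * f x)) = 0 := by
    intro x
    by_cases hx : η x = 0
    · simp [hx]
    · have := hf x
      have e : ∑ y ∈ S, w x y * (f x - f y) = 0 := by
        rw [← this]
        symm
        refine sum_subset (hSx x hx) fun y _ hy => ?_
        rw [walks_eq_zero hy, zero_mul]
      simp only [← mul_assoc]
      rw [← sum_mul, ← sum_mul, e, zero_mul, zero_mul]
  have hzero : ∑ x ∈ S, ∑ y ∈ S, w x y * ((f x - f y) * (η x ^ 2 * f x - η y ^ 2 * f y)) = 0 := by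
    have e : ∑ x ∈ S, ∑ y ∈ S, w x y * ((f x - f y) * (η x ^ 2 * f x - η y ^ 2 * f y)) =
        ∑ x ∈ S, ∑ y ∈ S, w x y * ((f x - f y) * (η x ^ 2 * f x)) +
        ∑ x ∈ S, ∑ y ∈ S, w y x * ((f y - f x) * (η y ^ 2 * f y)) := by
      rw [← sum_add_distrib]
      refine sum_congr rfl fun x _ => ?_
      rw [← sum_add_distrib]
      refine sum_congr rfl fun y _ => ?_
      rw [hwc y x]; ring
    rw [e, sum_comm (f := fun x y => w y x * ((f y - f x) * (η y ^ 2 * f y))),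
      sum_eq_zero fun x _ => hharm x, add_zero]
  have hlow : ∑ x ∈ S, ∑ y ∈ S, w x y * (1 / 4 * (η x ^ 2 + η y ^ 2) * (f x - f y) ^ 2) ≤
      ∑ x ∈ S, ∑ y ∈ S, w x y * (4 / (R : ℝ) ^ 2 * (f x ^ 2 + f y ^ 2)) := by
    rw [← sub_nonpos, ← sum_sub_distrib, ← hzero]
    refine sum_le_sum fun x _ => ?_
    rw [← sum_sub_distrib]
    refine sum_le_sum fun y _ => ?_
    by_cases hy : y ∈ ball nb 2 x
    · rw [← mul_sub]
      refine mul_le_mul_of_nonneg_left (le_trans ?_ (cutoff_ineq _ _ _ _)) (hw0 x y)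
      have := mul_le_mul_of_nonneg_right (hη x y hy) (by positivity : 0 ≤ f x ^ 2 + f y ^ 2)
      linarith
    · have : w x y = 0 := walks_eq_zero hy
      simp [this]
  have hup : ∑ x ∈ S, ∑ y ∈ S, w x y * (4 / (R : ℝ) ^ 2 * (f x ^ 2 + f y ^ 2)) ≤
      8 / (R : ℝ) ^ 2 * ((nb o).card : ℝ) ^ 2 * ∑ x ∈ S, f x ^ 2 := by
    have e : ∑ x ∈ S, ∑ y ∈ S, w x y * (4 / (R : ℝ) ^ 2 * (f x ^ 2 + f y ^ 2)) =
        ∑ x ∈ S, (∑ y ∈ S, w x y) * (4 / (R : ℝ) ^ 2 * f x ^ 2) +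
        ∑ x ∈ S, (∑ y ∈ S, w x y) * (4 / (R : ℝ) ^ 2 * f x ^ 2) := by
      have c : ∑ x ∈ S, (∑ y ∈ S, w x y) * (4 / (R : ℝ) ^ 2 * f x ^ 2) =
          ∑ x ∈ S, ∑ y ∈ S, w y x * (4 / (R : ℝ) ^ 2 * f y ^ 2) := by
        simp only [sum_mul]; rw [sum_comm]
      nth_rewrite 2 [c]
      simp only [sum_mul]
      rw [← sum_add_distrib]
      refine sum_congr rfl fun x _ => ?_
      rw [← sum_add_distrib]
      refine sum_congr rfl fun y _ => ?_
      rw [hwc y x]; ring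
    have e2 : ∑ x ∈ S, (∑ y ∈ S, w x y) * (4 / (R : ℝ) ^ 2 * f x ^ 2) ≤
        ∑ x ∈ S, ((nb o).card : ℝ) ^ 2 * (4 / (R : ℝ) ^ 2 * f x ^ 2) :=
      sum_le_sum fun x _ => mul_le_mul_of_nonneg_right (hrow x) (by positivity)
    rw [← mul_sum, ← mul_sum] at e2
    rw [e]
    calc _ ≤ _ := add_le_add e2 e2
      _ = _ := by ring
  have hleft : 1 / 4 * ∑ x ∈ ball nb R o, energy nb f x ≤
      ∑ x ∈ S, ∑ y ∈ S, w x y * (1 / 4 * (η x ^ 2 + η y ^ 2) * (f x - f y) ^ 2) := by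
    have hnn : ∀ x y, 0 ≤ w x y * (1 / 4 * (η x ^ 2 + η y ^ 2) * (f x - f y) ^ 2) := fun x y =>
      mul_nonneg (hw0 x y) (by positivity)
    rw [mul_sum]
    refine (sum_le_sum fun x hx => ?_).trans (sum_le_sum_of_subset_of_nonneg
      (hG.ball_mono (by omega) o) fun x _ _ => sum_nonneg fun y _ => hnn x y)
    have hxS : ball nb 2 x ⊆ S := hSx x (by rw [h1 x hx]; exact one_ne_zero)
    have hnb : nb x ⊆ ball nb 2 x := by
      rw [← ball_one (nb := nb) x]; exact hG.ball_mono one_le_two x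
    rw [energy, mul_sum]
    refine (sum_le_sum fun y hy => ?_).trans (sum_le_sum_of_subset_of_nonneg
      (hnb.trans hxS) fun y _ _ => hnn x y)
    have hwy : 1 ≤ w x y := one_le_walks (hnb hy)
    rw [h1 x hx]
    have e3 : 1 / 4 * (f x - f y) ^ 2 ≤ 1 / 4 * (1 ^ 2 + η y ^ 2) * (f x - f y) ^ 2 := by
      nlinarith [mul_nonneg (sq_nonneg (η y)) (sq_nonneg (f x - f y))]
    exact e3.trans (le_mul_of_one_le_left (by positivity) hwy)
  have := hleft.trans (hlow.trans hup)
  calc ∑ x ∈ ball nb R o, energy nb f x = 4 * (1 / 4 * ∑ x ∈ ball nb R o, energy nb f x) := by ring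
    _ ≤ 4 * (8 / (R : ℝ) ^ 2 * ((nb o).card : ℝ) ^ 2 * ∑ x ∈ S, f x ^ 2) := by gcongr
    _ = _ := by ring

/-- A maximal separated set in a ball. -/
theorem exists_net (ρ R : ℕ) (o : V) : ∃ X ⊆ ball nb R o,
    ((X : Set V).PairwiseDisjoint (ball nb ρ)) ∧ ∀ x ∈ ball nb R o, ∃ y ∈ X,
      x ∈ ball nb (ρ + ρ) y := by
  classical
  obtain ⟨X, hX, hmax⟩ := exists_max_image ((ball nb R o).powerset.filter fun X : Finset V =>
    (X : Set V).PairwiseDisjoint (ball nb ρ)) card ⟨∅, by simp⟩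
  simp only [mem_filter, mem_powerset] at hX hmax
  refine ⟨X, hX.1, hX.2, fun x hx => ?_⟩
  by_contra! hcon
  have hdis : ∀ y ∈ X, Disjoint (ball nb ρ x) (ball nb ρ y) := by
    intro y hy
    rw [disjoint_left]
    intro z hz hz'
    exact hcon y hy (ball_trans hz' (hG.mem_ball_comm.1 hz))
  have hxX : x ∉ X := fun h => hcon x h (hG.mem_ball_self _ x)
  have := hmax (insert x X) ⟨insert_subset hx hX.1, by
    rw [coe_insert]
    exact hX.2.insert fun y hy _ => hdis y hy⟩
  rw [card_insert_of_notMem hxX] at this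
  omega

/-- Disjoint balls in a large ball. -/
theorem card_mul_le_of_disjoint {ρ M : ℕ} {X : Finset V}
    (hX : (X : Set V).PairwiseDisjoint (ball nb ρ)) (o : V) (hM : ∀ x ∈ X, x ∈ ball nb M o) :
    X.card * (ball nb ρ o).card ≤ (ball nb (M + ρ) o).card := by
  calc X.card * (ball nb ρ o).card = ∑ x ∈ X, (ball nb ρ x).card := by
        rw [sum_congr rfl fun x _ => hG.card_ball_eq ρ x o, sum_const, smul_eq_mul]
    _ = (X.biUnion (ball nb ρ)).card := (card_biUnion hX).symm
    _ ≤ _ := card_le_card <| biUnion_subset.2 fun x hx y hy => ball_trans (hM x hx) hy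

omit hG in
omit [DecidableEq V] in
theorem sum_sq_le_of_sum_eq_zero (f : V → ℝ) (B : Finset V) (h : ∑ x ∈ B, f x = 0) :
    2 * B.card * ∑ x ∈ B, f x ^ 2 = ∑ x ∈ B, ∑ y ∈ B, (f x - f y) ^ 2 := by
  have : ∀ x, ∑ y ∈ B, (f x - f y) ^ 2 = B.card * f x ^ 2 + ∑ y ∈ B, f y ^ 2 := by
    intro x
    calc ∑ y ∈ B, (f x - f y) ^ 2 = ∑ y ∈ B, (f x ^ 2 + f y ^ 2 - 2 * f x * f y) :=
          sum_congr rfl fun y _ => by ring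
      _ = _ := by
        rw [sum_sub_distrib, sum_add_distrib, ← mul_sum, h, sum_const, nsmul_eq_mul]; ring
  rw [sum_congr rfl fun x _ => this x, sum_add_distrib, ← mul_sum, sum_const, nsmul_eq_mul]
  ring

/-- A harmonic function whose averages over the balls of a net vanish grows quickly. -/
theorem sum_sq_le_of_averages {f : V → ℝ} (hf : Harmonic nb f) {ρ R : ℕ} (hρ : 6 * ρ ≤ R)
    (hR : 1 ≤ R) (o : V) {X : Finset V} (hXR : X ⊆ ball nb R o)
    (hX : (X : Set V).PairwiseDisjoint (ball nb ρ))
    (hcov : ∀ x ∈ ball nb R o, ∃ y ∈ X, x ∈ ball nb (ρ + ρ) y)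
    (hav : ∀ x ∈ X, ∑ y ∈ ball nb (ρ + ρ) x, f y = 0) {A : ℝ}
    (hA : ((ball nb (8 * ρ) o).card : ℝ) ≤ A * (ball nb ρ o).card) :
    ∑ x ∈ ball nb R o, f x ^ 2 ≤
      64 * A ^ 2 * ((nb o).card : ℝ) ^ 2 * (ρ / R) ^ 2 * ∑ x ∈ ball nb (8 * R) o, f x ^ 2 := by
  set r := ρ + ρ with hr
  have hBρ : (0 : ℝ) < (ball nb ρ o).card := by exact_mod_cast hG.card_ball_pos ρ o
  have hBr : (0 : ℝ) < (ball nb r o).card := by exact_mod_cast hG.card_ball_pos r o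
  have hBρr : ((ball nb ρ o).card : ℝ) ≤ (ball nb r o).card := by
    exact_mod_cast card_le_card (hG.ball_mono (by omega) o)
  have hB2r : ((ball nb (2 * r) o).card : ℝ) ≤ A * (ball nb r o).card := by
    have : ((ball nb (2 * r) o).card : ℝ) ≤ (ball nb (8 * ρ) o).card := by
      exact_mod_cast card_le_card (hG.ball_mono (by omega) o)
    have hA0 : 0 ≤ A := by
      by_contra! h
      have : (0 : ℝ) ≤ (ball nb (8 * ρ) o).card := Nat.cast_nonneg _
      nlinarith
    exact this.trans (hA.trans (mul_le_mul_of_nonneg_left hBρr hA0))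
  have hA0 : 0 ≤ A := by
    by_contra! h
    have : (0 : ℝ) ≤ (ball nb (8 * ρ) o).card := Nat.cast_nonneg _
    nlinarith
  have hlocal : ∀ x ∈ X, ∑ y ∈ ball nb r x, f y ^ 2 ≤
      2 * (r : ℝ) ^ 2 * A * ∑ z ∈ ball nb (r + 2 * r) x, energy nb f z := by
    intro x hx
    have h1 := sum_sq_le_of_sum_eq_zero f (ball nb r x) (hav x hx)
    have h2 := hG.poincare f r (2 * r) x
    have h3 : ∑ y ∈ ball nb r x, ∑ z ∈ ball nb r x, (f y - f z) ^ 2 ≤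
        ∑ y ∈ ball nb r x, ∑ z ∈ ball nb (2 * r) y, (f y - f z) ^ 2 := by
      refine sum_le_sum fun y hy => sum_le_sum_of_subset_of_nonneg ?_ fun _ _ _ => sq_nonneg _
      intro z hz
      rw [two_mul]
      exact ball_trans (hG.mem_ball_comm.1 hy) hz
    rw [hG.card_ball_eq (2 * r) x o] at h2
    rw [hG.card_ball_eq r x o] at h1
    set E := ∑ z ∈ ball nb (r + 2 * r) x, energy nb f z
    have hE : 0 ≤ E := sum_nonneg fun _ _ => energy_nonneg _ _
    have h4 : ((2 * r : ℕ) : ℝ) ^ 2 * (ball nb (2 * r) o).card * E ≤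
        ((2 * r : ℕ) : ℝ) ^ 2 * (A * (ball nb r o).card) * E := by gcongr
    have h5 := (h1.le.trans h3).trans (h2.trans h4)
    push_cast at h5
    refine le_of_mul_le_mul_left ?_ (by positivity : (0 : ℝ) < 2 * (ball nb r o).card)
    refine h5.trans_eq (by ring)
  have hcover : ∑ x ∈ ball nb R o, f x ^ 2 ≤ ∑ x ∈ X, ∑ y ∈ ball nb r x, f y ^ 2 := by
    calc ∑ x ∈ ball nb R o, f x ^ 2
        ≤ ∑ x ∈ ball nb R o, ∑ y ∈ X, if x ∈ ball nb r y then f x ^ 2 else 0 := by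
          refine sum_le_sum fun x hx => ?_
          obtain ⟨y, hy, hxy⟩ := hcov x hx
          refine le_trans ?_ (single_le_sum (fun y _ => ?_) hy)
          · rw [if_pos hxy]
          · split_ifs <;> positivity
      _ = ∑ y ∈ X, ∑ x ∈ ball nb R o, if x ∈ ball nb r y then f x ^ 2 else 0 := sum_comm
      _ ≤ _ := by
          refine sum_le_sum fun y _ => ?_
          rw [← sum_filter]
          exact sum_le_sum_of_subset_of_nonneg (fun x hx => (mem_filter.1 hx).2)
            fun _ _ _ => sq_nonneg _
  have hoverlap : ∑ x ∈ X, ∑ z ∈ ball nb (r + 2 * r) x, energy nb f z ≤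
      A * ∑ z ∈ ball nb (2 * R) o, energy nb f z := by
    have e : ∀ x ∈ X, ∑ z ∈ ball nb (r + 2 * r) x, energy nb f z =
        ∑ z ∈ ball nb (2 * R) o, if x ∈ ball nb (r + 2 * r) z then energy nb f z else 0 := by
      intro x hx
      rw [← sum_filter]
      congr 1
      ext z
      rw [mem_filter, hG.mem_ball_comm (x := x)]
      refine ⟨fun h => ⟨?_, h⟩, fun h => h.2⟩
      exact hG.ball_mono (by omega) o (ball_trans (hXR hx) (hG.mem_ball_comm.1 h))
    rw [sum_congr rfl e, sum_comm, mul_sum]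
    refine sum_le_sum fun z _ => ?_
    rw [← sum_filter, sum_const, nsmul_eq_mul]
    refine mul_le_mul_of_nonneg_right ?_ (energy_nonneg _ _)
    have := hG.card_mul_le_of_disjoint (ρ := ρ) (M := r + 2 * r)
      (X := X.filter fun x => x ∈ ball nb (r + 2 * r) z)
      (hX.subset (by intro x hx; exact (mem_filter.1 hx).1)) z (fun x hx => (mem_filter.1 hx).2)
    rw [hG.card_ball_eq ρ z o, hG.card_ball_eq _ z o] at this
    have h2 : (ball nb (r + 2 * r + ρ) o).card ≤ (ball nb (8 * ρ) o).card :=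
      card_le_card (hG.ball_mono (by omega) o)
    have h3 : ((X.filter fun x => x ∈ ball nb (r + 2 * r) z).card : ℝ) * (ball nb ρ o).card ≤
        (ball nb (8 * ρ) o).card := by exact_mod_cast this.trans h2
    exact le_of_mul_le_mul_right (h3.trans hA) hBρ
  have hcac := hG.caccioppoli hf (2 * R) (by omega) o
  rw [show 4 * (2 * R) = 8 * R by ring] at hcac
  have hR0 : (0 : ℝ) < R := by exact_mod_cast hR
  calc ∑ x ∈ ball nb R o, f x ^ 2 ≤ ∑ x ∈ X, ∑ y ∈ ball nb r x, f y ^ 2 := hcover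
    _ ≤ ∑ x ∈ X, 2 * (r : ℝ) ^ 2 * A * ∑ z ∈ ball nb (r + 2 * r) x, energy nb f z :=
      sum_le_sum hlocal
    _ = 2 * (r : ℝ) ^ 2 * A * ∑ x ∈ X, ∑ z ∈ ball nb (r + 2 * r) x, energy nb f z :=
      (mul_sum _ _ _).symm
    _ ≤ 2 * (r : ℝ) ^ 2 * A * (A * (32 * ((nb o).card : ℝ) ^ 2 / ((2 * R : ℕ) : ℝ) ^ 2 *
        ∑ x ∈ ball nb (8 * R) o, f x ^ 2)) := by
      refine mul_le_mul_of_nonneg_left (hoverlap.trans ?_) (by positivity)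
      exact mul_le_mul_of_nonneg_left hcac hA0
    _ = _ := by
      rw [hr]; push_cast; field_simp; ring

end Homog

end Caccioppoli

section Determinant

open Matrix

variable {n : Type*} [Fintype n] [DecidableEq n]

omit [DecidableEq n] in
theorem prod_le_mean_pow (z : n → ℝ) (hz : ∀ i, 0 ≤ z i) [Nonempty n] :
    ∏ i, z i ≤ ((∑ i, z i) / Fintype.card n) ^ Fintype.card n := by
  have hc : (0 : ℝ) < Fintype.card n := by exact_mod_cast Fintype.card_pos
  have h := Real.geom_mean_le_arith_mean_weighted univ (fun _ => (Fintype.card n : ℝ)⁻¹) z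
    (fun _ _ => by positivity) (by simp) (fun i _ => hz i)
  rw [← mul_sum, Real.finsetProd_rpow univ z (fun i _ => hz i)] at h
  have h2 := pow_le_pow_left₀ (Real.rpow_nonneg (prod_nonneg fun i _ => hz i) _) h (Fintype.card n)
  rw [Real.rpow_inv_natCast_pow (prod_nonneg fun i _ => hz i) Fintype.card_ne_zero] at h2
  rwa [inv_mul_eq_div] at h2

theorem exists_transpose_mul_mul_eq_diagonal {A : Matrix n n ℝ} (hA : A.IsHermitian) :
    ∃ U : Matrix n n ℝ, Uᵀ * U = 1 ∧ Uᵀ * A * U = diagonal hA.eigenvalues := by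
  refine ⟨hA.eigenvectorUnitary, ?_, ?_⟩
  · have := Unitary.coe_star_mul_self hA.eigenvectorUnitary
    rwa [star_eq_conjTranspose, conjTranspose_eq_transpose_of_trivial] at this
  · have h := hA.conjStarAlgAut_star_eigenvectorUnitary
    rw [Unitary.conjStarAlgAut_apply] at h
    simp only [star_star, Unitary.coe_star] at h
    rw [star_eq_conjTranspose, conjTranspose_eq_transpose_of_trivial] at h
    exact h

theorem exists_simultaneous_diagonal {A B : Matrix n n ℝ} (hA : A.IsHermitian) (hB : B.PosDef) :
    ∃ (Q : Matrix n n ℝ) (l : n → ℝ), Qᵀ * B * Q = 1 ∧ Qᵀ * A * Q = diagonal l := by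
  obtain ⟨U, hU, hUB⟩ := exists_transpose_mul_mul_eq_diagonal hB.1
  set b := hB.1.eigenvalues
  have hb : ∀ i, 0 < b i := hB.eigenvalues_pos
  set P := U * diagonal fun i => (√(b i))⁻¹ with hP
  have hPB : Pᵀ * B * P = 1 := by
    have : Pᵀ * B * P = diagonal (fun i => (√(b i))⁻¹) * (Uᵀ * B * U) *
        diagonal fun i => (√(b i))⁻¹ := by
      rw [hP, transpose_mul, diagonal_transpose]; simp only [Matrix.mul_assoc]
    rw [this, hUB, diagonal_mul_diagonal, diagonal_mul_diagonal, ← diagonal_one]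
    congr 1
    funext i
    have := Real.mul_self_sqrt (hb i).le
    have h0 := (Real.sqrt_pos.2 (hb i)).ne'
    field_simp
    rw [sq]; exact this.symm
  have hPA : (Pᵀ * A * P).IsHermitian := by
    have := isHermitian_conjTranspose_mul_mul P hA
    rwa [conjTranspose_eq_transpose_of_trivial] at this
  obtain ⟨W, hW, hWA⟩ := exists_transpose_mul_mul_eq_diagonal hPA
  refine ⟨P * W, hPA.eigenvalues, ?_, ?_⟩
  · calc (P * W)ᵀ * B * (P * W) = Wᵀ * (Pᵀ * B * P) * W := by
          rw [transpose_mul]; simp only [Matrix.mul_assoc]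
      _ = 1 := by rw [hPB, Matrix.mul_one, hW]
  · rw [← hWA, transpose_mul]; simp only [Matrix.mul_assoc]

/-- Comparison of determinants of two forms, one of which is small off a small codimension. -/
theorem det_le_of_le_of_codim {κ : Type*} [Fintype κ] [Nonempty n] {A B : Matrix n n ℝ}
    (hA : A.PosSemidef) (hB : B.PosDef) (hAB : ∀ x, x ⬝ᵥ A *ᵥ x ≤ x ⬝ᵥ B *ᵥ x) {ε : ℝ}
    (hε : 0 ≤ ε) (T : (n → ℝ) →ₗ[ℝ] (κ → ℝ))
    (hT : ∀ x, T x = 0 → x ⬝ᵥ A *ᵥ x ≤ ε * (x ⬝ᵥ B *ᵥ x)) :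
    A.det ≤ (Fintype.card κ / Fintype.card n + ε) ^ Fintype.card n * B.det := by
  classical
  obtain ⟨Q, l, hQB, hQA⟩ := exists_simultaneous_diagonal hA.1 hB
  have hqf : ∀ (M : Matrix n n ℝ) c, (Q *ᵥ c) ⬝ᵥ M *ᵥ (Q *ᵥ c) = c ⬝ᵥ (Qᵀ * M * Q) *ᵥ c := by
    intro M c
    rw [Matrix.mul_assoc, ← mulVec_mulVec, dotProduct_mulVec c, vecMul_transpose, mulVec_mulVec]
  have hqA : ∀ c, (Q *ᵥ c) ⬝ᵥ A *ᵥ (Q *ᵥ c) = ∑ i, l i * c i ^ 2 := by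
    intro c
    rw [hqf, hQA]
    simp only [dotProduct, mulVec_diagonal]
    exact sum_congr rfl fun i _ => by ring
  have hqB : ∀ c, (Q *ᵥ c) ⬝ᵥ B *ᵥ (Q *ᵥ c) = ∑ i, c i ^ 2 := by
    intro c
    rw [hqf, hQB]
    simp only [dotProduct, one_mulVec]
    exact sum_congr rfl fun i _ => by ring
  have hl0 : ∀ i, 0 ≤ l i := by
    intro i
    have := hA.dotProduct_mulVec_nonneg (Q *ᵥ Pi.single i 1)
    rw [star_trivial, hqA, sum_eq_single i (fun j _ hj => by simp [hj]) (by simp)] at this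
    simpa using this
  have hl1 : ∀ i, l i ≤ 1 := by
    intro i
    have := hAB (Q *ᵥ Pi.single i 1)
    rw [hqA, hqB, sum_eq_single i (fun j _ hj => by simp [hj]) (by simp),
      sum_eq_single i (fun j _ hj => by simp [hj]) (by simp)] at this
    simpa using this
  set I := univ.filter fun i => ε < l i with hI
  have hcard : I.card ≤ Fintype.card κ := by
    by_contra! hlt
    let E : (I → ℝ) →ₗ[ℝ] (n → ℝ) :=
      { toFun := fun c i => if h : i ∈ I then c ⟨i, h⟩ else 0
        map_add' := fun c c' => by funext i; by_cases h : i ∈ I <;> simp [h]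
        map_smul' := fun a c => by funext i; by_cases h : i ∈ I <;> simp [h] }
    have hker : LinearMap.ker (T ∘ₗ Q.mulVecLin ∘ₗ E) ≠ ⊥ := by
      apply LinearMap.ker_ne_bot_of_finrank_lt
      simpa using hlt
    obtain ⟨c, hc, hc0⟩ := (Submodule.ne_bot_iff _).1 hker
    have h1 := hT (Q *ᵥ E c) (by simpa using hc)
    rw [hqA, hqB, mul_sum] at h1
    obtain ⟨i, hi⟩ : ∃ i, c i ≠ 0 := by
      by_contra! h; exact hc0 (funext h)
    have h2 : ∑ i, ε * E c i ^ 2 < ∑ i, l i * E c i ^ 2 := by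
      refine sum_lt_sum (fun j _ => ?_) ⟨i, mem_univ _, ?_⟩
      · by_cases h : j ∈ I
        · exact mul_le_mul_of_nonneg_right (mem_filter.1 h).2.le (sq_nonneg _)
        · simp [E, h]
      · have : E c i = c i := by simp [E]
        rw [this]
        exact mul_lt_mul_of_pos_right (mem_filter.1 i.2).2 (by positivity)
    linarith
  have hsum : ∑ i, l i ≤ Fintype.card κ + ε * Fintype.card n := by
    calc ∑ i, l i ≤ ∑ i, ((if i ∈ I then 1 else 0) + ε) := by
          refine sum_le_sum fun i _ => ?_
          split_ifs with h
          · linarith [hl1 i]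
          · rw [hI, mem_filter, not_and, not_lt] at h
            linarith [h (mem_univ i)]
      _ = I.card + ε * Fintype.card n := by
          rw [sum_add_distrib, sum_const, card_univ, nsmul_eq_mul, sum_ite_mem, univ_inter,
            sum_const, nsmul_eq_mul]; ring
      _ ≤ _ := by gcongr
  have hdB : Q.det ^ 2 * B.det = 1 := by
    have := congrArg det hQB
    rw [det_mul, det_mul, det_transpose, det_one] at this
    linarith
  have hdA : Q.det ^ 2 * A.det = ∏ i, l i := by
    have := congrArg det hQA
    rw [det_mul, det_mul, det_transpose, det_diagonal] at this
    linarith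
  have hAeq : A.det = (∏ i, l i) * B.det := by
    rw [← hdA]; linear_combination -A.det * hdB
  rw [hAeq]
  refine mul_le_mul_of_nonneg_right ?_ hB.det_pos.le
  refine (prod_le_mean_pow l hl0).trans ?_
  have hc : (0 : ℝ) < Fintype.card n := by exact_mod_cast Fintype.card_pos
  refine pow_le_pow_left₀ (div_nonneg (sum_nonneg fun i _ => hl0 i) hc.le) ?_ _
  rw [div_le_iff₀ hc, add_mul, div_mul_cancel₀ _ hc.ne']
  exact hsum

end Determinant

/-- Choice of good scales for a sequence of linear growth. -/
theorem exists_good_scale {h : ℕ → ℝ} {j₀ : ℕ} (hmono : ∀ j ≥ j₀, h j ≤ h (j + 1)) {c L : ℝ}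
    (hL : ∀ j ≥ j₀, h j ≤ c + L * j) (p : ℕ) :
    ∃ j ≥ j₀, h (j + 1) - h j ≤ 3 * L + 1 ∧ h (j + p + 1) - h (j + p) ≤ 3 * L + 1 ∧
      h (j + p + 1) - h j ≤ (p + 1) * (3 * L + 1) := by
  by_contra! hcon
  set Φ : ℕ → ℝ := fun j => (p + 1) * h j + (p + 1) * h (j + p) + ∑ i ∈ range (p + 1), h (j + i)
    with hΦ
  have hmono' : ∀ j ≥ j₀, ∀ i, h j ≤ h (j + i) := by
    intro j hj i
    induction i with
    | zero => exact le_rfl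
    | succ i ih => exact ih.trans (hmono _ (by omega))
  have hp : (0 : ℝ) < p + 1 := by positivity
  have hstep : ∀ j ≥ j₀, Φ j + (p + 1) * (3 * L + 1) ≤ Φ (j + 1) := by
    intro j hj
    have e : ∑ i ∈ range (p + 1), h (j + 1 + i) = ∑ i ∈ range (p + 1), h (j + i) +
        (h (j + p + 1) - h j) := by
      have e1 := sum_range_succ (fun i => h (j + i)) (p + 1)
      have e2 := sum_range_succ' (fun i => h (j + i)) (p + 1)
      have e3 : ∑ i ∈ range (p + 1), h (j + 1 + i) = ∑ i ∈ range (p + 1), h (j + (i + 1)) :=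
        sum_congr rfl fun i _ => by congr 1; ring
      rw [e3]
      simp only [add_zero] at e2
      rw [show j + (p + 1) = j + p + 1 by ring] at e1
      linarith
    have m1 := hmono j hj
    have m2 := hmono (j + p) (by omega)
    have m3 := hmono' j hj (p + 1)
    rw [show j + (p + 1) = j + p + 1 by ring] at m3
    simp only [hΦ]
    rw [e, show j + 1 + p = j + p + 1 by ring]
    by_cases c1 : h (j + 1) - h j ≤ 3 * L + 1
    · by_cases c2 : h (j + p + 1) - h (j + p) ≤ 3 * L + 1
      · have := hcon j hj c1 c2
        nlinarith
      · nlinarith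
    · nlinarith
  have hsteps : ∀ n : ℕ, Φ j₀ + n * ((p + 1) * (3 * L + 1)) ≤ Φ (j₀ + n) := by
    intro n
    induction n with
    | zero => simp
    | succ n ih =>
      have := hstep (j₀ + n) (by omega)
      push_cast
      rw [← add_assoc j₀ n 1]
      linarith
  have hup : ∀ n : ℕ, Φ (j₀ + n) ≤ (p + 1) * (3 * (c + L * (j₀ + n + p : ℕ))) := by
    intro n
    have b := hL (j₀ + n + p) (by omega)
    have s : ∑ i ∈ range (p + 1), h (j₀ + n + i) ≤ (p + 1) * h (j₀ + n + p) := by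
      calc _ ≤ ∑ i ∈ range (p + 1), h (j₀ + n + p) := by
            refine sum_le_sum fun i hi => ?_
            have hi' := mem_range.1 hi
            have := hmono' (j₀ + n + i) (by omega) (p - i)
            rwa [show j₀ + n + i + (p - i) = j₀ + n + p by omega] at this
        _ = _ := by rw [sum_const, card_range, nsmul_eq_mul]; push_cast; ring
    have m := hmono' (j₀ + n) (by omega) p
    simp only [hΦ]
    nlinarith
  obtain ⟨n, hn⟩ := exists_nat_gt (3 * (c + L * (j₀ + p)) - Φ j₀ / (p + 1))
  have h1 := (hsteps n).trans (hup n)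
  push_cast at h1
  have h2 : Φ j₀ = (p + 1) * (Φ j₀ / (p + 1)) := by field_simp
  rw [h2] at h1
  have h3 : Φ j₀ / (p + 1) + n * (3 * L + 1) ≤ 3 * (c + L * (j₀ + n + p)) := by
    refine le_of_mul_le_mul_left ?_ hp
    linarith
  nlinarith

section FiniteDim

open Matrix

variable {V : Type*} [DecidableEq V]

/-- The space of Lipschitz harmonic functions. -/
def lipHarm (nb : V → Finset V) : Submodule ℝ (V → ℝ) where
  carrier := {f | Harmonic nb f ∧ ∃ c, ∀ x, ∀ y ∈ nb x, |f x - f y| ≤ c}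
  zero_mem' := ⟨fun x => by simp, 0, by simp⟩
  add_mem' := by
    rintro f g ⟨hf, c, hc⟩ ⟨hg, c', hc'⟩
    refine ⟨fun x => ?_, c + c', fun x y hy => ?_⟩
    · have := congrArg₂ (· + ·) (hf x) (hg x)
      simp only [← sum_add_distrib, ← mul_add, add_zero] at this
      rw [← this]
      exact sum_congr rfl fun y _ => by simp only [Pi.add_apply]; ring
    · have := abs_add_le (f x - f y) (g x - g y)
      rw [show (f + g) x - (f + g) y = f x - f y + (g x - g y) by
        simp only [Pi.add_apply]; ring]
      linarith [hc x y hy, hc' x y hy]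
  smul_mem' := by
    rintro a f ⟨hf, c, hc⟩
    refine ⟨fun x => ?_, |a| * c, fun x y hy => ?_⟩
    · have := congrArg (a * ·) (hf x)
      simp only [mul_zero, mul_sum] at this
      rw [← this]
      exact sum_congr rfl fun y _ => by simp only [Pi.smul_apply, smul_eq_mul]; ring
    · simp only [Pi.smul_apply, smul_eq_mul]
      rw [← mul_sub, abs_mul]
      exact mul_le_mul_of_nonneg_left (hc x y hy) (abs_nonneg a)

variable {Γ : Type*} [Group Γ] [MulAction Γ V] {nb : V → Finset V}

theorem abs_sub_le_of_mem_ball {f : V → ℝ} {c : ℝ} (hc : ∀ x, ∀ y ∈ nb x, |f x - f y| ≤ c)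
    {n : ℕ} {x y : V} (h : y ∈ ball nb n x) : |f x - f y| ≤ n * c := by
  induction n generalizing x with
  | zero => rw [mem_ball_zero] at h; simp [h]
  | succ n ih =>
    obtain ⟨z, hz, hy⟩ := mem_ball_succ.1 h
    have := abs_sub_le (f x) (f z) (f y)
    push_cast
    linarith [hc x z hz, ih hy]

/-- The Gram matrix of a family of functions on a ball. -/
def gram {ι : Type*} (nb : V → Finset V) (o : V) (u : ι → V → ℝ) (n : ℕ) : Matrix ι ι ℝ :=
  fun a b => ∑ x ∈ ball nb n o, u a x * u b x

theorem gram_quadratic {ι : Type*} [Fintype ι] (o : V) (u : ι → V → ℝ) (n : ℕ) (c : ι → ℝ) :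
    c ⬝ᵥ gram nb o u n *ᵥ c = ∑ x ∈ ball nb n o, (∑ a, c a • u a) x ^ 2 := by
  simp only [gram, dotProduct, mulVec, mul_sum, sum_mul, Finset.sum_apply, Pi.smul_apply,
    smul_eq_mul, sq]
  rw [sum_congr rfl fun a _ => sum_comm, sum_comm]
  refine sum_congr rfl fun x _ => ?_
  rw [sum_comm]
  exact sum_congr rfl fun a _ => sum_congr rfl fun b _ => by ring

theorem gram_posSemidef {ι : Type*} [Fintype ι] (o : V) (u : ι → V → ℝ) (n : ℕ) :
    (gram nb o u n).PosSemidef := by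
  refine PosSemidef.of_dotProduct_mulVec_nonneg ?_ fun c => ?_
  · ext a b
    simp only [gram, conjTranspose_apply, star_trivial]
    exact sum_congr rfl fun x _ => mul_comm _ _
  · rw [star_trivial, gram_quadratic]
    exact sum_nonneg fun _ _ => sq_nonneg _

theorem exists_gram_det_le {ι : Type*} [Fintype ι] [DecidableEq ι] (o : V) {u : ι → V → ℝ}
    (hu : ∀ a, u a ∈ lipHarm nb) {C d : ℕ}
    (hC : ∀ n, 1 ≤ n → ∀ x, (ball nb n x).card ≤ C * n ^ d) :
    ∃ M : ℝ, 1 ≤ M ∧ ∀ n, 1 ≤ n → (gram nb o u n).det ≤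
      M * ((M * (n : ℝ) ^ (d + 2)) ^ Fintype.card ι) := by
  choose c hc using fun a => (hu a).2
  set B : ℝ := ∑ a, (|u a o| + |c a|) with hB
  have hB0 : 0 ≤ B := sum_nonneg fun a _ => by positivity
  have hBa : ∀ a, |u a o| + |c a| ≤ B := fun a =>
    single_le_sum (f := fun a => |u a o| + |c a|) (fun a _ => by positivity) (mem_univ a)
  have hval : ∀ a n, 1 ≤ n → ∀ x ∈ ball nb n o, |u a x| ≤ B * n := by
    intro a n hn x hx
    have h1 := abs_sub_le_of_mem_ball (hc a) hx
    have h2 : |u a x| ≤ |u a o| + |u a o - u a x| := by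
      have := abs_sub_abs_le_abs_sub (u a x) (u a o)
      rw [abs_sub_comm (u a o)]; linarith
    have hn' : (1 : ℝ) ≤ n := by exact_mod_cast hn
    have h3 : (n : ℝ) * c a ≤ n * |c a| := by gcongr; exact le_abs_self _
    nlinarith [hBa a, abs_nonneg (u a o), abs_nonneg (c a)]
  have hent : ∀ n, 1 ≤ n → ∀ a b, |gram nb o u n a b| ≤ C * B ^ 2 * (n : ℝ) ^ (d + 2) := by
    intro n hn a b
    calc |gram nb o u n a b| ≤ ∑ x ∈ ball nb n o, |u a x * u b x| := abs_sum_le_sum_abs _ _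
      _ ≤ ∑ x ∈ ball nb n o, (B * n) * (B * n) := by
          refine sum_le_sum fun x hx => ?_
          rw [abs_mul]
          exact mul_le_mul (hval a n hn x hx) (hval b n hn x hx) (abs_nonneg _) (by positivity)
      _ = (ball nb n o).card * (B * n) ^ 2 := by rw [sum_const, nsmul_eq_mul, sq]
      _ ≤ (C * n ^ d : ℕ) * (B * n) ^ 2 := by
          gcongr; exact hC n hn o
      _ = _ := by push_cast; ring
  set M : ℝ := max 1 (max (Fintype.card ι).factorial (C * B ^ 2))
  refine ⟨M, le_max_left _ _, fun n hn => ?_⟩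
  have h := Matrix.det_le (abv := AbsoluteValue.abs) (hent n hn)
  rw [nsmul_eq_mul] at h
  refine ((le_abs_self _).trans h).trans ?_
  have e1 : ((Fintype.card ι).factorial : ℝ) ≤ M := (le_max_left _ _).trans (le_max_right _ _)
  have e2 : (C : ℝ) * B ^ 2 ≤ M := (le_max_right _ _).trans (le_max_right _ _)
  gcongr

namespace Homog

variable (hG : Homog Γ nb)
include hG

theorem exists_gram_posDef {ι : Type*} [Fintype ι] (o : V) {u : ι → V → ℝ}
    (hu : LinearIndependent ℝ u) : ∃ N, ∀ n ≥ N, (gram nb o u n).PosDef := by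
  let K : ℕ →o (Submodule ℝ (ι → ℝ))ᵒᵈ :=
    { toFun := fun n => OrderDual.toDual
        { carrier := {c | ∀ x ∈ ball nb n o, (∑ a, c a • u a) x = 0}
          zero_mem' := by intro x _; simp
          add_mem' := by
            intro c c' h h' x hx
            simp only [Pi.add_apply, add_smul, sum_add_distrib]
            rw [h x hx, h' x hx, add_zero]
          smul_mem' := by
            intro r c h x hx
            have := h x hx
            simp only [Pi.smul_apply, smul_assoc, ← smul_sum] at *
            rw [this, smul_zero] }
      monotone' := fun m n hmn c hc x hx => hc x (hG.ball_mono hmn o hx) }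
  obtain ⟨N, hN⟩ := IsArtinian.monotone_stabilizes K
  refine ⟨N, fun n hn => ?_⟩
  refine PosDef.of_dotProduct_mulVec_pos (gram_posSemidef o u n).1 fun c hc => ?_
  rw [star_trivial, gram_quadratic]
  by_contra! hle
  apply hc
  have h0 := (sum_eq_zero_iff_of_nonneg fun x _ => sq_nonneg _).1
    (le_antisymm hle (sum_nonneg fun x _ => sq_nonneg _))
  have hcN : c ∈ OrderDual.ofDual (K N) := by
    rw [hN n hn]
    exact fun x hx => pow_eq_zero_iff two_ne_zero |>.1 (h0 x hx)
  have hall : ∑ a, c a • u a = 0 := by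
    funext x
    obtain ⟨m, hm⟩ := hG.conn o x
    have : c ∈ OrderDual.ofDual (K (max N m)) := by
      rw [← hN _ (le_max_left N m)]; exact hcN
    exact this x (hG.ball_mono (le_max_right N m) o hm)
  exact funext (Fintype.linearIndependent_iff.1 hu c hall)

/-- A linearly independent family of Lipschitz harmonic functions has bounded size. -/
theorem exists_card_le : ∃ D₀ : ℕ, ∀ s : Finset (lipHarm nb),
    LinearIndependent ℝ (fun i : s => (i : lipHarm nb)) → s.card ≤ D₀ := by
  classical
  rcases isEmpty_or_nonempty V with hV | ⟨⟨o⟩⟩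
  · refine ⟨0, fun s hs => ?_⟩
    by_contra! h
    obtain ⟨f, hf⟩ := card_pos.1 h
    exact hs.ne_zero ⟨f, hf⟩ (Subtype.ext (funext fun x => hV.elim x))
  obtain ⟨C, d, hC⟩ := hG.growth
  set k : ℝ := ((nb o).card : ℝ)
  set L : ℝ := (2 * d + 2) * Real.log 8 with hL
  set A : ℝ := Real.exp (3 * L + 1) with hA
  have hA0 : 0 < A := Real.exp_pos _
  obtain ⟨p, hp1, hp⟩ : ∃ p : ℕ, 1 ≤ p ∧
      64 * A ^ 2 * k ^ 2 * ((1 / 8 : ℝ) ^ p) ^ 2 ≤ 1 / (4 * A) := by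
    have ht : Filter.Tendsto (fun p : ℕ => 64 * A ^ 2 * k ^ 2 * ((1 / 8 : ℝ) ^ p) ^ 2)
        Filter.atTop (nhds 0) := by
      have := ((tendsto_pow_atTop_nhds_zero_of_lt_one (r := (1 / 8 : ℝ)) (by norm_num)
        (by norm_num)).pow 2).const_mul (64 * A ^ 2 * k ^ 2)
      simpa using this
    obtain ⟨p, hp, hp1⟩ := ((ht.eventually (ge_mem_nhds (by positivity : 0 < 1 / (4 * A)))).and
      (Filter.eventually_ge_atTop 1)).exists
    exact ⟨p, hp1, hp⟩
  obtain ⟨D₀, hD₀⟩ := exists_nat_ge (4 * A * A ^ (p + 1))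
  refine ⟨D₀, fun s hs => ?_⟩
  by_contra! hlt
  have hDpos : 0 < s.card := by omega
  have : Nonempty s := (card_pos.1 hDpos).to_subtype
  set u : s → V → ℝ := fun i => ((i : lipHarm nb) : V → ℝ) with hu
  have hmem : ∀ i, u i ∈ lipHarm nb := fun i => (i : lipHarm nb).2
  have hind : LinearIndependent ℝ u := hs.map' (lipHarm nb).subtype (Submodule.ker_subtype _)
  obtain ⟨N, hN⟩ := hG.exists_gram_posDef o hind
  obtain ⟨M, hM1, hM⟩ := exists_gram_det_le o hmem hC
  set D : ℝ := (s.card : ℝ) with hD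
  have hD0 : 0 < D := Nat.cast_pos.2 hDpos
  have hcardD : Fintype.card s = s.card := Fintype.card_coe s
  set G : ℕ → Matrix s s ℝ := fun j => gram nb o u (8 ^ j) with hGr
  set b : ℕ → ℝ := fun j => ((ball nb (8 ^ j) o).card : ℝ) with hb
  have hbpos : ∀ j, 0 < b j := fun j => Nat.cast_pos.2 (hG.card_ball_pos _ o)
  have hpd : ∀ j ≥ N, (G j).PosDef := fun j hj =>
    hN _ (hj.trans (Nat.lt_pow_self (by norm_num)).le)
  have hbmono : ∀ i j, i ≤ j → b i ≤ b j := fun i j hij =>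
    Nat.cast_le.2 (card_le_card (hG.ball_mono (Nat.pow_le_pow_right (by norm_num) hij) o))
  have hqmono : ∀ j c, c ⬝ᵥ G j *ᵥ c ≤ c ⬝ᵥ G (j + 1) *ᵥ c := by
    intro j c
    simp only [hGr, gram_quadratic]
    exact sum_le_sum_of_subset_of_nonneg
      (hG.ball_mono (Nat.pow_le_pow_right (by norm_num) (Nat.le_succ j)) o)
      fun _ _ _ => sq_nonneg _
  have hdmono : ∀ j ≥ N, (G j).det ≤ (G (j + 1)).det := by
    intro j hj
    have := det_le_of_le_of_codim (κ := Empty) (hpd j hj).posSemidef (hpd (j + 1) (by omega))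
      (hqmono j) zero_le_one 0 (fun x _ => by rw [one_mul]; exact hqmono j x)
    simpa using this
  set h : ℕ → ℝ := fun j => Real.log (b j) + Real.log (G j).det / D with hh
  have hl1 : ∀ j, Real.log (b j) ≤ Real.log (b (j + 1)) := fun j =>
    Real.log_le_log (hbpos j) (hbmono _ _ (Nat.le_succ j))
  have hl2 : ∀ j ≥ N, Real.log (G j).det / D ≤ Real.log (G (j + 1)).det / D := fun j hj => by
    have := Real.log_le_log (hpd j hj).det_pos (hdmono j hj)
    gcongr
  have hhmono : ∀ j ≥ N, h j ≤ h (j + 1) := fun j hj => add_le_add (hl1 j) (hl2 j hj)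
  have hC1 : (1 : ℝ) ≤ C := by
    have h1 := hC 1 le_rfl o
    have h2 := hG.card_ball_pos 1 o
    rw [one_pow, mul_one] at h1
    exact_mod_cast h2.trans_le h1
  have hhub : ∀ j ≥ N, h j ≤ (Real.log C + Real.log M / D + Real.log M) + L * j := by
    intro j hj
    have h8 : ((8 ^ j : ℕ) : ℝ) = 8 ^ j := by push_cast; rfl
    have hlog8 : ∀ e : ℕ, Real.log (((8 : ℝ) ^ j) ^ e) = e * (j * Real.log 8) := by
      intro e; rw [Real.log_pow, Real.log_pow]
    have i1 : Real.log (b j) ≤ Real.log C + d * (j * Real.log 8) := by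
      rw [← hlog8, ← Real.log_mul (by positivity) (by positivity)]
      refine Real.log_le_log (hbpos j) ?_
      rw [← h8, ← Nat.cast_pow, ← Nat.cast_mul]
      exact Nat.cast_le.2 (hC _ (Nat.one_le_pow _ _ (by norm_num)) o)
    have i2 : Real.log (G j).det ≤ Real.log M + D * (Real.log M + (d + 2) * (j * Real.log 8)) := by
      have := Real.log_le_log (hpd j hj).det_pos (hM (8 ^ j) (Nat.one_le_pow _ _ (by norm_num)))
      rw [h8, hcardD, Real.log_mul (by positivity) (by positivity), Real.log_pow,
        Real.log_mul (by positivity) (by positivity), hlog8] at this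
      push_cast at this
      exact this
    have i3 : Real.log (G j).det / D ≤
        Real.log M / D + (Real.log M + (d + 2) * (j * Real.log 8)) := by
      rw [div_le_iff₀ hD0, add_mul, div_mul_cancel₀ _ hD0.ne']
      linarith
    simp only [hh]
    rw [hL]
    linarith
  obtain ⟨j, hj, g1, g2, g3⟩ := exists_good_scale hhmono hhub p
  have r1 : b (j + 1) ≤ A * b j := by
    have : Real.log (b (j + 1)) ≤ 3 * L + 1 + Real.log (b j) := by
      simp only [hh] at g1; linarith [hl2 j hj]
    have := Real.exp_le_exp.2 this
    rwa [Real.exp_log (hbpos _), Real.exp_add, Real.exp_log (hbpos _)] at this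
  have r2 : (G (j + p + 1)).det ≤ A ^ s.card * (G (j + p)).det := by
    have q1 : Real.log (G (j + p + 1)).det / D - Real.log (G (j + p)).det / D ≤ 3 * L + 1 := by
      simp only [hh] at g2; linarith [hl1 (j + p)]
    have q2 : Real.log (G (j + p + 1)).det ≤ s.card * (3 * L + 1) + Real.log (G (j + p)).det := by
      rw [← sub_div, div_le_iff₀ hD0] at q1
      linarith
    have := Real.exp_le_exp.2 q2
    rwa [Real.exp_log (hpd _ (by omega)).det_pos, Real.exp_add,
      Real.exp_log (hpd _ (by omega)).det_pos, Real.exp_nat_mul] at this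
  have r3 : b (j + p + 1) ≤ A ^ (p + 1) * b j := by
    have dmono : Real.log (G j).det / D ≤ Real.log (G (j + p + 1)).det / D := by
      have : ∀ i, Real.log (G j).det / D ≤ Real.log (G (j + i)).det / D := by
        intro i
        induction i with
        | zero => exact le_rfl
        | succ i ih => exact ih.trans (hl2 _ (by omega))
      exact this (p + 1)
    have : Real.log (b (j + p + 1)) ≤ (p + 1 : ℕ) * (3 * L + 1) + Real.log (b j) := by
      simp only [hh] at g3; push_cast; linarith
    have := Real.exp_le_exp.2 this
    rwa [Real.exp_log (hbpos _), Real.exp_add, Real.exp_log (hbpos _), Real.exp_nat_mul] at this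
  obtain ⟨X, hXR, hXd, hXc⟩ := hG.exists_net (8 ^ j) (8 ^ (j + p)) o
  have hX : (X.card : ℝ) ≤ A ^ (p + 1) := by
    have h1 := hG.card_mul_le_of_disjoint hXd o (M := 8 ^ (j + p)) fun x hx => hXR hx
    have h2 : (ball nb (8 ^ (j + p) + 8 ^ j) o).card ≤ (ball nb (8 ^ (j + p + 1)) o).card := by
      refine card_le_card (hG.ball_mono ?_ o)
      have : 8 ^ j ≤ 8 ^ (j + p) := Nat.pow_le_pow_right (by norm_num) (by omega)
      rw [pow_succ]; omega
    have h3 : (X.card : ℝ) * b j ≤ b (j + p + 1) := by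
      simp only [hb]
      exact_mod_cast h1.trans h2
    exact le_of_mul_le_mul_right (h3.trans r3) (hbpos j)
  let T : (s → ℝ) →ₗ[ℝ] (X → ℝ) :=
    { toFun := fun c x => ∑ y ∈ ball nb (8 ^ j + 8 ^ j) x, (∑ a, c a • u a) y
      map_add' := fun c c' => by
        funext x
        simp only [Pi.add_apply, add_smul, sum_add_distrib]
      map_smul' := fun r c => by
        funext x
        simp only [Pi.smul_apply, smul_assoc, ← smul_sum, RingHom.id_apply] }
  set ε : ℝ := 64 * A ^ 2 * k ^ 2 * ((1 / 8 : ℝ) ^ p) ^ 2 with hε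
  have hsmall : ∀ c, T c = 0 → c ⬝ᵥ G (j + p) *ᵥ c ≤ ε * (c ⬝ᵥ G (j + p + 1) *ᵥ c) := by
    intro c hc
    simp only [hGr, gram_quadratic]
    have hf : (∑ a, c a • u a) ∈ lipHarm nb :=
      Submodule.sum_mem _ fun a _ => Submodule.smul_mem _ _ (hmem a)
    have := hG.sum_sq_le_of_averages hf.1 (ρ := 8 ^ j) (R := 8 ^ (j + p)) ?_
      (Nat.one_le_pow _ _ (by norm_num)) o hXR hXd hXc (fun x hx => congrFun hc ⟨x, hx⟩) (A := A) ?_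
    · refine this.trans_eq ?_
      rw [pow_succ' 8 (j + p)]
      congr 2
      push_cast
      rw [pow_add, one_div, inv_pow]
      field_simp
    · calc 6 * 8 ^ j ≤ 8 ^ (j + 1) := by rw [pow_succ]; omega
        _ ≤ 8 ^ (j + p) := Nat.pow_le_pow_right (by norm_num) (by omega)
    · rw [← pow_succ']; exact r1
  have hdet := det_le_of_le_of_codim (hpd (j + p) (by omega)).posSemidef
    (hpd (j + p + 1) (by omega)) (hqmono (j + p)) (by positivity : 0 ≤ ε) T hsmall
  rw [Fintype.card_coe, hcardD] at hdet
  have hpos := (hpd (j + p) (by omega)).det_pos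
  have hq : (X.card : ℝ) / s.card + ε ≤ 1 / (2 * A) := by
    have e1 : (X.card : ℝ) / D ≤ 1 / (4 * A) := by
      rw [div_le_div_iff₀ hD0 (by positivity), one_mul]
      have : (D₀ : ℝ) ≤ D := Nat.cast_le.2 hlt.le
      nlinarith
    have e2 : 1 / (2 * A) = 1 / (4 * A) + 1 / (4 * A) := by field_simp; norm_num
    rw [e2]
    exact add_le_add e1 hp
  have hfin : (G (j + p)).det ≤ (1 / 2) ^ s.card * (G (j + p)).det := by
    calc (G (j + p)).det ≤ ((X.card : ℝ) / s.card + ε) ^ s.card * (G (j + p + 1)).det := hdet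
      _ ≤ (1 / (2 * A)) ^ s.card * (A ^ s.card * (G (j + p)).det) := by
          gcongr
          exact (hpd _ (by omega)).det_pos.le
      _ = _ := by
          rw [← mul_assoc, ← mul_pow]
          congr 2
          field_simp
  have hlt1 : (1 / 2 : ℝ) ^ s.card < 1 := pow_lt_one₀ (by norm_num) (by norm_num) hDpos.ne'
  nlinarith

theorem finiteDimensional_lipHarm : FiniteDimensional ℝ (lipHarm nb) := by
  obtain ⟨D₀, hD⟩ := hG.exists_card_le
  have h : Module.rank ℝ (lipHarm nb) ≤ D₀ := rank_le hD
  exact Module.rank_lt_aleph0_iff.1 (h.trans_lt (Cardinal.natCast_lt_aleph0))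

end Homog

end FiniteDim

section Existence

variable {V : Type*} [DecidableEq V]

/-- The transition probabilities of the simple random walk. -/
noncomputable def prob (nb : V → Finset V) (n : ℕ) (x y : V) : ℝ :=
  walks nb n x y / ((nb x).card : ℝ) ^ n

variable {Γ : Type*} [Group Γ] [MulAction Γ V] {nb : V → Finset V}

theorem prob_nonneg (n : ℕ) (x y : V) : 0 ≤ prob nb n x y :=
  div_nonneg (walks_nonneg n x y) (by positivity)

theorem one_div_le_prob {n : ℕ} {x y : V} (h : y ∈ ball nb n x) :
    1 / ((nb x).card : ℝ) ^ n ≤ prob nb n x y :=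
  div_le_div_of_nonneg_right (one_le_walks h) (by positivity)

namespace Homog

variable (hG : Homog Γ nb)
include hG

theorem card_nb_pos (x : V) : (0 : ℝ) < (nb x).card :=
  Nat.cast_pos.2 (card_pos.2 ⟨x, hG.self_mem x⟩)

theorem prob_add_of_subset (m n : ℕ) {x y : V} {S : Finset V} (hS : ball nb m x ⊆ S) :
    prob nb (m + n) x y = ∑ z ∈ S, prob nb m x z * prob nb n z y := by
  simp only [prob]
  rw [walks_add_of_subset m n hS, sum_div]
  refine sum_congr rfl fun z _ => ?_
  rw [hG.card_nb_eq z x, pow_add, div_mul_div_comm]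

theorem prob_comm (n : ℕ) (x y : V) : prob nb n x y = prob nb n y x := by
  rw [prob, prob, hG.walks_comm, hG.card_nb_eq x y]

theorem sum_prob_of_subset (n : ℕ) {x : V} {S : Finset V} (hS : ball nb n x ⊆ S) :
    ∑ y ∈ S, prob nb n x y = 1 := by
  simp only [prob]
  rw [← sum_div, hG.sum_walks_of_subset n hS, div_self]
  exact pow_ne_zero _ (hG.card_nb_pos x).ne'

theorem prob_self (n : ℕ) (x y : V) : prob nb n x x = prob nb n y y := by
  obtain ⟨g, rfl⟩ := hG.trans x y
  rw [prob, prob, hG.walks_smul, hG.card_nb_eq x (g • x)]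

theorem sum_prob_mul_prob (m n : ℕ) {x y : V} {S : Finset V} (hS : ball nb m x ⊆ S) :
    ∑ z ∈ S, prob nb m x z * prob nb n y z = prob nb (m + n) x y := by
  rw [hG.prob_add_of_subset m n hS]
  exact sum_congr rfl fun z _ => by rw [hG.prob_comm n y z]

theorem sum_sq_prob_sub (n : ℕ) {x y : V} (o : V) {S : Finset V} (hx : ball nb n x ⊆ S)
    (hy : ball nb n y ⊆ S) : ∑ z ∈ S, (prob nb n x z - prob nb n y z) ^ 2 =
      2 * (prob nb (n + n) o o - prob nb (n + n) x y) := by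
  have e : ∀ z, (prob nb n x z - prob nb n y z) ^ 2 = prob nb n x z * prob nb n x z
      - 2 * (prob nb n x z * prob nb n y z) + prob nb n y z * prob nb n y z := fun z => by ring
  simp only [e, sum_add_distrib, sum_sub_distrib, ← mul_sum]
  rw [hG.sum_prob_mul_prob n n hx, hG.sum_prob_mul_prob n n hx, hG.sum_prob_mul_prob n n hy,
    hG.prob_self _ x o, hG.prob_self _ y o]
  ring

theorem prob_le_prob_self (n : ℕ) (o x y : V) : prob nb (n + n) x y ≤ prob nb (n + n) o o := by
  have h := hG.sum_sq_prob_sub n o (S := ball nb n x ∪ ball nb n y) subset_union_left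
    subset_union_right
  have := sum_nonneg fun z (_ : z ∈ ball nb n x ∪ ball nb n y) =>
    sq_nonneg (prob nb n x z - prob nb n y z)
  linarith

/-- The decrease of the return probability. -/
theorem prob_self_sub (n : ℕ) (o x : V) :
    prob nb (n + n) o o - prob nb (n + 2 + n) o o =
      ∑ y ∈ ball nb 2 x, prob nb 2 x y * (prob nb (n + n) o o - prob nb (n + n) x y) := by
  simp only [mul_sub, sum_sub_distrib]
  rw [← sum_mul, hG.sum_prob_of_subset 2 subset_rfl, one_mul,
    show n + 2 + n = 2 + (n + n) by ring, hG.prob_self _ o x, hG.prob_self _ o x,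
    hG.prob_add_of_subset 2 (n + n) subset_rfl]
  congr 1
  exact sum_congr rfl fun y _ => by rw [hG.prob_comm (n + n) x y]

theorem prob_self_sub_nonneg (n : ℕ) (o : V) :
    0 ≤ prob nb (n + n) o o - prob nb (n + 2 + n) o o := by
  rw [hG.prob_self_sub n o o]
  exact sum_nonneg fun y _ =>
    mul_nonneg (prob_nonneg _ _ _) (sub_nonneg.2 (hG.prob_le_prob_self n o o y))

theorem prob_self_sub_le (n : ℕ) (o : V) {x y : V} (h : y ∈ ball nb 2 x) :
    prob nb (n + n) o o - prob nb (n + n) x y ≤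
      ((nb o).card : ℝ) ^ 2 * (prob nb (n + n) o o - prob nb (n + 2 + n) o o) := by
  have h1 := one_div_le_prob h
  have h2 := hG.prob_self_sub n o x
  have h3 := single_le_sum (f := fun y => prob nb 2 x y *
    (prob nb (n + n) o o - prob nb (n + n) x y)) (fun y _ =>
      mul_nonneg (prob_nonneg _ _ _) (sub_nonneg.2 (hG.prob_le_prob_self n o x y))) h
  rw [← h2] at h3
  have h4 := mul_le_mul_of_nonneg_right h1 (sub_nonneg.2 (hG.prob_le_prob_self n o x y))
  rw [hG.card_nb_eq x o] at h4
  have hk : (0 : ℝ) < ((nb o).card : ℝ) ^ 2 := pow_pos (hG.card_nb_pos o) 2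
  have := h4.trans h3
  rw [one_div, inv_mul_le_iff₀ hk] at this
  exact this

theorem prob_self_sub_le_sq (n : ℕ) (o : V) {R : ℕ} {x y : V} (h : y ∈ ball nb R x) :
    prob nb (n + n) o o - prob nb (n + n) x y ≤ (R : ℝ) ^ 2 *
      (((nb o).card : ℝ) ^ 2 * (prob nb (n + n) o o - prob nb (n + 2 + n) o o)) := by
  induction R generalizing x with
  | zero =>
    rw [mem_ball_zero] at h
    rw [h, hG.prob_self _ x o]; simp
  | succ R ih =>
    obtain ⟨z, hz, hy⟩ := mem_ball_succ.1 h
    have h1 := hG.prob_self_sub_le n o (hG.ball_mono one_le_two x (by rwa [ball_one]) : z ∈ _)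
    have h2 := ih hy
    set D := ((nb o).card : ℝ) ^ 2 * (prob nb (n + n) o o - prob nb (n + 2 + n) o o)
    rcases R.eq_zero_or_pos with rfl | hR
    · rw [mem_ball_zero] at hy
      subst hy
      simpa using h1
    set S := ball nb n x ∪ ball nb n y ∪ ball nb n z
    have sx : ball nb n x ⊆ S := subset_union_left.trans subset_union_left
    have sy : ball nb n y ⊆ S := subset_union_right.trans subset_union_left
    have sz : ball nb n z ⊆ S := subset_union_right
    have exz := hG.sum_sq_prob_sub n o sx sz
    have ezy := hG.sum_sq_prob_sub n o sz sy
    have exy := hG.sum_sq_prob_sub n o sx sy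
    have hR' : (0 : ℝ) < R := Nat.cast_pos.2 hR
    have key : ∑ w ∈ S, (prob nb n x w - prob nb n y w) ^ 2 ≤
        (1 + R) * ∑ w ∈ S, (prob nb n x w - prob nb n z w) ^ 2 +
        (1 + 1 / R) * ∑ w ∈ S, (prob nb n z w - prob nb n y w) ^ 2 := by
      rw [mul_sum, mul_sum, ← sum_add_distrib]
      refine sum_le_sum fun w _ => ?_
      set a := prob nb n x w - prob nb n z w
      set b := prob nb n z w - prob nb n y w
      rw [show prob nb n x w - prob nb n y w = a + b by ring]
      have : (1 + (R : ℝ)) * a ^ 2 + (1 + 1 / R) * b ^ 2 - (a + b) ^ 2 =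
          (R * a - b) ^ 2 / R := by field_simp; ring
      have h0 : 0 ≤ (R * a - b) ^ 2 / R := by positivity
      linarith
    rw [exz, ezy, exy] at key
    have e1 : (1 + (R : ℝ)) * (2 * (prob nb (n + n) o o - prob nb (n + n) x z)) ≤
      (1 + R) * (2 * D) := by gcongr
    have e2 : (1 + 1 / (R : ℝ)) * (2 * (prob nb (n + n) o o - prob nb (n + n) z y)) ≤
      (1 + 1 / R) * (2 * ((R : ℝ) ^ 2 * D)) := by gcongr
    have e3 : (1 + (R : ℝ)) * (2 * D) + (1 + 1 / R) * (2 * ((R : ℝ) ^ 2 * D)) =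
      2 * ((R + 1) ^ 2 * D) := by field_simp; ring
    push_cast
    linarith

theorem lt_card_ball [Infinite V] (n : ℕ) (x : V) : n < (ball nb n x).card := by
  induction n with
  | zero => exact hG.card_ball_pos 0 x
  | succ n ih =>
    by_contra! hle
    have heq : ball nb n x = ball nb (n + 1) x :=
      eq_of_subset_of_card_le (hG.ball_mono n.le_succ x) (by omega)
    have hall : ∀ m, ball nb (n + m) x = ball nb n x := by
      intro m
      induction m with
      | zero => rfl
      | succ m ihm =>
        refine (subset_antisymm ?_ (hG.ball_mono (by omega) x))
        intro y hy
        rw [← add_assoc] at hy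
        obtain ⟨z, hz, hy⟩ := mem_ball_add.1 hy
        rw [ihm] at hz
        rw [heq]
        exact mem_ball_add.2 ⟨z, hz, hy⟩
    refine Set.infinite_univ.not_finite ((ball nb n x).finite_toSet.subset fun y _ => ?_)
    obtain ⟨m, hm⟩ := hG.conn x y
    rw [← hall m]
    exact hG.ball_mono (by omega) x hm

theorem one_le_card_mul_prob (n : ℕ) (o : V) :
    1 ≤ ((ball nb n o).card : ℝ) * prob nb (n + n) o o := by
  have h1 := hG.sum_prob_of_subset n (x := o) subset_rfl
  have h2 := sq_sum_le_card_mul_sum_sq (s := ball nb n o) (f := fun z => prob nb n o z)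
  rw [h1, one_pow] at h2
  rw [← hG.sum_prob_mul_prob n n (subset_rfl : ball nb n o ⊆ _)]
  simpa only [sq] using h2

theorem card_mul_sub_le (n R : ℕ) (o : V) :
    ((ball nb R o).card : ℝ) * (prob nb (n + n) o o - (R : ℝ) ^ 2 *
      (((nb o).card : ℝ) ^ 2 * (prob nb (n + n) o o - prob nb (n + 2 + n) o o))) ≤ 1 := by
  have h1 := hG.sum_prob_of_subset (n + n) (x := o)
    (S := ball nb (n + n) o ∪ ball nb R o) subset_union_left
  calc _ = ∑ x ∈ ball nb R o, (prob nb (n + n) o o - (R : ℝ) ^ 2 *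
      (((nb o).card : ℝ) ^ 2 * (prob nb (n + n) o o - prob nb (n + 2 + n) o o))) := by
        rw [sum_const, nsmul_eq_mul]
    _ ≤ ∑ x ∈ ball nb R o, prob nb (n + n) o x :=
        sum_le_sum fun x hx => by linarith [hG.prob_self_sub_le_sq n o hx]
    _ ≤ ∑ x ∈ ball nb (n + n) o ∪ ball nb R o, prob nb (n + n) o x :=
        sum_le_sum_of_subset_of_nonneg subset_union_right fun _ _ _ => prob_nonneg _ _ _
    _ = 1 := h1

/-- A polynomial lower bound for the decrease of the return probabilities. -/
theorem one_le_mul_prob_sub [Infinite V] (o : V) : ∃ C : ℝ, ∃ d : ℕ, 0 < C ∧ ∀ n : ℕ, 1 ≤ n →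
    1 ≤ C * (n : ℝ) ^ d * (prob nb (n + n) o o - prob nb (n + 2 + n) o o) := by
  obtain ⟨C, d, hC⟩ := hG.growth
  have hC1 : (1 : ℝ) ≤ C := by
    have h1 := hC 1 le_rfl o
    have h2 := hG.card_ball_pos 1 o
    rw [one_pow, mul_one] at h1
    exact_mod_cast h2.trans_le h1
  have hk := hG.card_nb_pos o
  refine ⟨8 * ((nb o).card : ℝ) ^ 2 * (C : ℝ) ^ 3, 3 * d, by positivity, fun n hn => ?_⟩
  set b := (ball nb n o).card with hb
  have hD := hG.prob_self_sub_nonneg n o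
  have ha := hG.one_le_card_mul_prob n o
  have hR := hG.card_mul_sub_le n (2 * b) o
  set D := prob nb (n + n) o o - prob nb (n + 2 + n) o o
  set a := prob nb (n + n) o o
  have hbC : (b : ℝ) ≤ C * (n : ℝ) ^ d := by exact_mod_cast hC n hn o
  have hb0 : (0 : ℝ) < b := Nat.cast_pos.2 (hG.card_ball_pos n o)
  have hR2 : (2 * b : ℝ) ≤ ((ball nb (2 * b) o).card : ℝ) := by
    exact_mod_cast (hG.lt_card_ball (2 * b) o).le
  push_cast at hR
  have key : 1 ≤ 8 * ((nb o).card : ℝ) ^ 2 * (b : ℝ) ^ 3 * D := by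
    by_contra! hlt
    have h1 : (1 : ℝ) / 2 < b * (a - (2 * b) ^ 2 * (((nb o).card : ℝ) ^ 2 * D)) := by
      linarith
    have h2 : 0 < a - (2 * b) ^ 2 * (((nb o).card : ℝ) ^ 2 * D) := by
      by_contra! h; nlinarith
    have h3 := mul_le_mul_of_nonneg_right hR2 h2.le
    linarith
  calc (1 : ℝ) ≤ 8 * ((nb o).card : ℝ) ^ 2 * (b : ℝ) ^ 3 * D := key
    _ ≤ 8 * ((nb o).card : ℝ) ^ 2 * (C * (n : ℝ) ^ d) ^ 3 * D := by gcongr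
    _ = _ := by ring

theorem exists_second_difference_le [Infinite V] (o : V) {ε : ℝ} (hε : 0 < ε) :
    ∃ n : ℕ, 0 < prob nb (n + n) o o - prob nb (n + 2 + n) o o ∧
      prob nb (n + n) o o - 2 * prob nb (n + 2 + n) o o +
      prob nb (n + 2 + (n + 2)) o o ≤
      ε * (prob nb (n + n) o o - prob nb (n + 2 + n) o o) := by
  obtain ⟨C, d, hC0, hC⟩ := hG.one_le_mul_prob_sub o
  set D : ℕ → ℝ := fun n => prob nb (n + n) o o - prob nb (n + 2 + n) o o with hD
  have hpos : ∀ n, 1 ≤ n → 0 < D n := by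
    intro n hn
    by_contra! h
    have h' : D n = 0 := le_antisymm h (hG.prob_self_sub_nonneg n o)
    have := hC n hn
    simp only [hD] at h'
    rw [h', mul_zero] at this
    linarith
  by_contra! hlt
  have hstep : ∀ n, 1 ≤ n → D (n + 1) ≤ (1 - ε) * D n := by
    intro n hn
    have := hlt n (hpos n hn)
    have e1 : n + 1 + (n + 1) = n + 2 + n := by ring
    have e2 : n + 1 + 2 + (n + 1) = n + 2 + (n + 2) := by ring
    simp only [hD, e1, e2]
    linarith
  have hr : 0 ≤ 1 - ε := by
    by_contra! h
    nlinarith [hstep 1 le_rfl, hpos 2 one_le_two, hpos 1 le_rfl]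
  have hpow : ∀ n, D (n + 1) ≤ (1 - ε) ^ n * D 1 := by
    intro n
    induction n with
    | zero => simp
    | succ n ih =>
      calc _ ≤ _ := hstep (n + 1) (by omega)
        _ ≤ (1 - ε) * ((1 - ε) ^ n * D 1) := by gcongr
        _ = _ := by ring
  have hD1 := hpos 1 le_rfl
  have := le_of_pow_le_poly_mul_pow (a := 1) (C := C * 2 ^ d * D 1) (d := d) hr fun n hn => by
    have hn' : (1 : ℝ) ≤ n := by exact_mod_cast hn
    have h1 := hC (n + 1) (by omega)
    calc (1 : ℝ) ^ n = 1 := one_pow n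
      _ ≤ C * ((n + 1 : ℕ) : ℝ) ^ d * D (n + 1) := h1
      _ ≤ C * (2 * n : ℝ) ^ d * ((1 - ε) ^ n * D 1) := by
          gcongr
          · exact (hpos _ (by omega)).le
          · push_cast; linarith
          · exact hpow n
      _ = _ := by rw [mul_pow]; ring
  linarith

/-- Almost harmonic functions with a uniform Lipschitz bound, separating points near `o`. -/
theorem exists_almost_harmonic [Infinite V] (o : V) {ε : ℝ} (hε : 0 < ε) :
    ∃ u : V → ℝ, u o = 0 ∧
      (∀ x, ∀ y ∈ nb x, |u x - u y| ≤ 2 * ((nb o).card : ℝ) ^ 2) ∧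
      (∀ x, |∑ y ∈ ball nb 2 x, prob nb 2 x y * (u x - u y)| ≤ ε) ∧
      2 ≤ ∑ w ∈ ball nb 2 o, |u w| := by
  set k : ℝ := ((nb o).card : ℝ) with hk
  have hk0 : 0 < k := hG.card_nb_pos o
  obtain ⟨n, hD0, hn⟩ := hG.exists_second_difference_le o
    (show 0 < ε ^ 2 / (2 * k ^ 2) by positivity)
  have hDx := hG.prob_self_sub n o
  have hDle := fun {x y} => hG.prob_self_sub_le n o (x := x) (y := y)
  set D := prob nb (n + n) o o - prob nb (n + 2 + n) o o with hD
  obtain ⟨w, hw, hwD⟩ : ∃ w ∈ ball nb 2 o, D ≤ prob nb (n + n) o o - prob nb (n + n) o w := by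
    obtain ⟨w, hw, h⟩ := exists_le_of_sum_le (s := ball nb 2 o) ⟨o, hG.mem_ball_self 2 o⟩
      (f := fun y => prob nb 2 o y * D)
      (g := fun y => prob nb 2 o y * (prob nb (n + n) o o - prob nb (n + n) o y))
      (by rw [← hDx o, ← sum_mul, hG.sum_prob_of_subset 2 subset_rfl, one_mul])
    refine ⟨w, hw, le_of_mul_le_mul_left h ?_⟩
    exact (one_div_pos.2 (pow_pos (hG.card_nb_pos o) 2)).trans_le (one_div_le_prob hw)
  set p : V → ℝ := fun x => prob nb (n + n) x o - prob nb (n + n) x w with hp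
  have hLip : ∀ x, ∀ y ∈ ball nb 2 x, |p x - p y| ≤ 2 * k ^ 2 * D := by
    intro x y hy
    refine abs_le_of_sq_le_sq ?_ (by positivity)
    set S := ball nb n x ∪ ball nb n y ∪ (ball nb n o ∪ ball nb n w)
    have sx : ball nb n x ⊆ S := subset_union_left.trans subset_union_left
    have sy : ball nb n y ⊆ S := subset_union_right.trans subset_union_left
    have so : ball nb n o ⊆ S := subset_union_left.trans subset_union_right
    have sw : ball nb n w ⊆ S := subset_union_right.trans subset_union_right
    have hcs := sum_mul_sq_le_sq_mul_sq S (fun z => prob nb n x z - prob nb n y z)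
      (fun z => prob nb n o z - prob nb n w z)
    have e : ∑ z ∈ S, (prob nb n x z - prob nb n y z) * (prob nb n o z - prob nb n w z)
        = p x - p y := by
      simp only [sub_mul, mul_sub, sum_sub_distrib]
      rw [hG.sum_prob_mul_prob n n sx, hG.sum_prob_mul_prob n n sx,
        hG.sum_prob_mul_prob n n sy, hG.sum_prob_mul_prob n n sy]
      simp only [hp]
      ring
    rw [e, hG.sum_sq_prob_sub n o sx sy, hG.sum_sq_prob_sub n o so sw] at hcs
    refine hcs.trans ?_
    have h1 := hDle hy
    have h2 := hDle hw
    have h0 := sub_nonneg.2 (hG.prob_le_prob_self n o x y)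
    have h0' := sub_nonneg.2 (hG.prob_le_prob_self n o o w)
    calc _ ≤ (2 * (k ^ 2 * D)) * (2 * (k ^ 2 * D)) := by gcongr
      _ = _ := by ring
  have hharm : ∀ x, |∑ y ∈ ball nb 2 x, prob nb 2 x y * (p x - p y)| ≤ ε * D := by
    intro x
    refine abs_le_of_sq_le_sq ?_ (by positivity)
    set S := ball nb (n + 2) x ∪ (ball nb n o ∪ ball nb n w)
    have sx' : ball nb (n + 2) x ⊆ S := subset_union_left
    have sx : ball nb n x ⊆ S := (hG.ball_mono (by omega) x).trans subset_union_left
    have so : ball nb n o ⊆ S := subset_union_left.trans subset_union_right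
    have sw : ball nb n w ⊆ S := subset_union_right.trans subset_union_right
    have hcs := sum_mul_sq_le_sq_mul_sq S (fun z => prob nb n x z - prob nb (n + 2) x z)
      (fun z => prob nb n o z - prob nb n w z)
    have e : ∑ z ∈ S, (prob nb n x z - prob nb (n + 2) x z) * (prob nb n o z - prob nb n w z)
        = ∑ y ∈ ball nb 2 x, prob nb 2 x y * (p x - p y) := by
      have e1 : ∀ v, ∑ y ∈ ball nb 2 x, prob nb 2 x y * prob nb (n + n) y v =
          prob nb (n + 2 + n) x v := by
        intro v
        rw [show n + 2 + n = 2 + (n + n) by ring, hG.prob_add_of_subset 2 (n + n) subset_rfl]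
      simp only [sub_mul, mul_sub, sum_sub_distrib]
      rw [hG.sum_prob_mul_prob n n sx, hG.sum_prob_mul_prob n n sx,
        hG.sum_prob_mul_prob (n + 2) n sx', hG.sum_prob_mul_prob (n + 2) n sx', ← sum_mul,
        hG.sum_prob_of_subset 2 subset_rfl]
      simp only [hp, mul_sub, sum_sub_distrib, e1]
      ring
    have e2 : ∑ z ∈ S, (prob nb n x z - prob nb (n + 2) x z) ^ 2 =
        prob nb (n + n) o o - 2 * prob nb (n + 2 + n) o o + prob nb (n + 2 + (n + 2)) o o := by
      have : ∀ z, (prob nb n x z - prob nb (n + 2) x z) ^ 2 = prob nb n x z * prob nb n x z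
        - 2 * (prob nb (n + 2) x z * prob nb n x z)
        + prob nb (n + 2) x z * prob nb (n + 2) x z := fun z => by ring
      simp only [this, sum_add_distrib, sum_sub_distrib, ← mul_sum]
      rw [hG.sum_prob_mul_prob n n sx, hG.sum_prob_mul_prob (n + 2) n sx',
        hG.sum_prob_mul_prob (n + 2) (n + 2) sx', hG.prob_self (n + n) x o,
        hG.prob_self (n + 2 + n) x o, hG.prob_self (n + 2 + (n + 2)) x o]
    rw [e, e2, hG.sum_sq_prob_sub n o so sw] at hcs
    refine hcs.trans ?_
    have h2 := hDle hw
    have h0' := sub_nonneg.2 (hG.prob_le_prob_self n o o w)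
    calc _ ≤ (ε ^ 2 / (2 * k ^ 2) * D) * (2 * (k ^ 2 * D)) := by gcongr
      _ = _ := by field_simp
  refine ⟨fun x => (p x - p o) / D, by simp, fun x y hy => ?_, fun x => ?_, ?_⟩
  · rw [← sub_div, sub_sub_sub_cancel_right, abs_div, abs_of_pos hD0, div_le_iff₀ hD0]
    exact hLip x y (hG.ball_mono one_le_two x (by rwa [ball_one]))
  · simp only [← sub_div, sub_sub_sub_cancel_right, ← mul_div_assoc]
    rw [← sum_div, abs_div, abs_of_pos hD0, div_le_iff₀ hD0]
    exact hharm x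
  · refine le_trans ?_ (single_le_sum (f := fun w => |(p w - p o) / D|)
      (fun _ _ => abs_nonneg _) hw)
    rw [abs_div, abs_of_pos hD0, le_div_iff₀ hD0, abs_sub_comm]
    refine le_trans ?_ (le_abs_self _)
    simp only [hp]
    rw [hG.prob_self _ w o, hG.prob_comm _ w o]
    linarith

theorem exists_nonconstant_lipHarm [Infinite V] :
    ∃ f ∈ lipHarm nb, ∃ x y, f x ≠ f y := by
  obtain ⟨o⟩ := (inferInstance : Nonempty V)
  set k : ℝ := ((nb o).card : ℝ) with hk
  choose u hu0 hLip hharm hnc using fun j : ℕ =>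
    hG.exists_almost_harmonic o (show (0 : ℝ) < 1 / ((j : ℝ) + 1) by positivity)
  have hbd : ∀ j x, u j x ∈ Set.Icc (-(gdist nb o x * (2 * k ^ 2)))
      (gdist nb o x * (2 * k ^ 2)) := by
    intro j x
    have := abs_sub_le_of_mem_ball (hLip j) (hG.mem_ball_gdist o x)
    rw [hu0, zero_sub, abs_neg] at this
    exact abs_le.1 this
  let F : Filter ℕ := (Filter.hyperfilter ℕ : Filter ℕ)
  have hF : F ≤ Filter.atTop := Nat.hyperfilter_le_atTop
  have hcpt : IsCompact (Set.univ.pi fun x =>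
      Set.Icc (-(gdist nb o x * (2 * k ^ 2))) (gdist nb o x * (2 * k ^ 2))) :=
    isCompact_univ_pi fun x => isCompact_Icc
  obtain ⟨f, -, hf⟩ := hcpt.ultrafilter_le_nhds ((Filter.hyperfilter ℕ).map u) (by
    rw [Filter.le_principal_iff]
    exact Filter.mem_map.2 (Filter.Eventually.of_forall fun j x _ => hbd j x))
  have hlim : ∀ x, Filter.Tendsto (fun j => u j x) F (nhds (f x)) :=
    tendsto_pi_nhds.1 hf
  have hlim0 : Filter.Tendsto (fun j : ℕ => 1 / ((j : ℝ) + 1)) F (nhds 0) :=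
    tendsto_one_div_add_atTop_nhds_zero_nat.mono_left hF
  refine ⟨f, ⟨fun x => ?_, 2 * k ^ 2, fun x y hy => ?_⟩, ?_⟩
  · have h1 : |∑ y ∈ ball nb 2 x, prob nb 2 x y * (f x - f y)| ≤ 0 :=
      le_of_tendsto_of_tendsto' (tendsto_finsetSum _ fun y _ =>
        ((hlim x).sub (hlim y)).const_mul _).abs hlim0 fun j => hharm j x
    have h2 := abs_nonpos_iff.1 h1
    simp only [prob, div_mul_eq_mul_div] at h2
    rw [← sum_div, div_eq_zero_iff] at h2
    exact h2.resolve_right (pow_pos (hG.card_nb_pos x) 2).ne'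
  · exact le_of_tendsto' ((hlim x).sub (hlim y)).abs fun j => hLip j x y hy
  · by_contra! hc
    have h1 : 2 ≤ ∑ w ∈ ball nb 2 o, |f w| :=
      ge_of_tendsto' (tendsto_finsetSum _ fun y _ => (hlim y).abs) hnc
    have h2 : f o = 0 := tendsto_nhds_unique (hlim o) (by simp only [hu0]; exact tendsto_const_nhds)
    have h3 : ∑ w ∈ ball nb 2 o, |f w| = 0 := sum_eq_zero fun w _ => by rw [hc w o, h2, abs_zero]
    linarith

end Homog

end Existence

section CompactLinear

open scoped Pointwise

/-- All finite subsets of `G` have growth bounded by a multiple of `n ^ d`. -/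
def GrowthLE (G : Type*) [Group G] (d : ℕ) : Prop :=
  ∀ S : Set G, S.Finite → ∃ C : ℕ, ∀ n, 1 ≤ n → (S ^ n).ncard ≤ C * n ^ d

theorem finite_pow {M : Type*} [Monoid M] {S : Set M} (hS : S.Finite) (n : ℕ) : (S ^ n).Finite := by
  induction n with
  | zero => rw [pow_zero]; exact Set.finite_one
  | succ n ih => rw [pow_succ]; exact ih.mul hS

theorem GrowthLE.subgroup {G : Type*} [Group G] {d : ℕ} (h : GrowthLE G d) (K : Subgroup G) :
    GrowthLE K d := by
  intro S hS
  obtain ⟨C, hC⟩ := h (K.subtype '' S) (hS.image _)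
  refine ⟨C, fun n hn => ?_⟩
  have := hC n hn
  rwa [← Set.image_pow, Set.ncard_image_of_injective _ K.subtype_injective] at this

variable {G A : Type*} [Group G] [NormedRing A] (ρ : G →* A) (hρ : ∀ g, ‖ρ g‖ ≤ 1)
include hρ

theorem norm_map_mul_sub_one_le (g h : G) :
    ‖ρ (g * h) - 1‖ ≤ ‖ρ g - 1‖ + ‖ρ h - 1‖ := by
  have e : ρ (g * h) - 1 = (ρ g - 1) + ρ g * (ρ h - 1) := by rw [map_mul]; noncomm_ring
  rw [e]
  refine (norm_add_le _ _).trans (add_le_add le_rfl ((norm_mul_le _ _).trans ?_))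
  exact mul_le_of_le_one_left (norm_nonneg _) (hρ g)

theorem norm_map_inv_sub_one_le (g : G) : ‖ρ g⁻¹ - 1‖ ≤ ‖ρ g - 1‖ := by
  have e : ρ g⁻¹ - 1 = -(ρ g⁻¹ * (ρ g - 1)) := by
    rw [mul_sub, ← map_mul, inv_mul_cancel, map_one]; noncomm_ring
  rw [e, norm_neg]
  exact (norm_mul_le _ _).trans (mul_le_of_le_one_left (norm_nonneg _) (hρ _))

theorem norm_map_pow_sub_one_le (g : G) (n : ℕ) : ‖ρ (g ^ n) - 1‖ ≤ n * ‖ρ g - 1‖ := by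
  induction n with
  | zero => simp
  | succ n ih =>
    rw [pow_succ]
    refine (norm_map_mul_sub_one_le ρ hρ _ _).trans ?_
    push_cast
    linarith

open scoped commutatorElement in
theorem norm_map_commutator_sub_one_le (g h : G) :
    ‖ρ ⁅g, h⁆ - 1‖ ≤ 2 * ‖ρ g - 1‖ * ‖ρ h - 1‖ := by
  have e : ρ ⁅g, h⁆ - 1 =
      ((ρ g - 1) * (ρ h - 1) - (ρ h - 1) * (ρ g - 1)) * ρ (g⁻¹ * h⁻¹) := by
    have h1 : ρ h * ρ g * ρ (g⁻¹ * h⁻¹) = 1 := by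
      rw [← map_mul, ← map_mul, ← map_one ρ]; congr 1; group
    have h2 : ρ ⁅g, h⁆ = ρ g * ρ h * ρ (g⁻¹ * h⁻¹) := by
      rw [← map_mul, ← map_mul, commutatorElement_def]; congr 1; group
    rw [show (ρ g - 1) * (ρ h - 1) - (ρ h - 1) * (ρ g - 1) = ρ g * ρ h - ρ h * ρ g by
      noncomm_ring, sub_mul, h1, h2]
  rw [e]
  refine (norm_mul_le _ _).trans ?_
  refine (mul_le_of_le_one_right (norm_nonneg _) (hρ _)).trans ?_
  refine (norm_sub_le _ _).trans ?_
  linarith [norm_mul_le (ρ g - 1) (ρ h - 1), norm_mul_le (ρ h - 1) (ρ g - 1),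
    mul_comm ‖ρ g - 1‖ ‖ρ h - 1‖]

theorem norm_map_pow_sub_one_sub_le (g : G) (n : ℕ) :
    ‖ρ (g ^ n) - 1 - n • (ρ g - 1)‖ ≤ (n * ‖ρ g - 1‖) ^ 2 := by
  induction n with
  | zero => simp
  | succ n ih =>
    have e : ρ (g ^ (n + 1)) - 1 - (n + 1) • (ρ g - 1) =
        (ρ (g ^ n) - 1) * (ρ g - 1) + (ρ (g ^ n) - 1 - n • (ρ g - 1)) := by
      rw [pow_succ, map_mul, add_smul, one_smul]; noncomm_ring
    rw [e]
    have h1 := norm_map_pow_sub_one_le ρ hρ g n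
    have h2 := (norm_mul_le (ρ (g ^ n) - 1) (ρ g - 1)).trans
      (mul_le_mul_of_nonneg_right h1 (norm_nonneg _))
    refine (norm_add_le _ _).trans ((add_le_add h2 ih).trans ?_)
    have hn : (0 : ℝ) ≤ n := n.cast_nonneg
    have h3 := mul_nonneg hn (mul_nonneg (norm_nonneg (ρ g - 1)) (norm_nonneg (ρ g - 1)))
    push_cast
    nlinarith [sq_nonneg ‖ρ g - 1‖]

theorem half_le_norm_map_pow_sub_one [NormedAlgebra ℂ A] (g : G) {n : ℕ} (hn : 1 ≤ n)
    (h : n * ‖ρ g - 1‖ ≤ 1 / 2) : ‖ρ g - 1‖ / 2 ≤ ‖ρ (g ^ n) - 1‖ := by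
  have h1 := norm_map_pow_sub_one_sub_le ρ hρ g n
  have h2 := norm_sub_norm_le (n • (ρ g - 1)) (ρ (g ^ n) - 1)
  have h3 : ‖n • (ρ g - 1)‖ = n * ‖ρ g - 1‖ := by
    rw [← Nat.cast_smul_eq_nsmul ℂ, norm_smul, Complex.norm_natCast]
  rw [norm_sub_rev (n • (ρ g - 1)), h3] at h2
  have hn' : (1 : ℝ) ≤ n := by exact_mod_cast hn
  have h4 := le_mul_of_one_le_left (norm_nonneg (ρ g - 1)) hn'
  nlinarith [norm_nonneg (ρ g - 1)]

/-- A sequence of group elements converging very fast to the identity forces growth. -/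
theorem false_of_fast_sequence [NormedAlgebra ℂ A] {d : ℕ} (hd : GrowthLE G d) (g : ℕ → G)
    {T : Set G} (hT : T.Finite) (h1T : 1 ∈ T) (hgT : ∀ k, g k ∈ T ^ 4 ^ k)
    (hpos : ∀ k, 0 < ‖ρ (g k) - 1‖)
    (h0 : ((4 ^ d + 1 : ℕ) : ℝ) * ‖ρ (g 0) - 1‖ ≤ 1 / 2)
    (hstep : ∀ k, 16 * ((4 ^ d + 1 : ℕ) : ℝ) * ‖ρ (g (k + 1)) - 1‖ ≤ ‖ρ (g k) - 1‖) : False := by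
  classical
  set N : ℕ := 4 ^ d + 1 with hN
  have hN1 : (1 : ℝ) ≤ N := Nat.one_le_cast.2 (Nat.le_add_left 1 _)
  have hsmall : ∀ k, (N : ℝ) * ‖ρ (g k) - 1‖ ≤ 1 / 2 := by
    intro k
    induction k with
    | zero => exact h0
    | succ k ih => nlinarith [hstep k, hpos k, hpos (k + 1)]
  let Q : ℕ → ℕ → Finset G := fun m => Nat.rec (fun _ => {1})
    (fun _ q i => (range N ×ˢ q (i + 1)).image fun p => g i ^ p.1 * p.2) m
  have hQs : ∀ m i, Q (m + 1) i = (range N ×ˢ Q m (i + 1)).image fun p => g i ^ p.1 * p.2 :=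
    fun _ _ => rfl
  have hQ0 : ∀ i, Q 0 i = {1} := fun _ => rfl
  have hQn : ∀ m i, ∀ x ∈ Q m i, ‖ρ x - 1‖ ≤ 2 * N * ‖ρ (g i) - 1‖ := by
    intro m
    induction m with
    | zero =>
      intro i x hx
      rw [hQ0, mem_singleton] at hx
      rw [hx, map_one, sub_self, norm_zero]
      positivity
    | succ m ih =>
      intro i x hx
      rw [hQs, mem_image] at hx
      obtain ⟨⟨a, y⟩, hp, rfl⟩ := hx
      rw [mem_product, mem_range] at hp
      refine (norm_map_mul_sub_one_le ρ hρ _ _).trans ?_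
      have e1 := norm_map_pow_sub_one_le ρ hρ (g i) a
      have e2 := ih (i + 1) y hp.2
      have e3 : (a : ℝ) * ‖ρ (g i) - 1‖ ≤ N * ‖ρ (g i) - 1‖ := by
        gcongr; exact hp.1.le
      have := hstep i
      simp only
      nlinarith [hpos i, hpos (i + 1)]
  have hne : ∀ m i a b x y, a < b → b < N → x ∈ Q m (i + 1) → y ∈ Q m (i + 1) →
      g i ^ a * x ≠ g i ^ b * y := by
    intro m i a b x y hab hb hx hy he
    have e : g i ^ (b - a) = x * y⁻¹ := by
      rw [eq_mul_inv_iff_mul_eq, ← mul_right_inj (g i ^ a), he, ← mul_assoc, ← pow_add]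
      congr 2; omega
    have hba : ((b - a : ℕ) : ℝ) ≤ N := by exact_mod_cast (by omega)
    have e1 := half_le_norm_map_pow_sub_one ρ hρ (g i) (n := b - a) (by omega)
      ((mul_le_mul_of_nonneg_right hba (norm_nonneg _)).trans (hsmall i))
    rw [e] at e1
    have e2 := norm_map_mul_sub_one_le ρ hρ x y⁻¹
    have e3 := norm_map_inv_sub_one_le ρ hρ y
    linarith [hQn _ _ x hx, hQn _ _ y hy, hstep i, hpos i]
  have hcard : ∀ m i, (Q m i).card = N ^ m := by
    intro m
    induction m with
    | zero => intro i; rw [hQ0]; simp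
    | succ m ih =>
      intro i
      rw [hQs, card_image_of_injOn, card_product, card_range, ih, pow_succ']
      rintro ⟨a, x⟩ hp ⟨b, y⟩ hq he
      rw [mem_coe, mem_product, mem_range] at hp hq
      simp only at he hp hq
      rcases lt_trichotomy a b with h | h | h
      · exact absurd he (hne m i a b x y h hq.1 hp.2 hq.2)
      · subst h; rw [mul_right_inj] at he; rw [he]
      · exact absurd he.symm (hne m i b a y x h hp.1 hq.2 hp.2)
  have hQT : ∀ m i, ∀ x ∈ Q m i, ∃ e, e + N * 4 ^ i ≤ N * 4 ^ (i + m) ∧ x ∈ T ^ e := by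
    intro m
    induction m with
    | zero =>
      intro i x hx
      rw [hQ0, mem_singleton] at hx
      exact ⟨0, by simp, by simp [hx]⟩
    | succ m ih =>
      intro i x hx
      rw [hQs, mem_image] at hx
      obtain ⟨⟨a, y⟩, hp, rfl⟩ := hx
      rw [mem_product, mem_range] at hp
      obtain ⟨e, he, hy⟩ := ih (i + 1) y hp.2
      refine ⟨4 ^ i * a + e, ?_, ?_⟩
      · rw [show i + (m + 1) = i + 1 + m by ring]
        have : 4 ^ i * a ≤ 4 ^ i * N := Nat.mul_le_mul_left _ hp.1.le
        rw [pow_succ 4 i] at he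
        nlinarith
      · rw [pow_add, pow_mul]
        exact Set.mul_mem_mul (Set.pow_mem_pow (hgT i)) hy
  obtain ⟨C, hC⟩ := hd T hT
  have hgr : ∀ m : ℕ, ((N : ℝ)) ^ m ≤ C * (N : ℝ) ^ d * (4 ^ d : ℝ) ^ m := by
    intro m
    have h4 : 1 ≤ N * 4 ^ m := Nat.one_le_iff_ne_zero.2 (by positivity)
    have hsub : (SetLike.coe (Q m 0)) ⊆ T ^ (N * 4 ^ m) := by
      intro x hx
      rw [SetLike.mem_coe] at hx
      obtain ⟨e, he, hxe⟩ := hQT m 0 x hx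
      rw [zero_add] at he
      exact Set.pow_subset_pow_right h1T (by omega) hxe
    have h5 := Set.ncard_le_ncard hsub (finite_pow hT _)
    rw [Set.ncard_coe_finset, hcard] at h5
    have h6 : (N : ℝ) ^ m ≤ C * ((N : ℝ) * 4 ^ m) ^ d := by exact_mod_cast h5.trans (hC _ h4)
    calc _ ≤ _ := h6
      _ = _ := by rw [mul_pow, ← pow_mul, mul_comm m d, pow_mul]; ring
  have := le_of_pow_le_poly_mul_pow (a := (N : ℝ)) (b := (4 : ℝ) ^ d) (C := C * (N : ℝ) ^ d)
    (d := 0) (by positivity) fun n _ => by rw [pow_zero, mul_one]; exact hgr n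
  rw [hN] at this
  push_cast at this
  linarith

end CompactLinear

section CompactLinear

open scoped Pointwise

/-- `G` has a finite-index subgroup with infinite abelianization. -/
def VirtIndicable (G : Type*) [Group G] : Prop :=
  ∃ K : Subgroup G, K.FiniteIndex ∧ Infinite (Abelianization K)

theorem VirtIndicable.of_subgroup {G : Type*} [Group G] (K : Subgroup G) [K.FiniteIndex]
    (h : VirtIndicable K) : VirtIndicable G := by
  obtain ⟨L, hL, hinf⟩ := h
  refine ⟨L.map K.subtype, ⟨?_⟩, ?_⟩
  · rw [Subgroup.index_map_subtype]
    exact mul_ne_zero hL.index_ne_zero Subgroup.FiniteIndex.index_ne_zero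
  · exact (L.equivMapOfInjective K.subtype
      K.subtype_injective).abelianizationCongr.toEquiv.infinite_iff.1 hinf

theorem finiteIndex_of_finite_range {G X : Type*} [Group G] (K : Subgroup G) (f : G → X)
    (hf : (Set.range f).Finite) (h : ∀ a b, f a = f b → a⁻¹ * b ∈ K) : K.FiniteIndex := by
  have : Finite (Set.range f) := hf
  have : Finite (G ⧸ K) := Finite.of_injective
    (fun q : G ⧸ K => (⟨f q.out, q.out, rfl⟩ : Set.range f)) fun q r hqr => by
      have := QuotientGroup.eq.2 (h _ _ (congrArg Subtype.val hqr))
      rwa [QuotientGroup.out_eq', QuotientGroup.out_eq'] at this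
  exact Subgroup.finiteIndex_of_finite_quotient

theorem finiteIndex_ker_of_finite_range {G M : Type*} [Group G] [Monoid M] (f : G →* M)
    (hf : (Set.range f).Finite) : f.ker.FiniteIndex :=
  finiteIndex_of_finite_range _ f hf fun a b h => by
    rw [MonoidHom.mem_ker, map_mul, ← h, ← map_mul, inv_mul_cancel, map_one]

theorem infinite_range_comp_subtype {G M : Type*} [Group G] [Monoid M] (f : G →* M)
    (hf : (Set.range f).Infinite) (K : Subgroup G) [K.FiniteIndex] :
    (Set.range (f.comp K.subtype)).Infinite := by
  intro hfin
  have : Finite (G ⧸ K) := Subgroup.finite_quotient_of_finiteIndex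
  refine hf (((Set.finite_range fun q : G ⧸ K => f q.out).mul hfin).subset ?_)
  rintro _ ⟨g, rfl⟩
  have hk : (QuotientGroup.mk g : G ⧸ K).out⁻¹ * g ∈ K :=
    QuotientGroup.eq.1 (QuotientGroup.out_eq' _)
  refine Set.mem_mul.2 ⟨_, ⟨QuotientGroup.mk g, rfl⟩, _, ⟨⟨_, hk⟩, rfl⟩, ?_⟩
  simp only [MonoidHom.comp_apply, Subgroup.coe_subtype]
  rw [← map_mul, mul_inv_cancel_left]

theorem infinite_abelianization_of_commute {G M : Type*} [Group G] [Monoid M] (f : G →* M)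
    (hf : (Set.range f).Infinite) (hc : ∀ a b, f a * f b = f b * f a) :
    Infinite (Abelianization G) := by
  have hle : commutator G ≤ f.ker := by
    rw [commutator_def, Subgroup.commutator_le]
    intro a _ b _
    rw [MonoidHom.mem_ker, commutatorElement_def, map_mul, map_mul, map_mul, hc a b,
      mul_assoc (f b), ← map_mul f a, mul_inv_cancel, map_one, mul_one, ← map_mul,
      mul_inv_cancel, map_one]
  by_contra hfin
  rw [not_infinite_iff_finite] at hfin
  have : Finite (G ⧸ commutator G) := hfin
  refine hf ((Set.finite_range (QuotientGroup.lift (commutator G) f hle)).subset ?_)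
  rintro _ ⟨g, rfl⟩
  exact ⟨QuotientGroup.mk g, QuotientGroup.lift_mk _ _ _⟩

theorem exists_finite_subset_closure_eq {G : Type*} [Group G] {X : Set G}
    (h : (Subgroup.closure X).FG) :
    ∃ S ⊆ X, S.Finite ∧ Subgroup.closure S = Subgroup.closure X := by
  classical
  have hmem : ∀ g ∈ Subgroup.closure X, ∃ S ⊆ X, S.Finite ∧ g ∈ Subgroup.closure S := by
    intro g hg
    induction hg using Subgroup.closure_induction with
    | mem x hx => exact ⟨{x}, by simpa using hx, Set.finite_singleton x,
        Subgroup.subset_closure rfl⟩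
    | one => exact ⟨∅, Set.empty_subset _, Set.finite_empty, one_mem _⟩
    | mul x y _ _ hx hy =>
      obtain ⟨S, hS, hSf, hxS⟩ := hx
      obtain ⟨T, hT, hTf, hyT⟩ := hy
      exact ⟨S ∪ T, Set.union_subset hS hT, hSf.union hTf,
        mul_mem (Subgroup.closure_mono Set.subset_union_left hxS)
          (Subgroup.closure_mono Set.subset_union_right hyT)⟩
    | inv x _ hx =>
      obtain ⟨S, hS, hSf, hxS⟩ := hx
      exact ⟨S, hS, hSf, inv_mem hxS⟩
  obtain ⟨F, hF⟩ := h
  have hF' : ∀ g : F, ∃ S ⊆ X, S.Finite ∧ (g : G) ∈ Subgroup.closure S := fun g =>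
    hmem g (hF ▸ Subgroup.subset_closure g.2)
  choose S hS hSf hgS using hF'
  refine ⟨⋃ g, S g, Set.iUnion_subset hS, Set.finite_iUnion hSf,
    le_antisymm (Subgroup.closure_mono (Set.iUnion_subset hS)) ?_⟩
  rw [← hF, Subgroup.closure_le]
  exact fun g hg => Subgroup.closure_mono (Set.subset_iUnion S ⟨g, hg⟩) (hgS ⟨g, hg⟩)

theorem eq_one_of_pow_eq_one_of_norm_lt {μ : ℂ} {n : ℕ} (hn : 0 < n) (h : μ ^ n = 1)
    (hμ : n * ‖μ - 1‖ < 1) : μ = 1 := by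
  by_contra hne
  have hnorm : ‖μ‖ = 1 := Complex.norm_eq_one_of_pow_eq_one h hn.ne'
  have hsum : ∑ i ∈ range n, μ ^ i = 0 := by
    have := geom_sum_mul μ n
    rw [h, sub_self] at this
    exact (mul_eq_zero.1 this).resolve_right (sub_ne_zero.2 hne)
  have hpow : ∀ i : ℕ, ‖1 - μ ^ i‖ ≤ i * ‖μ - 1‖ := by
    intro i
    induction i with
    | zero => simp
    | succ i ih =>
      have e : 1 - μ ^ (i + 1) = (1 - μ ^ i) - μ ^ i * (μ - 1) := by ring
      rw [e]
      refine (norm_sub_le _ _).trans ?_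
      rw [norm_mul, norm_pow, hnorm, one_pow, one_mul]
      push_cast
      linarith
  have h1 : (n : ℂ) = ∑ i ∈ range n, (1 - μ ^ i) := by
    rw [sum_sub_distrib, hsum]; simp
  have h2 : (n : ℝ) ≤ ∑ i ∈ range n, (n * ‖μ - 1‖) := by
    calc (n : ℝ) = ‖(n : ℂ)‖ := (Complex.norm_natCast n).symm
      _ = ‖∑ i ∈ range n, (1 - μ ^ i)‖ := by rw [← h1]
      _ ≤ ∑ i ∈ range n, ‖1 - μ ^ i‖ := norm_sum_le _ _
      _ ≤ _ := sum_le_sum fun i hi => (hpow i).trans (by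
          gcongr; exact (mem_range.1 hi).le)
  rw [sum_const, card_range, nsmul_eq_mul] at h2
  have hn' : (0 : ℝ) < n := Nat.cast_pos.2 hn
  nlinarith

variable {G E : Type*} [Group G] [NormedAddCommGroup E] [NormedSpace ℂ E]

/-- The restriction of a representation to an invariant subspace. -/
noncomputable def subrep (ρ : G →* (E →L[ℂ] E)) (p : Submodule ℂ E)
    (hp : ∀ g, ∀ x ∈ p, ρ g x ∈ p) : G →* (p →L[ℂ] p) where
  toFun g := ((ρ g).comp p.subtypeL).codRestrict p fun x => hp g x x.2
  map_one' := by ext x; simp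
  map_mul' g h := by
    ext x
    exact congrArg (fun A : E →L[ℂ] E => A x) (map_mul ρ g h)

theorem coe_subrep_apply (ρ : G →* (E →L[ℂ] E)) (p : Submodule ℂ E)
    (hp : ∀ g, ∀ x ∈ p, ρ g x ∈ p) (g : G) (x : p) :
    (subrep ρ p hp g x : E) = ρ g x := rfl

theorem norm_subrep_le (ρ : G →* (E →L[ℂ] E)) (hρ : ∀ g, ‖ρ g‖ ≤ 1) (p : Submodule ℂ E)
    (hp : ∀ g, ∀ x ∈ p, ρ g x ∈ p) (g : G) : ‖subrep ρ p hp g‖ ≤ 1 := by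
  refine ContinuousLinearMap.opNorm_le_bound _ zero_le_one fun x => ?_
  rw [Submodule.coe_norm, coe_subrep_apply, one_mul]
  exact ((ρ g).le_of_opNorm_le (hρ g) x).trans_eq (one_mul _)

theorem mul_comm_of_mem_ker_subrep (ρ : G →* (E →L[ℂ] E)) {T : E →L[ℂ] E}
    (hT : ∀ g, T * ρ g = ρ g * T) {a b : G}
    (ha : ∀ x ∈ LinearMap.ker T.toLinearMap, ρ a x = x)
    (hb : ∀ x ∈ LinearMap.ker T.toLinearMap, ρ b x = x)
    (ha' : ∀ x ∈ LinearMap.range T.toLinearMap, ρ a x = x)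
    (hb' : ∀ x ∈ LinearMap.range T.toLinearMap, ρ b x = x) : ρ a * ρ b = ρ b * ρ a := by
  have key : ∀ {a b : G}, (∀ x ∈ LinearMap.ker T.toLinearMap, ρ a x = x) →
      (∀ x ∈ LinearMap.range T.toLinearMap, ρ b x = x) → ρ a * ρ b = ρ a + ρ b - 1 := by
    intro a b ha hb
    ext x
    have h1 : T (ρ b x - x) = 0 := by
      have := congrArg (fun A : E →L[ℂ] E => A x) (hT b)
      simp only [mul_apply_eq_comp] at this
      rw [map_sub, this, hb (T x) ⟨x, rfl⟩, sub_self]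
    have h2 := ha _ (LinearMap.mem_ker.2 h1)
    rw [map_sub, sub_eq_sub_iff_add_eq_add] at h2
    simp only [mul_apply_eq_comp, sub_apply,
      add_apply, one_apply_eq_self]
    rw [eq_sub_iff_add_eq, h2, add_comm]
  rw [key ha hb', key hb ha', add_comm (ρ a)]

theorem exists_det_eq_pow [FiniteDimensional ℂ E] (ρ : G →* (E →L[ℂ] E)) (a b : G) {μ : ℂ}
    (h : ρ (a * b * a⁻¹ * b⁻¹) = μ • 1) : μ ^ Module.finrank ℂ E = 1 := by
  let f : G →* ℂ :=
    { toFun := fun g => LinearMap.det (ρ g).toLinearMap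
      map_one' := by rw [map_one]; exact LinearMap.det_id
      map_mul' := fun g h => by rw [map_mul]; exact LinearMap.det_comp _ _ }
  have h1 : f (a * b * a⁻¹ * b⁻¹) = 1 := by
    rw [map_mul, map_mul, map_mul, mul_right_comm (f a), ← map_mul f a, mul_inv_cancel, map_one,
      one_mul, ← map_mul, mul_inv_cancel, map_one]
  have h2 : f (a * b * a⁻¹ * b⁻¹) = LinearMap.det (μ • (1 : E →ₗ[ℂ] E)) := by
    change LinearMap.det (ρ (a * b * a⁻¹ * b⁻¹)).toLinearMap = _
    rw [h]; rfl
  rw [← h1, h2, LinearMap.det_smul]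
  simp

end CompactLinear

section CompactLinear

open scoped Pointwise commutatorElement

theorem commute_of_mem_closure {G M : Type*} [Group G] [Monoid M] (ρ : G →* M) {S : Set G}
    {A : M} (h : ∀ s ∈ S, A * ρ s = ρ s * A) : ∀ g ∈ Subgroup.closure S, A * ρ g = ρ g * A := by
  intro g hg
  induction hg using Subgroup.closure_induction with
  | mem x hx => exact h x hx
  | one => rw [map_one, one_mul, mul_one]
  | mul x y _ _ hx hy => rw [map_mul, ← mul_assoc, hx, mul_assoc, hy, mul_assoc]
  | inv x _ hx =>
    calc A * ρ x⁻¹ = ρ x⁻¹ * (ρ x * A) * ρ x⁻¹ := by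
          rw [← mul_assoc, ← map_mul, inv_mul_cancel, map_one, one_mul]
      _ = ρ x⁻¹ * A * (ρ x * ρ x⁻¹) := by rw [← hx]; simp only [mul_assoc]
      _ = _ := by rw [← map_mul, mul_inv_cancel, map_one, mul_one]

theorem map_commutator_eq_one_iff {G M : Type*} [Group G] [Monoid M] (ρ : G →* M) (g h : G) :
    ρ ⁅g, h⁆ = 1 → ρ g * ρ h = ρ h * ρ g := by
  intro e
  have : ⁅g, h⁆ * (h * g) = g * h := by rw [commutatorElement_def]; group
  rw [← map_mul, ← this, map_mul, e, one_mul, map_mul]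

variable {G E : Type*} [Group G] [NormedAddCommGroup E] [NormedSpace ℂ E]

theorem commute_of_central_scalar [FiniteDimensional ℂ E] {d : ℕ} (hd : GrowthLE G d)
    (ρ : G →* (E →L[ℂ] E)) (hρ : ∀ g, ‖ρ g‖ ≤ 1) {S : Set G} (hS : S.Finite) {ε : ℝ}
    (hε : 32 * ((4 ^ d + 1 : ℕ) : ℝ) * (Module.finrank ℂ E + 1) * ε ≤ 1)
    (hSε : ∀ s ∈ S, ‖ρ s - 1‖ ≤ ε)
    (hsc : ∀ z ∈ Subgroup.closure S, (∀ s ∈ S, ρ z * ρ s = ρ s * ρ z) → ∃ c : ℂ, ρ z = c • 1) :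
    ∀ a ∈ Subgroup.closure S, ∀ b ∈ Subgroup.closure S, ρ a * ρ b = ρ b * ρ a := by
  suffices h : ∀ s ∈ S, ∀ t ∈ S, ρ s * ρ t = ρ t * ρ s by
    intro a ha b hb
    refine commute_of_mem_closure ρ (fun t ht => ?_) b hb
    exact (commute_of_mem_closure ρ (fun s hs => h t ht s hs) a ha).symm
  by_contra hcon
  push Not at hcon
  obtain ⟨s₀, hs₀, t₀, ht₀, hst⟩ := hcon
  have : Nontrivial E := by
    by_contra htriv
    rw [not_nontrivial_iff_subsingleton] at htriv
    exact hst (ContinuousLinearMap.ext fun x => Subsingleton.elim _ _)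
  have hε0 : 0 ≤ ε := (norm_nonneg _).trans (hSε s₀ hs₀)
  set N : ℝ := ((4 ^ d + 1 : ℕ) : ℝ) with hN
  have hN1 : 1 ≤ N := Nat.one_le_cast.2 (Nat.le_add_left 1 _)
  set n : ℕ := Module.finrank ℂ E with hn
  have hn0 : 0 < n := Module.finrank_pos
  have hn1 : (1 : ℝ) ≤ n := Nat.one_le_cast.2 hn0
  have hNε : 32 * N * ε ≤ 1 := by
    refine le_trans ?_ hε
    have : 0 ≤ 32 * N * ε := by positivity
    nlinarith
  have hnε : n * ε < 1 := by
    have h1 : 0 ≤ N * (n * ε) := by positivity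
    have h2 : 0 ≤ N * ε := by positivity
    have h3 : n * ε ≤ N * (n * ε) := le_mul_of_one_le_left (by positivity) hN1
    nlinarith
  have hε1 : 32 * ε ≤ 1 := by nlinarith
  set T : Set G := S ∪ S⁻¹ ∪ {1} with hT
  have hTinv : T⁻¹ = T := by
    rw [hT, Set.union_inv, Set.union_inv, inv_inv, Set.union_comm S⁻¹, Set.inv_singleton, inv_one]
  have h1T : (1 : G) ∈ T := Or.inr rfl
  have hST : S ⊆ T := fun x hx => Or.inl (Or.inl hx)
  have hpowinv : ∀ n, ∀ x ∈ T ^ n, x⁻¹ ∈ T ^ n := by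
    intro n x hx
    have := Set.inv_mem_inv.2 hx
    rwa [← inv_pow, hTinv] at this
  let P : G → Prop := fun g => g ∈ Subgroup.closure S ∧ ‖ρ g - 1‖ ≤ ε ∧
    ∃ s ∈ S, ρ g * ρ s ≠ ρ s * ρ g
  have hnext : ∀ g : {g // P g}, ∃ g' : {g // P g}, ∃ s ∈ S, (g' : G) = ⁅(g : G), s⁆ := by
    rintro ⟨g, hg, hgε, s, hs, hgs⟩
    have hc : ⁅g, s⁆ ∈ Subgroup.closure S := by
      rw [commutatorElement_def]
      have := Subgroup.subset_closure hs
      exact mul_mem (mul_mem (mul_mem hg this) (inv_mem hg)) (inv_mem this)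
    have hb : ‖ρ ⁅g, s⁆ - 1‖ ≤ ε := by
      refine (norm_map_commutator_sub_one_le ρ hρ g s).trans ?_
      have := mul_le_mul hgε (hSε s hs) (norm_nonneg _) hε0
      nlinarith
    refine ⟨⟨⁅g, s⁆, hc, hb, ?_⟩, s, hs, rfl⟩
    by_contra hcen
    push Not at hcen
    obtain ⟨c, hcc⟩ := hsc _ hc hcen
    have hc1 : c ^ n = 1 := exists_det_eq_pow ρ g s (by rw [← hcc, commutatorElement_def])
    have hcn : ‖c - 1‖ ≤ ε := by
      have e : ρ ⁅g, s⁆ - 1 = (c - 1) • (1 : E →L[ℂ] E) := by rw [hcc, sub_smul, one_smul]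
      rw [e, norm_smul, norm_one, mul_one] at hb
      exact hb
    have := eq_one_of_pow_eq_one_of_norm_lt hn0 hc1
      ((mul_le_mul_of_nonneg_left hcn (Nat.cast_nonneg n)).trans_lt hnε)
    rw [this, one_smul] at hcc
    exact hgs (map_commutator_eq_one_iff ρ g s hcc)
  choose nxt s hs hnxt using hnext
  let g : ℕ → {g // P g} := fun k =>
    nxt^[k] ⟨s₀, Subgroup.subset_closure hs₀, hSε _ hs₀, t₀, ht₀, hst⟩
  have hg : ∀ k, (g (k + 1) : G) = ⁅(g k : G), s (g k)⁆ := fun k => by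
    rw [← hnxt]; exact congrArg Subtype.val (Function.iterate_succ_apply' _ _ _)
  refine false_of_fast_sequence ρ hρ hd (fun k => (g k : G)) (T := T)
    ((hS.union hS.inv).union (Set.finite_singleton 1)) h1T ?_ ?_ ?_ ?_
  · intro k
    induction k with
    | zero => rw [pow_zero, pow_one]; exact hST hs₀
    | succ k ih =>
      simp only [hg, commutatorElement_def]
      have hsk : s (g k) ∈ T ^ 1 := by rw [pow_one]; exact hST (hs _)
      have := Set.mul_mem_mul (Set.mul_mem_mul (Set.mul_mem_mul ih hsk) (hpowinv _ _ ih))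
        (hpowinv _ _ hsk)
      rw [← pow_add, ← pow_add, ← pow_add] at this
      refine Set.pow_subset_pow_right h1T ?_ this
      have : 1 ≤ 4 ^ k := Nat.one_le_pow _ _ (by norm_num)
      rw [pow_succ]; omega
  · intro k
    rw [norm_pos_iff, sub_ne_zero]
    intro h1
    obtain ⟨_, _, t, _, ht⟩ := (g k).2
    rw [h1, one_mul, mul_one] at ht
    exact ht rfl
  · rw [← hN]
    have := mul_le_mul_of_nonneg_left (g 0).2.2.1 (by positivity : 0 ≤ N)
    linarith
  · intro k
    rw [← hN]
    simp only [hg]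
    have h1 := norm_map_commutator_sub_one_le ρ hρ (g k) (s (g k))
    have h2 := mul_le_mul_of_nonneg_left (hSε _ (hs (g k)))
      (mul_nonneg zero_le_two (norm_nonneg (ρ (g k) - 1)))
    have h3 := mul_le_mul_of_nonneg_left (h1.trans h2) (by positivity : 0 ≤ 16 * N)
    refine h3.trans ?_
    have h4 := mul_le_mul_of_nonneg_right hNε (norm_nonneg (ρ (g k) - 1))
    linarith

theorem finiteIndex_closure_near_one [FiniteDimensional ℂ E] (ρ : G →* (E →L[ℂ] E))
    (hρ : ∀ g, ‖ρ g‖ ≤ 1) {ε : ℝ} (hε : 0 < ε) :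
    (Subgroup.closure {g | ‖ρ g - 1‖ ≤ ε}).FiniteIndex := by
  have : ProperSpace (E →L[ℂ] E) := FiniteDimensional.proper ℂ _
  have htb := (isCompact_closedBall (0 : E →L[ℂ] E) 1).totallyBounded
  obtain ⟨t, ht, hcov⟩ := Metric.totallyBounded_iff.1 htb (ε / 2) (by positivity)
  have hch : ∀ g, ∃ y ∈ t, ‖ρ g - y‖ < ε / 2 := by
    intro g
    have := hcov (mem_closedBall_zero_iff.2 (hρ g))
    simp only [Set.mem_iUnion, Metric.mem_ball, dist_eq_norm] at this
    obtain ⟨y, hy, h⟩ := this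
    exact ⟨y, hy, h⟩
  choose f hft hf using hch
  refine finiteIndex_of_finite_range _ f (ht.subset (Set.range_subset_iff.2 hft)) fun a b h => ?_
  refine Subgroup.subset_closure ?_
  have e : ρ (a⁻¹ * b) - 1 = ρ a⁻¹ * (ρ b - ρ a) := by
    rw [mul_sub, ← map_mul, ← map_mul, inv_mul_cancel, map_one]
  change ‖ρ (a⁻¹ * b) - 1‖ ≤ ε
  rw [e]
  refine (norm_mul_le _ _).trans ((mul_le_of_le_one_left (norm_nonneg _) (hρ _)).trans ?_)
  have e2 : ρ b - ρ a = (ρ b - f b) - (ρ a - f a) := by rw [h]; abel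
  rw [e2]
  exact (norm_sub_le _ _).trans (by linarith [hf a, hf b])

theorem infinite_abelianization_of_reducible (ρ : G →* (E →L[ℂ] E))
    (hinf : (Set.range ρ).Infinite) {T : E →L[ℂ] E} (hT : ∀ g, T * ρ g = ρ g * T)
    {p q : Submodule ℂ E} (hp' : p = LinearMap.ker T.toLinearMap)
    (hq' : q = LinearMap.range T.toLinearMap)
    (hp : ∀ g, ∀ x ∈ p, ρ g x ∈ p) (hq : ∀ g, ∀ x ∈ q, ρ g x ∈ q)
    (hpf : (Set.range (subrep ρ p hp)).Finite) (hqf : (Set.range (subrep ρ q hq)).Finite) :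
    VirtIndicable G := by
  have h1 := finiteIndex_ker_of_finite_range _ hpf
  have h2 := finiteIndex_ker_of_finite_range _ hqf
  let K : Subgroup G := (subrep ρ p hp).ker ⊓ (subrep ρ q hq).ker
  have hK : K.FiniteIndex := inferInstance
  refine ⟨K, hK, infinite_abelianization_of_commute (ρ.comp K.subtype)
    (infinite_range_comp_subtype ρ hinf K) ?_⟩
  have fixp : ∀ a : K, ∀ x ∈ p, ρ a x = x := fun a x hx => by
    have := congrArg (fun A => ((A ⟨x, hx⟩ : p) : E)) a.2.1
    exact this
  have fixq : ∀ a : K, ∀ x ∈ q, ρ a x = x := fun a x hx => by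
    have := congrArg (fun A => ((A ⟨x, hx⟩ : q) : E)) a.2.2
    exact this
  rw [hp'] at fixp
  rw [hq'] at fixq
  exact fun a b => mul_comm_of_mem_ker_subrep ρ hT (fixp a) (fixp b) (fixq a) (fixq b)

end CompactLinear

/-- A finitely generated group of polynomial growth with an infinite bounded finite-dimensional
representation has a finite-index subgroup with infinite abelianization. -/
theorem virtIndicable_of_infinite_range.{u, v} {d : ℕ} (n : ℕ) :
    ∀ (G : Type u) [Group G] (E : Type v)
    [NormedAddCommGroup E] [NormedSpace ℂ E] [FiniteDimensional ℂ E],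
    Module.finrank ℂ E = n → Group.FG G → GrowthLE G d → ∀ ρ : G →* (E →L[ℂ] E),
    (∀ g, ‖ρ g‖ ≤ 1) → (Set.range ρ).Infinite → VirtIndicable G := by
  induction n using Nat.strong_induction_on with
  | _ n ih =>
  intro G _ E _ _ _ hn hfg hd ρ hρ hinf
  set N : ℝ := ((4 ^ d + 1 : ℕ) : ℝ) with hN
  have hN1 : 1 ≤ N := Nat.one_le_cast.2 (Nat.le_add_left 1 _)
  set ε : ℝ := 1 / (32 * N * (Module.finrank ℂ E + 1)) with hε
  have hε0 : 0 < ε := by positivity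
  have hε1 : 32 * N * (Module.finrank ℂ E + 1) * ε ≤ 1 :=
    (mul_one_div_cancel (by positivity)).le
  have hfi := finiteIndex_closure_near_one ρ hρ hε0
  set X : Set G := {g | ‖ρ g - 1‖ ≤ ε} with hX
  have hXfg : (Subgroup.closure X).FG :=
    (Group.fg_iff_subgroup_fg _).1 (Subgroup.fg_of_index_ne_zero _)
  obtain ⟨S, hSX, hSf, hSc⟩ := exists_finite_subset_closure_eq hXfg
  rw [← hSc] at hfi hXfg
  by_cases hsc : ∀ z ∈ Subgroup.closure S, (∀ s ∈ S, ρ z * ρ s = ρ s * ρ z) →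
      ∃ c : ℂ, ρ z = c • 1
  · have hcomm := commute_of_central_scalar hd ρ hρ hSf hε1 (fun s hs => hSX hs) hsc
    exact ⟨Subgroup.closure S, hfi, infinite_abelianization_of_commute
      (ρ.comp (Subgroup.closure S).subtype) (infinite_range_comp_subtype ρ hinf _)
      fun a b => hcomm a a.2 b b.2⟩
  · push Not at hsc
    obtain ⟨z, hz, hzS, hzc⟩ := hsc
    have hzcomm := commute_of_mem_closure ρ hzS
    refine VirtIndicable.of_subgroup (Subgroup.closure S) ?_
    set K := Subgroup.closure S
    let ρ' := ρ.comp K.subtype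
    have hρ' : ∀ g, ‖ρ' g‖ ≤ 1 := fun g => hρ _
    have hinf' : (Set.range ρ').Infinite := infinite_range_comp_subtype ρ hinf K
    have : Nontrivial E := by
      by_contra htriv
      rw [not_nontrivial_iff_subsingleton] at htriv
      exact hzc 1 (ContinuousLinearMap.ext fun x => Subsingleton.elim _ _)
    obtain ⟨c, hc⟩ := Module.End.exists_eigenvalue (ρ z).toLinearMap
    let T : E →L[ℂ] E := ρ z - c • 1
    have hT : ∀ g, T * ρ' g = ρ' g * T := fun g => by
      change (ρ z - c • 1) * ρ g = ρ g * (ρ z - c • 1)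
      rw [sub_mul, mul_sub, hzcomm g g.2, smul_mul_assoc, mul_smul_comm, one_mul, mul_one]
    have hTapp : ∀ g x, T (ρ' g x) = ρ' g (T x) := fun g x =>
      congrArg (fun A : E →L[ℂ] E => A x) (hT g)
    have hker : LinearMap.ker T.toLinearMap ≠ ⊥ := by
      obtain ⟨x, hx⟩ := hc.exists_hasEigenvector
      intro hbot
      refine hx.2 ((Submodule.eq_bot_iff _).1 hbot x ?_)
      rw [LinearMap.mem_ker]
      change ρ z x - c • x = 0
      rw [sub_eq_zero]
      exact hx.apply_eq_smul
    have hker' : LinearMap.ker T.toLinearMap ≠ ⊤ := by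
      intro htop
      refine hzc c (sub_eq_zero.1 ?_)
      ext x
      have : x ∈ LinearMap.ker T.toLinearMap := htop ▸ Submodule.mem_top
      exact this
    have hran : LinearMap.range T.toLinearMap ≠ ⊤ := by
      intro htop
      exact hker (LinearMap.ker_eq_bot_iff_range_eq_top.2 htop)
    have hp : ∀ g, ∀ x ∈ LinearMap.ker T.toLinearMap, ρ' g x ∈ LinearMap.ker T.toLinearMap := by
      intro g x hx
      have hx' : T x = 0 := hx
      change T (ρ' g x) = 0
      rw [hTapp, hx', map_zero]
    have hq : ∀ g, ∀ x ∈ LinearMap.range T.toLinearMap,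
        ρ' g x ∈ LinearMap.range T.toLinearMap := by
      rintro g _ ⟨x, rfl⟩
      exact ⟨ρ' g x, hTapp g x⟩
    have hfgK : Group.FG K := (Group.fg_iff_subgroup_fg _).2 hXfg
    have hdK := hd.subgroup K
    by_cases hpf : (Set.range (subrep ρ' _ hp)).Finite
    · by_cases hqf : (Set.range (subrep ρ' _ hq)).Finite
      · exact infinite_abelianization_of_reducible ρ' hinf' hT rfl rfl hp hq hpf hqf
      · exact ih _ (hn ▸ Submodule.finrank_lt hran) K _ rfl hfgK hdK _
          (norm_subrep_le ρ' hρ' _ hq) hqf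
    · exact ih _ (hn ▸ Submodule.finrank_lt hker') K _ rfl hfgK hdK _
        (norm_subrep_le ρ' hρ' _ hp) hpf

section Length

/-- A length function on a group. -/
structure IsLength {Γ : Type*} [Group Γ] (ℓ : Γ → ℕ) : Prop where
  one : ℓ 1 = 0
  mul_le : ∀ g h, ℓ (g * h) ≤ ℓ g + ℓ h
  inv : ∀ g, ℓ g⁻¹ = ℓ g

/-- A length function of polynomial growth of degree at most `d`, whose balls eventually
generate the group. -/
structure LenGroup {Γ : Type*} [Group Γ] (ℓ : Γ → ℕ) (d : ℕ) : Prop extends IsLength ℓ where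
  growth : ∃ C : ℕ, ∀ n, 1 ≤ n → ∀ T : Finset Γ, (∀ t ∈ T, ℓ t ≤ n) →
    (∀ s ∈ T, ∀ t ∈ T, ℓ (s⁻¹ * t) = 0 → s = t) → T.card ≤ C * n ^ d
  gen : ∃ m, Subgroup.closure {g | ℓ g ≤ m} = ⊤

variable {Γ : Type*} [Group Γ] {ℓ : Γ → ℕ}

namespace IsLength

variable (hl : IsLength ℓ)
include hl

/-- The subgroup of elements of length zero. -/
def ker : Subgroup Γ where
  carrier := {g | ℓ g = 0}
  one_mem' := hl.one
  mul_mem' {a b} ha hb := by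
    have := hl.mul_le a b
    change ℓ a = 0 at ha
    change ℓ b = 0 at hb
    change ℓ (a * b) = 0
    omega
  inv_mem' {a} ha := (hl.inv a).trans ha

theorem mul_right_eq (g : Γ) {u : Γ} (hu : ℓ u = 0) : ℓ (g * u) = ℓ g := by
  have h1 := hl.mul_le g u
  have h2 := hl.mul_le (g * u) u⁻¹
  rw [mul_inv_cancel_right, hl.inv] at h2
  omega

theorem mul_left_eq (g : Γ) {u : Γ} (hu : ℓ u = 0) : ℓ (u * g) = ℓ g := by
  rw [← hl.inv, mul_inv_rev, hl.mul_right_eq _ ((hl.inv u).trans hu), hl.inv]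

theorem comp {Λ : Type*} [Group Λ] (f : Λ →* Γ) : IsLength (fun g => ℓ (f g)) where
  one := by rw [map_one, hl.one]
  mul_le g h := by rw [map_mul]; exact hl.mul_le _ _
  inv g := by rw [map_inv, hl.inv]

theorem pow_le (g : Γ) (n : ℕ) : ℓ (g ^ n) ≤ n * ℓ g := by
  induction n with
  | zero => rw [pow_zero, hl.one]; exact Nat.zero_le _
  | succ n ih =>
    rw [pow_succ]
    have := hl.mul_le (g ^ n) g
    rw [add_mul, one_mul]; omega

end IsLength

namespace LenGroup

variable {d : ℕ} (hG : LenGroup ℓ d)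
include hG

theorem exists_ncard_le : ∃ C : ℕ, ∀ n, 1 ≤ n →
    (QuotientGroup.mk (s := hG.ker) '' {g : Γ | ℓ g ≤ n}).Finite ∧
    (QuotientGroup.mk (s := hG.ker) '' {g : Γ | ℓ g ≤ n}).ncard ≤ C * n ^ d := by
  classical
  obtain ⟨C, hC⟩ := hG.growth
  refine ⟨C, fun n hn => ?_⟩
  have key : ∀ T : Finset (Γ ⧸ hG.ker),
      (SetLike.coe T) ⊆ QuotientGroup.mk (s := hG.ker) '' {g : Γ | ℓ g ≤ n} →
      T.card ≤ C * n ^ d := by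
    intro T hT
    have hinj : Function.Injective (Quotient.out : Γ ⧸ hG.ker → Γ) := Quotient.out_injective
    rw [← card_image_of_injective T hinj]
    refine hC n hn _ ?_ ?_
    · intro t ht
      obtain ⟨q, hq, rfl⟩ := mem_image.1 ht
      obtain ⟨g, hg, rfl⟩ := hT hq
      obtain ⟨u, hu⟩ := QuotientGroup.mk_out_eq_mul hG.ker g
      rw [hu, hG.mul_right_eq _ u.2]
      exact hg
    · intro s hs t ht h
      obtain ⟨q, hq, rfl⟩ := mem_image.1 hs
      obtain ⟨r, hr, rfl⟩ := mem_image.1 ht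
      have := (QuotientGroup.eq (s := hG.ker)).2 h
      rw [QuotientGroup.out_eq', QuotientGroup.out_eq'] at this
      rw [this]
  have hfin : (QuotientGroup.mk (s := hG.ker) '' {g : Γ | ℓ g ≤ n}).Finite := by
    by_contra hinf
    obtain ⟨T, hT, hcard⟩ := Set.Infinite.exists_subset_card_eq hinf (C * n ^ d + 1)
    have := key T hT
    omega
  refine ⟨hfin, ?_⟩
  rw [Set.ncard_eq_toFinset_card _ hfin]
  exact key _ (by intro q hq; exact hfin.mem_toFinset.1 hq)

theorem finite_mk_image (n : ℕ) :
    (QuotientGroup.mk (s := hG.ker) '' {g : Γ | ℓ g ≤ n}).Finite := by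
  obtain ⟨C, hC⟩ := hG.exists_ncard_le
  exact (hC (n + 1) (Nat.le_add_left _ _)).1.subset
    (Set.image_mono fun g hg => le_trans hg (Nat.le_succ n))

/-- A homomorphism with finite image on the kernel of the length is finite on balls. -/
theorem finite_image_of_finite_image_ker {M : Type*} [Monoid M] (f : Γ →* M)
    (hf : (f '' hG.ker).Finite) (n : ℕ) : (f '' {g | ℓ g ≤ n}).Finite := by
  refine (((hG.finite_mk_image n).image fun q => f q.out).mul hf).subset ?_
  rintro _ ⟨g, hg, rfl⟩
  refine Set.mem_mul.2 ⟨_, ⟨_, ⟨g, hg, rfl⟩, rfl⟩, f ((QuotientGroup.mk g : Γ ⧸ hG.ker).out⁻¹ * g),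
    ⟨_, QuotientGroup.eq.1 (QuotientGroup.out_eq' _), rfl⟩, ?_⟩
  rw [← map_mul, mul_inv_cancel_left]

theorem subgroup (K : Subgroup Γ) [K.FiniteIndex] : LenGroup (fun g : K => ℓ g) d := by
  refine { toIsLength := hG.toIsLength.comp K.subtype, growth := ?_, gen := ?_ }
  · obtain ⟨C, hC⟩ := hG.growth
    refine ⟨C, fun n hn T hT hsep => ?_⟩
    have := hC n hn (T.map ⟨K.subtype, K.subtype_injective⟩) ?_ ?_
    · rwa [card_map] at this
    · intro t ht
      obtain ⟨s, hs, rfl⟩ := mem_map.1 ht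
      exact hT s hs
    · intro s hs t ht h
      obtain ⟨s, hs', rfl⟩ := mem_map.1 hs
      obtain ⟨t, ht', rfl⟩ := mem_map.1 ht
      exact congrArg _ (hsep s hs' t ht' h)
  · obtain ⟨m, hm⟩ := hG.gen
    obtain ⟨R, hR, hR1⟩ := K.exists_isComplement_right 1
    have hRf : R.Finite := hR.finite_right
    obtain ⟨b, hb⟩ := (hRf.image ℓ).bddAbove
    have hb' : ∀ r ∈ R, ℓ r ≤ b := fun r hr => hb ⟨r, hr, rfl⟩
    refine ⟨b + m + b, eq_top_iff.2 ?_⟩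
    rw [← Subgroup.closure_mul_image_eq_top hR hR1 hm, Subgroup.closure_le]
    rintro _ ⟨x, hx, rfl⟩
    obtain ⟨r, hr, s, hs, rfl⟩ := Set.mem_mul.1 hx
    refine Subgroup.subset_closure ?_
    change ℓ (r * s * _) ≤ _
    refine (hG.mul_le _ _).trans (add_le_add ((hG.mul_le _ _).trans (add_le_add (hb' r hr) hs)) ?_)
    rw [hG.inv]
    exact hb' _ (Subtype.mem _)

end LenGroup

end Length

section EdgeRep

open scoped BoundedContinuousFunction

variable {V : Type*}

/-- The oriented edges of the reflexive graph `nb`. -/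
def Edge (nb : V → Finset V) : Type _ := {p : V × V // p.2 ∈ nb p.1}

instance (nb : V → Finset V) : TopologicalSpace (Edge nb) := ⊥

instance (nb : V → Finset V) : DiscreteTopology (Edge nb) := ⟨rfl⟩

theorem finite_range_of_factor {S Y Z : Type*} [Finite Z] (f : S → Y) (Φ : S → Z)
    (h : ∀ u v, Φ u = Φ v → f u = f v) : (Set.range f).Finite := by
  refine Finite.of_injective (fun y : Set.range f => Φ y.2.choose) fun y z hyz => ?_
  have := h _ _ hyz
  rw [y.2.choose_spec, z.2.choose_spec] at this
  exact Subtype.ext this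

theorem exists_finset_separating {X : Type*} [TopologicalSpace X] (E : Submodule ℂ (X →ᵇ ℂ))
    [FiniteDimensional ℂ E] :
    ∃ A : Finset X, ∀ F ∈ E, ∀ F' ∈ E, (∀ a ∈ A, F a = F' a) → F = F' := by
  classical
  let K : Finset X → Submodule ℂ E := fun A =>
    { carrier := {F | ∀ a ∈ A, (F : X →ᵇ ℂ) a = 0}
      zero_mem' := fun a _ => rfl
      add_mem' := fun {F F'} hF hF' a ha => by
        change (F : X →ᵇ ℂ) a + (F' : X →ᵇ ℂ) a = 0
        rw [hF a ha, hF' a ha, add_zero]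
      smul_mem' := fun c F hF a ha => by
        change c * (F : X →ᵇ ℂ) a = 0
        rw [hF a ha, mul_zero] }
  obtain ⟨_, ⟨A, rfl⟩, hA⟩ := set_has_minimal_iff_artinian.2
    (inferInstance : IsArtinian ℂ E) (Set.range K) ⟨_, ⟨∅, rfl⟩⟩
  have hz : ∀ F ∈ K A, F = 0 := by
    intro F hF
    ext x
    by_contra hx
    refine hA (K (insert x A)) ⟨_, rfl⟩ (lt_of_le_of_ne
      (fun F' hF' a ha => hF' a (mem_insert_of_mem ha)) fun h => ?_)
    rw [← h] at hF
    exact hx (hF x (mem_insert_self _ _))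
  refine ⟨A, fun F hF F' hF' h => ?_⟩
  have := hz (⟨F, hF⟩ - ⟨F', hF'⟩) fun a ha => by
    change F a - F' a = 0
    rw [h a ha, sub_self]
  rw [sub_eq_zero] at this
  exact congrArg Subtype.val this

variable [DecidableEq V]

/-- The discrete gradient of a Lipschitz harmonic function. -/
noncomputable def grad (nb : V → Finset V) : lipHarm nb →ₗ[ℝ] (Edge nb →ᵇ ℂ) where
  toFun f := BoundedContinuousFunction.ofNormedAddCommGroupDiscrete
    (fun e => ((f.1 e.1.1 - f.1 e.1.2 : ℝ) : ℂ)) f.2.2.choose fun e => by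
      rw [Complex.norm_real]
      exact f.2.2.choose_spec _ _ e.2
  map_add' f g := by
    ext e
    change ((_ : ℝ) : ℂ) = ((_ : ℝ) : ℂ) + ((_ : ℝ) : ℂ)
    rw [← Complex.ofReal_add]
    congr 1
    change (f.1 _ + g.1 _) - (f.1 _ + g.1 _) = _
    ring
  map_smul' c f := by
    ext e
    change ((_ : ℝ) : ℂ) = c • ((_ : ℝ) : ℂ)
    rw [Complex.real_smul, ← Complex.ofReal_mul]
    congr 1
    change c * f.1 _ - c * f.1 _ = _
    ring

/-- The complex span of the gradients of Lipschitz harmonic functions. -/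
noncomputable def gradSpan (nb : V → Finset V) : Submodule ℂ (Edge nb →ᵇ ℂ) :=
  Submodule.span ℂ (Set.range (grad nb))

variable {Γ : Type*} [Group Γ] [MulAction Γ V] {nb : V → Finset V}

namespace Homog

variable (hG : Homog Γ nb)
include hG

theorem finiteDimensional_gradSpan : FiniteDimensional ℂ (gradSpan nb) := by
  have := hG.finiteDimensional_lipHarm
  obtain ⟨B, hB⟩ := (Module.finite_def (R := ℝ) (M := lipHarm nb)).1 this
  have hle : gradSpan nb ≤ Submodule.span ℂ (grad nb '' (SetLike.coe B)) := by
    rw [gradSpan, Submodule.span_le]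
    rintro _ ⟨f, rfl⟩
    have hf : f ∈ Submodule.span ℝ (SetLike.coe B) := hB ▸ Submodule.mem_top
    induction hf using Submodule.span_induction with
    | mem x hx => exact Submodule.subset_span ⟨x, hx, rfl⟩
    | zero => rw [map_zero]; exact Submodule.zero_mem _
    | add x y _ _ hx hy => rw [map_add]; exact Submodule.add_mem _ hx hy
    | smul c x _ hx =>
      rw [map_smul, ← Complex.coe_smul]
      exact Submodule.smul_mem _ _ hx
  have : FiniteDimensional ℂ (Submodule.span ℂ (grad nb '' (SetLike.coe B))) :=
    FiniteDimensional.span_of_finite ℂ (B.finite_toSet.image _)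
  exact Submodule.finiteDimensional_of_le hle

/-- The action on oriented edges. -/
def edgeSmul (g : Γ) (e : Edge nb) : Edge nb :=
  ⟨(g • e.1.1, g • e.1.2), hG.smul_mem g _ _ e.2⟩

theorem norm_compContinuous_edgeSmul_le (g : Γ) (F : Edge nb →ᵇ ℂ) :
    ‖F.compContinuous ⟨hG.edgeSmul g, continuous_of_discreteTopology⟩‖ ≤ 1 * ‖F‖ := by
  rw [one_mul]
  exact (BoundedContinuousFunction.norm_le (norm_nonneg _)).2 fun e => F.norm_coe_le_norm _

/-- The isometric representation on bounded functions on the set of oriented edges. -/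
noncomputable def edgeRep : Γ →* ((Edge nb →ᵇ ℂ) →L[ℂ] (Edge nb →ᵇ ℂ)) where
  toFun g := LinearMap.mkContinuous
    { toFun := fun F => F.compContinuous ⟨hG.edgeSmul g⁻¹, continuous_of_discreteTopology⟩
      map_add' := fun _ _ => rfl
      map_smul' := fun _ _ => rfl } 1 (hG.norm_compContinuous_edgeSmul_le g⁻¹)
  map_one' := by
    ext F e
    change F (hG.edgeSmul 1⁻¹ e) = F e
    congr 1
    refine Subtype.ext (Prod.ext ?_ ?_) <;> simp [edgeSmul]
  map_mul' g h := by
    ext F e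
    change F (hG.edgeSmul (g * h)⁻¹ e) = F (hG.edgeSmul h⁻¹ (hG.edgeSmul g⁻¹ e))
    congr 1
    refine Subtype.ext (Prod.ext ?_ ?_) <;> simp [edgeSmul, mul_smul]

theorem norm_edgeRep_le (g : Γ) : ‖hG.edgeRep g‖ ≤ 1 :=
  LinearMap.mkContinuous_norm_le _ zero_le_one (hG.norm_compContinuous_edgeSmul_le g⁻¹)

theorem translate_mem_lipHarm (g : Γ) {f : V → ℝ} (hf : f ∈ lipHarm nb) :
    (fun x => f (g • x)) ∈ lipHarm nb := by
  obtain ⟨hh, c, hc⟩ := hf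
  refine ⟨fun x => ?_, c, fun x y hy => hc _ _ (hG.smul_mem g _ _ hy)⟩
  rw [← hh (g • x), hG.sum_ball_smul]
  exact sum_congr rfl fun y _ => by rw [hG.walks_smul]

theorem edgeRep_mem (g : Γ) : ∀ F ∈ gradSpan nb, hG.edgeRep g F ∈ gradSpan nb := by
  intro F hF
  induction hF using Submodule.span_induction with
  | mem x hx =>
    obtain ⟨f, rfl⟩ := hx
    exact Submodule.subset_span ⟨⟨_, hG.translate_mem_lipHarm g⁻¹ f.2⟩, rfl⟩
  | zero => rw [map_zero]; exact Submodule.zero_mem _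
  | add x y _ _ hx hy => rw [map_add]; exact Submodule.add_mem _ hx hy
  | smul c x _ hx => rw [map_smul]; exact Submodule.smul_mem _ _ hx

/-- The representation of `Γ` on gradients of Lipschitz harmonic functions. -/
noncomputable def gradRep : Γ →* (gradSpan nb →L[ℂ] gradSpan nb) :=
  subrep hG.edgeRep (gradSpan nb) hG.edgeRep_mem

theorem norm_gradRep_le (g : Γ) : ‖hG.gradRep g‖ ≤ 1 :=
  norm_subrep_le _ hG.norm_edgeRep_le _ _ g

theorem finite_gradRep_stabilizer (o : V) :
    (hG.gradRep '' (MulAction.stabilizer Γ o : Set Γ)).Finite := by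
  have := hG.finiteDimensional_gradSpan
  obtain ⟨A, hA⟩ := exists_finset_separating (gradSpan nb)
  obtain ⟨N, hN⟩ : ∃ N, ∀ a ∈ A, a.1.1 ∈ ball nb N o ∧ a.1.2 ∈ ball nb N o := by
    refine ⟨A.sup fun a => gdist nb o a.1.1 + gdist nb o a.1.2, fun a ha => ?_⟩
    have : gdist nb o a.1.1 + gdist nb o a.1.2 ≤ _ :=
      le_sup (f := fun a : Edge nb => gdist nb o a.1.1 + gdist nb o a.1.2) ha
    constructor <;> rw [hG.mem_ball_iff_gdist_le] <;> omega
  have hstab : ∀ u ∈ MulAction.stabilizer Γ o, ∀ x ∈ ball nb N o, u⁻¹ • x ∈ ball nb N o := by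
    intro u hu x hx
    have := (hG.smul_mem_ball u⁻¹).2 hx
    rwa [MulAction.mem_stabilizer_iff.1 (inv_mem hu)] at this
  rw [Set.image_eq_range]
  refine finite_range_of_factor _ (fun u (a : A) =>
    ((⟨_, hstab u u.2 _ (hN a a.2).1⟩, ⟨_, hstab u u.2 _ (hN a a.2).2⟩) :
      (ball nb N o) × (ball nb N o))) fun u v huv => ?_
  ext F : 1
  refine Subtype.ext (hA _ (Subtype.mem _) _ (Subtype.mem _) fun a ha => ?_)
  have h := congrFun huv ⟨a, ha⟩
  rw [Prod.ext_iff, Subtype.ext_iff, Subtype.ext_iff] at h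
  change F.1 (hG.edgeSmul (u : Γ)⁻¹ a) = F.1 (hG.edgeSmul (v : Γ)⁻¹ a)
  congr 1
  exact Subtype.ext (Prod.ext h.1 h.2)

theorem translate_sub_of_mem_ker {g : Γ} (hg : g ∈ hG.gradRep.ker) {f : V → ℝ}
    (hf : f ∈ lipHarm nb) (x y : V) : f (g⁻¹ • x) - f x = f (g⁻¹ • y) - f y := by
  have hedge : ∀ x, ∀ y ∈ nb x, f (g⁻¹ • x) - f (g⁻¹ • y) = f x - f y := by
    intro x y hy
    have h := congrArg (fun A => ((A ⟨grad nb ⟨f, hf⟩, Submodule.subset_span ⟨_, rfl⟩⟩ :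
      gradSpan nb) : Edge nb →ᵇ ℂ) ⟨(x, y), hy⟩) hg
    exact Complex.ofReal_injective h
  obtain ⟨n, hn⟩ := hG.conn x y
  induction n generalizing x with
  | zero => rw [mem_ball_zero.1 hn]
  | succ n ih =>
    obtain ⟨z, hz, hy⟩ := mem_ball_succ.1 hn
    rw [← ih z hy]
    linarith [hedge x z hz]

theorem eq_of_finite_range {f : V → ℝ} (hf : f ∈ lipHarm nb) (hfin : (Set.range f).Finite)
    (x y : V) : f x = f y := by
  obtain ⟨_, ⟨m, rfl⟩, hm⟩ := Set.exists_max_image _ id hfin ⟨_, ⟨x, rfl⟩⟩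
  have hmax : ∀ z, f z ≤ f m := fun z => hm _ ⟨z, rfl⟩
  have key : ∀ n, ∀ z, f z = f m → ∀ w ∈ ball nb n z, f w = f m := by
    intro n
    induction n with
    | zero => intro z hz w hw; rw [mem_ball_zero.1 hw, hz]
    | succ n ih =>
      intro z hz w hw
      obtain ⟨t, ht, hw⟩ := mem_ball_succ.1 hw
      refine ih t ?_ w hw
      have ht2 : t ∈ ball nb 2 z := hG.ball_mono (by norm_num : 1 ≤ 2) z (by rwa [ball_one])
      have h0 := (sum_eq_zero_iff_of_nonneg (fun v _ => mul_nonneg (walks_nonneg 2 z v)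
        (sub_nonneg.2 (by rw [hz]; exact hmax v)))).1 (hf.1 z) t ht2
      have := one_le_walks ht2
      rcases mul_eq_zero.1 h0 with h | h <;> linarith
  obtain ⟨n, hn⟩ := hG.conn m x
  obtain ⟨n', hn'⟩ := hG.conn m y
  rw [key n m rfl x hn, key n' m rfl y hn']

end Homog

end EdgeRep

section HomInt

theorem exists_surjective_int (R : Type*) [CommGroup R] [Group.FG R] [Infinite R] :
    ∃ ψ : R →* Multiplicative ℤ, Function.Surjective ψ := by
  obtain ⟨ι, j, _, _, p, hp, e, ⟨E⟩⟩ := CommGroup.equiv_free_prod_prod_multiplicative_zmod R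
  rcases isEmpty_or_nonempty j with hj | ⟨⟨i⟩⟩
  · have : ∀ i, NeZero (p i ^ e i) := fun i => ⟨pow_ne_zero _ (hp i).ne_zero⟩
    have : ∀ i, Finite (Multiplicative (ZMod (p i ^ e i))) := fun i =>
      inferInstanceAs (Finite (ZMod (p i ^ e i)))
    exact absurd (Finite.of_equiv _ E.toEquiv.symm) (not_finite_iff_infinite.2 inferInstance)
  · refine ⟨((Pi.evalMonoidHom _ i).comp (MonoidHom.fst _ _)).comp E.toMonoidHom, fun z => ?_⟩
    refine ⟨E.symm (fun _ => z, 1), ?_⟩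
    simp

theorem eq_one_of_pow_eq_one_int {z : Multiplicative ℤ} {n : ℕ} (hn : 0 < n) (h : z ^ n = 1) :
    z = 1 := by
  have h1 : (n : ℤ) * z.toAdd = 0 := by
    have := congrArg Multiplicative.toAdd h
    rwa [toAdd_pow, nsmul_eq_mul, toAdd_one] at this
  rcases mul_eq_zero.1 h1 with h | h
  · omega
  · exact h

theorem map_eq_one_int_of_finite {G M : Type*} [Group G] [Monoid M] (c : G →* M)
    (ψ : G →* Multiplicative ℤ) (hψ : ∀ a b, c a = c b → ψ a = ψ b) {K : Subgroup G}
    (hK : (c '' K).Finite) {u : G} (hu : u ∈ K) : ψ u = 1 := by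
  have hfin : (Set.range fun n : ℕ => c (u ^ n)).Finite :=
    hK.subset (by rintro _ ⟨n, rfl⟩; exact ⟨_, pow_mem hu n, rfl⟩)
  have : ¬ Function.Injective fun n : ℕ => c (u ^ n) := fun hinj =>
    Set.infinite_range_of_injective hinj hfin
  rw [Function.Injective] at this
  push Not at this
  obtain ⟨a, b, hab, hne⟩ := this
  have key : ∀ {a b : ℕ}, c (u ^ a) = c (u ^ b) → a < b → ψ u = 1 := by
    intro a b hab hlt
    have h := hψ _ _ hab
    rw [map_pow, map_pow] at h
    refine eq_one_of_pow_eq_one_int (n := b - a) (by omega) ?_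
    have e : ψ u ^ a * ψ u ^ (b - a) = ψ u ^ b := by rw [← pow_add]; congr 1; omega
    rw [← h] at e
    exact mul_eq_left.1 e
  rcases lt_or_gt_of_ne hne with h | h
  · exact key hab h
  · exact key hab.symm h

variable {Γ : Type*} [Group Γ] {ℓ : Γ → ℕ} {d : ℕ}

namespace LenGroup

variable (hG : LenGroup ℓ d)
include hG

theorem exists_hom_int_of_infinite_range {A : Type*} [CommGroup A] (K : Subgroup Γ)
    [K.FiniteIndex] (c : K →* A) (hinf : (Set.range c).Infinite)
    (hfin : (c '' {g | ℓ g = 0}).Finite) :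
    ∃ Γ₁ : Subgroup Γ, Γ₁.Normal ∧ Γ₁.FiniteIndex ∧ ∃ φ : Γ₁ →* Multiplicative ℤ,
      Function.Surjective φ ∧ ∀ g : Γ₁, ℓ g = 0 → φ g = 1 := by
  let i : K.normalCore →* K := Subgroup.inclusion K.normalCore_le
  have hL := hG.subgroup K.normalCore
  have hr : Set.range (c.comp i) = Set.range (c.comp (K.normalCore.subgroupOf K).subtype) := by
    ext a
    constructor
    · rintro ⟨g, rfl⟩
      exact ⟨⟨i g, g.2⟩, rfl⟩
    · rintro ⟨g, rfl⟩
      exact ⟨⟨_, g.2⟩, rfl⟩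
  have hinf' : (Set.range (c.comp i)).Infinite := by
    rw [hr]; exact infinite_range_comp_subtype c hinf _
  have hfin' : (c.comp i '' hL.ker).Finite :=
    hfin.subset (by rintro _ ⟨g, hg, rfl⟩; exact ⟨i g, hg, rfl⟩)
  obtain ⟨m, hm⟩ := hL.gen
  have hfg : Group.FG (c.comp i).range := by
    rw [Group.fg_iff_subgroup_fg, Subgroup.fg_iff]
    refine ⟨_, ?_, hL.finite_image_of_finite_image_ker (c.comp i) hfin' m⟩
    rw [← MonoidHom.map_closure, hm, MonoidHom.range_eq_map]
  have : Infinite (c.comp i).range := hinf'.to_subtype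
  obtain ⟨ψ, hψ⟩ := exists_surjective_int (c.comp i).range
  refine ⟨K.normalCore, inferInstance, inferInstance, ψ.comp (c.comp i).rangeRestrict,
    hψ.comp (c.comp i).rangeRestrict_surjective, fun g hg => ?_⟩
  refine map_eq_one_int_of_finite (c.comp i) (ψ.comp (c.comp i).rangeRestrict)
    (fun a b h => ?_) hfin' (u := g) hg
  exact congrArg ψ (Subtype.ext h)

open scoped Pointwise in
theorem growthLE_of_surjective {G : Type*} [Group G] (f : Γ →* G) (hf : Function.Surjective f)
    (hU : (f '' hG.ker).Finite) : GrowthLE G d ∧ Group.FG G := by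
  constructor
  · intro S hS
    choose σ hσ using hf
    obtain ⟨b, hb⟩ := (hS.image fun s => ℓ (σ s)).bddAbove
    have hb' : ∀ s ∈ S, ℓ (σ s) ≤ b + 1 := fun s hs => (hb ⟨s, hs, rfl⟩).trans (Nat.le_succ b)
    have hlift : ∀ n, S ^ n ⊆ f '' {g | ℓ g ≤ n * (b + 1)} := by
      intro n
      induction n with
      | zero =>
        rw [pow_zero]
        rintro _ rfl
        exact ⟨1, by simp [hG.one], map_one f⟩
      | succ n ih =>
        rw [pow_succ]
        rintro _ ⟨x, hx, s, hs, rfl⟩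
        obtain ⟨g, hg, rfl⟩ := ih hx
        refine ⟨g * σ s, (hG.mul_le _ _).trans ?_, by rw [map_mul, hσ]⟩
        rw [add_mul, one_mul]
        exact add_le_add hg (hb' s hs)
    obtain ⟨C, hC⟩ := hG.exists_ncard_le
    refine ⟨C * (b + 1) ^ d * (f '' hG.ker).ncard, fun n hn => ?_⟩
    obtain ⟨h1, h2⟩ := hC (n * (b + 1)) (Nat.one_le_iff_ne_zero.2 (by positivity))
    have hsub : S ^ n ⊆ (fun q : Γ ⧸ hG.ker => f q.out) ''
        (QuotientGroup.mk '' {g : Γ | ℓ g ≤ n * (b + 1)}) * f '' hG.ker := by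
      refine (hlift n).trans ?_
      rintro _ ⟨g, hg, rfl⟩
      refine Set.mem_mul.2 ⟨_, ⟨_, ⟨g, hg, rfl⟩, rfl⟩,
        f ((QuotientGroup.mk g : Γ ⧸ hG.ker).out⁻¹ * g),
        ⟨_, QuotientGroup.eq.1 (QuotientGroup.out_eq' _), rfl⟩, ?_⟩
      rw [← map_mul, mul_inv_cancel_left]
    refine (Set.ncard_le_ncard hsub ((h1.image _).mul hU)).trans ?_
    have h3 := Set.natCard_mul_le (s := (fun q : Γ ⧸ hG.ker => f q.out) ''
        (QuotientGroup.mk '' {g : Γ | ℓ g ≤ n * (b + 1)})) (t := f '' hG.ker)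
    rw [Nat.card_coe_set_eq, Nat.card_coe_set_eq, Nat.card_coe_set_eq] at h3
    refine h3.trans ?_
    refine (Nat.mul_le_mul_right _ ((Set.ncard_image_le h1).trans h2)).trans (le_of_eq ?_)
    rw [mul_pow]; ring
  · obtain ⟨m, hm⟩ := hG.gen
    rw [Group.fg_def, Subgroup.fg_iff]
    refine ⟨_, ?_, hG.finite_image_of_finite_image_ker f hU m⟩
    rw [← MonoidHom.map_closure, hm, ← MonoidHom.range_eq_map, MonoidHom.range_eq_top.2 hf]

open scoped Classical in
/-- The coset space of the kernel of a length function of polynomial growth carries a homogeneous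
graph structure. -/
theorem exists_homog : ∃ nb : (Γ ⧸ hG.ker) → Finset (Γ ⧸ hG.ker), Homog Γ nb := by
  obtain ⟨m, hm⟩ := hG.gen
  have hfin : ∀ x : Γ ⧸ hG.ker, {y : Γ ⧸ hG.ker | ℓ (x.out⁻¹ * y.out) ≤ m}.Finite := by
    intro x
    refine ((hG.finite_mk_image m).image fun y => x.out • y).subset fun y hy => ?_
    refine ⟨_, ⟨x.out⁻¹ * y.out, hy, rfl⟩, ?_⟩
    change QuotientGroup.mk (x.out * (x.out⁻¹ * y.out)) = y
    rw [mul_inv_cancel_left, QuotientGroup.out_eq']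
  have hout : ∀ g h : Γ, ℓ ((QuotientGroup.mk g : Γ ⧸ hG.ker).out⁻¹ *
      (QuotientGroup.mk h : Γ ⧸ hG.ker).out) = ℓ (g⁻¹ * h) := by
    intro g h
    obtain ⟨u, hu⟩ := QuotientGroup.mk_out_eq_mul hG.ker g
    obtain ⟨v, hv⟩ := QuotientGroup.mk_out_eq_mul hG.ker h
    rw [hu, hv, mul_inv_rev, ← mul_assoc, hG.mul_right_eq _ v.2, mul_assoc,
      hG.mul_left_eq _ (inv_mem u.2)]
  let nb : (Γ ⧸ hG.ker) → Finset (Γ ⧸ hG.ker) := fun x => (hfin x).toFinset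
  have hnb : ∀ g h : Γ, (QuotientGroup.mk h : Γ ⧸ hG.ker) ∈ nb (QuotientGroup.mk g) ↔
      ℓ (g⁻¹ * h) ≤ m := by
    intro g h
    rw [Set.Finite.mem_toFinset, ← hout g h]
    rfl
  have hball : ∀ n, ∀ g h : Γ, (QuotientGroup.mk h : Γ ⧸ hG.ker) ∈ ball nb n (QuotientGroup.mk g) →
      ℓ (g⁻¹ * h) ≤ n * m := by
    intro n
    induction n with
    | zero =>
      intro g h hh
      rw [mem_ball_zero, eq_comm, QuotientGroup.eq] at hh
      rw [zero_mul]
      exact le_of_eq hh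
    | succ n ih =>
      intro g h hh
      obtain ⟨z, hz, hy⟩ := mem_ball_succ.1 hh
      obtain ⟨z, rfl⟩ := QuotientGroup.mk_surjective z
      have h1 := (hnb g z).1 hz
      have h2 := ih z h hy
      have h3 := hG.mul_le (g⁻¹ * z) (z⁻¹ * h)
      rw [mul_assoc, mul_inv_cancel_left] at h3
      rw [add_mul, one_mul]
      omega
  have hsmul : ∀ (g : Γ) x y, y ∈ nb x → g • y ∈ nb (g • x) := by
    intro g x y
    obtain ⟨x, rfl⟩ := QuotientGroup.mk_surjective x
    obtain ⟨y, rfl⟩ := QuotientGroup.mk_surjective y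
    intro h
    refine (hnb (g * x) (g * y)).2 ?_
    rw [mul_inv_rev, mul_assoc, inv_mul_cancel_left]
    exact (hnb x y).1 h
  have hsmulb : ∀ n, ∀ (g : Γ) x y, y ∈ ball nb n x → g • y ∈ ball nb n (g • x) := by
    intro n
    induction n with
    | zero => intro g x y h; rw [mem_ball_zero] at h ⊢; rw [h]
    | succ n ih =>
      intro g x y h
      obtain ⟨z, hz, hy⟩ := mem_ball_succ.1 h
      exact mem_ball_succ.2 ⟨g • z, hsmul g x z hz, ih g z y hy⟩
  refine ⟨nb, ?_, ?_, hsmul, ?_, ?_, ?_⟩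
  · intro x
    obtain ⟨x, rfl⟩ := QuotientGroup.mk_surjective x
    refine (hnb x x).2 ?_
    rw [inv_mul_cancel, hG.one]
    exact Nat.zero_le _
  · intro x y
    obtain ⟨x, rfl⟩ := QuotientGroup.mk_surjective x
    obtain ⟨y, rfl⟩ := QuotientGroup.mk_surjective y
    rw [hnb, hnb, ← hG.inv, mul_inv_rev, inv_inv]
    exact id
  · intro x y
    obtain ⟨x, rfl⟩ := QuotientGroup.mk_surjective x
    obtain ⟨y, rfl⟩ := QuotientGroup.mk_surjective y
    refine ⟨y * x⁻¹, ?_⟩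
    change QuotientGroup.mk (y * x⁻¹ * x) = _
    rw [inv_mul_cancel_right]
  · intro x y
    obtain ⟨x, rfl⟩ := QuotientGroup.mk_surjective x
    obtain ⟨y, rfl⟩ := QuotientGroup.mk_surjective y
    have key : ∀ g ∈ Subgroup.closure {g | ℓ g ≤ m}, ∃ n,
        (QuotientGroup.mk g : Γ ⧸ hG.ker) ∈ ball nb n (QuotientGroup.mk 1) := by
      intro g hg
      induction hg using Subgroup.closure_induction with
      | mem g hg =>
        refine ⟨1, ?_⟩
        rw [ball_one, hnb, inv_one, one_mul]
        exact hg
      | one => exact ⟨0, mem_ball_zero.2 rfl⟩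
      | mul g h _ _ hg hh =>
        obtain ⟨n, hn⟩ := hg
        obtain ⟨k, hk⟩ := hh
        refine ⟨n + k, ball_trans hn ?_⟩
        have := hsmulb k g _ _ hk
        rwa [MulAction.Quotient.smul_mk, MulAction.Quotient.smul_mk,
          smul_eq_mul, smul_eq_mul, mul_one] at this
      | inv g _ hg =>
        obtain ⟨n, hn⟩ := hg
        have := hsmulb n g⁻¹ _ _ hn
        rw [MulAction.Quotient.smul_mk, MulAction.Quotient.smul_mk, smul_eq_mul, smul_eq_mul,
          mul_one, inv_mul_cancel] at this
        have hsym : ∀ n, ∀ x y, y ∈ ball nb n x → x ∈ ball nb n y := by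
          intro n
          induction n with
          | zero => intro x y h; rw [mem_ball_zero] at h ⊢; rw [h]
          | succ n ih =>
            intro x y h
            obtain ⟨z, hz, hy⟩ := mem_ball_succ.1 h
            refine mem_ball_add.2 ⟨z, ih _ _ hy, ?_⟩
            rw [ball_one]
            obtain ⟨x, rfl⟩ := QuotientGroup.mk_surjective x
            obtain ⟨z, rfl⟩ := QuotientGroup.mk_surjective z
            rw [hnb] at hz ⊢
            rwa [← hG.inv, mul_inv_rev, inv_inv]
        exact ⟨n, hsym _ _ _ this⟩
    obtain ⟨n, hn⟩ := key (x⁻¹ * y) (hm ▸ Subgroup.mem_top _)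
    refine ⟨n, ?_⟩
    have := hsmulb n x _ _ hn
    rwa [MulAction.Quotient.smul_mk, MulAction.Quotient.smul_mk, smul_eq_mul, smul_eq_mul,
      mul_one, mul_inv_cancel_left] at this
  · obtain ⟨C, hC⟩ := hG.exists_ncard_le
    refine ⟨C * (m + 1) ^ d, d, fun n hn x => ?_⟩
    obtain ⟨h1, h2⟩ := hC (n * (m + 1)) (Nat.one_le_iff_ne_zero.2 (by positivity))
    obtain ⟨x, rfl⟩ := QuotientGroup.mk_surjective x
    have hsub : SetLike.coe (ball nb n (QuotientGroup.mk x)) ⊆ (fun y => x • y) ''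
        (QuotientGroup.mk (s := hG.ker) '' {g : Γ | ℓ g ≤ n * (m + 1)}) := by
      intro y hy
      rw [SetLike.mem_coe] at hy
      obtain ⟨y, rfl⟩ := QuotientGroup.mk_surjective y
      refine ⟨_, ⟨x⁻¹ * y, (hball n x y hy).trans (Nat.mul_le_mul_left _ (Nat.le_succ m)), rfl⟩, ?_⟩
      change QuotientGroup.mk (x * (x⁻¹ * y)) = _
      rw [mul_inv_cancel_left]
    have := (Set.ncard_le_ncard hsub (h1.image _)).trans ((Set.ncard_image_le h1).trans h2)
    rw [Set.ncard_coe_finset, mul_pow] at this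
    linarith

end LenGroup

end HomInt

variable {Γ : Type*} [Group Γ] {ℓ : Γ → ℕ} {d : ℕ}

theorem LenGroup.exists_hom_int_of_virtIndicable (hG : LenGroup ℓ d) {Q : Type*} [Group Q]
    (π : Γ →* Q) (hπ : Function.Surjective π) (hU : (π '' hG.ker).Finite) (hQ : VirtIndicable Q) :
    ∃ Γ₁ : Subgroup Γ, Γ₁.Normal ∧ Γ₁.FiniteIndex ∧ ∃ φ : Γ₁ →* Multiplicative ℤ,
      Function.Surjective φ ∧ ∀ g : Γ₁, ℓ g = 0 → φ g = 1 := by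
  obtain ⟨K, hK, hKinf⟩ := hQ
  have : (K.comap π).FiniteIndex :=
    ⟨by rw [K.index_comap_of_surjective hπ]; exact hK.index_ne_zero⟩
  refine hG.exists_hom_int_of_infinite_range (K.comap π)
    (Abelianization.of.comp (π.subgroupComap K)) ?_ ?_
  · have hs : Function.Surjective (Abelianization.of.comp (π.subgroupComap K)) := by
      intro a
      obtain ⟨⟨q, hq⟩, rfl⟩ := QuotientGroup.mk_surjective a
      obtain ⟨g, rfl⟩ := hπ q
      exact ⟨⟨g, hq⟩, rfl⟩
    rw [Set.range_eq_univ.2 hs]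
    exact Set.infinite_univ
  · refine ((hU.preimage Subtype.val_injective.injOn).image
      (Abelianization.of : K →* Abelianization K)).subset ?_
    rintro _ ⟨g, hg, rfl⟩
    exact ⟨π.subgroupComap K g, ⟨g, hg, rfl⟩, rfl⟩

open scoped Classical in
/-- A group with a length function of polynomial growth, unbounded modulo the kernel of the length,
virtually surjects onto the integers, trivially on the kernel. -/
theorem LenGroup.exists_hom_int (hG : LenGroup ℓ d) [Infinite (Γ ⧸ hG.ker)] :
    ∃ Γ₁ : Subgroup Γ, Γ₁.Normal ∧ Γ₁.FiniteIndex ∧ ∃ φ : Γ₁ →* Multiplicative ℤ,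
      Function.Surjective φ ∧ ∀ g : Γ₁, ℓ g = 0 → φ g = 1 := by
  obtain ⟨nb, H⟩ := hG.exists_homog
  let o : Γ ⧸ hG.ker := QuotientGroup.mk 1
  have hstab : ∀ g, ℓ g = 0 → g • o = o := fun g hg => by
    change QuotientGroup.mk (g * 1) = (QuotientGroup.mk 1 : Γ ⧸ hG.ker)
    rw [mul_one, eq_comm, QuotientGroup.eq, inv_one, one_mul]
    exact hg
  by_cases hfin : (Set.range H.gradRep).Finite
  · have := finiteIndex_ker_of_finite_range _ hfin
    obtain ⟨f, hf, x, y, hxy⟩ := H.exists_nonconstant_lipHarm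
    let c : H.gradRep.ker →* Multiplicative ℝ :=
      { toFun := fun g => Multiplicative.ofAdd (f ((g : Γ)⁻¹ • o) - f o)
        map_one' := by simp
        map_mul' := fun g h => by
          rw [← ofAdd_add]
          congr 1
          have := H.translate_sub_of_mem_ker h.2 hf ((g : Γ)⁻¹ • o) o
          rw [Subgroup.coe_mul, mul_inv_rev, mul_smul]
          linarith }
    refine hG.exists_hom_int_of_infinite_range H.gradRep.ker c ?_ ?_
    · intro hc
      refine hxy (H.eq_of_finite_range hf ?_ x y)
      have hfq : Finite (Γ ⧸ H.gradRep.ker) := Subgroup.finite_quotient_of_finiteIndex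
      refine ((hc.image Multiplicative.toAdd).image2 (fun a (q : Γ ⧸ H.gradRep.ker) =>
        a + f (q.out⁻¹ • o)) Set.finite_univ).subset ?_
      rintro _ ⟨z, rfl⟩
      obtain ⟨g, rfl⟩ := H.trans o z
      have hk : (QuotientGroup.mk g⁻¹ : Γ ⧸ H.gradRep.ker).out⁻¹ * g⁻¹ ∈ H.gradRep.ker :=
        QuotientGroup.eq.1 (QuotientGroup.out_eq' _)
      set q := (QuotientGroup.mk g⁻¹ : Γ ⧸ H.gradRep.ker)
      refine ⟨_, ⟨_, ⟨⟨_, hk⟩, rfl⟩, rfl⟩, q, Set.mem_univ _, ?_⟩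
      have := H.translate_sub_of_mem_ker hk hf (q.out⁻¹ • o) o
      change f ((q.out⁻¹ * g⁻¹)⁻¹ • o) - f o + f (q.out⁻¹ • o) = f (g • o)
      rw [mul_inv_rev, inv_inv, inv_inv] at this ⊢
      rw [mul_smul, smul_inv_smul] at this
      linarith
    · refine (Set.finite_singleton 1).subset ?_
      rintro _ ⟨g, hg, rfl⟩
      change Multiplicative.ofAdd (f ((g : Γ)⁻¹ • o) - f o) = 1
      rw [hstab _ ((hG.inv _).trans hg), sub_self, ofAdd_zero]
  · have := H.finiteDimensional_gradSpan
    let Q := Γ ⧸ H.gradRep.ker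
    let π : Γ →* Q := QuotientGroup.mk' _
    let ρ : Q →* _ := QuotientGroup.lift H.gradRep.ker H.gradRep le_rfl
    have hρ : ∀ g : Γ, ρ (π g) = H.gradRep g := fun g => rfl
    have hρinj : Function.Injective ρ := (injective_iff_map_eq_one ρ).2 fun q hq => by
      obtain ⟨g, rfl⟩ := QuotientGroup.mk_surjective q
      exact (QuotientGroup.eq_one_iff g).2 hq
    have hU : (π '' hG.ker).Finite := by
      refine Set.Finite.of_finite_image (f := ρ) ?_ hρinj.injOn
      refine (H.finite_gradRep_stabilizer o).subset ?_
      rintro _ ⟨_, ⟨g, hg, rfl⟩, rfl⟩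
      exact ⟨g, MulAction.mem_stabilizer_iff.2 (hstab g hg), rfl⟩
    obtain ⟨hgr, hfg⟩ := hG.growthLE_of_surjective π (QuotientGroup.mk'_surjective _) hU
    have hrange : (Set.range ρ).Infinite := by
      refine Set.Infinite.mono ?_ hfin
      rintro _ ⟨g, rfl⟩
      exact ⟨π g, rfl⟩
    refine hG.exists_hom_int_of_virtIndicable π (QuotientGroup.mk'_surjective _) hU
      (virtIndicable_of_infinite_range _ Q _ rfl hfg hgr ρ (fun q => ?_) hrange)
    obtain ⟨g, rfl⟩ := QuotientGroup.mk_surjective q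
    exact H.norm_gradRep_le g

variable {Γ : Type*} [Group Γ] {ℓ : Γ → ℕ} {d : ℕ}

/-- The subgroup generated by the conjugates of `B` by `t ^ k` for `k` in `[a, b)`. -/
def conjSpan (t : Γ) (B : Set Γ) (a b : ℕ) : Subgroup Γ :=
  Subgroup.closure {x | ∃ k, a ≤ k ∧ k < b ∧ ∃ g ∈ B, x = t ^ k * g * (t ^ k)⁻¹}

theorem conj_mem_conjSpan {t : Γ} {B : Set Γ} {a b k : ℕ} (ha : a ≤ k) (hb : k < b) {g : Γ}
    (hg : g ∈ B) : t ^ k * g * (t ^ k)⁻¹ ∈ conjSpan t B a b :=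
  Subgroup.subset_closure ⟨k, ha, hb, g, hg, rfl⟩

theorem conjSpan_le {t : Γ} {B : Set Γ} {a b : ℕ} {H : Subgroup Γ}
    (h : ∀ k, a ≤ k → k < b → ∀ g ∈ B, t ^ k * g * (t ^ k)⁻¹ ∈ H) : conjSpan t B a b ≤ H := by
  refine (Subgroup.closure_le _).2 ?_
  rintro _ ⟨k, ha, hb, g, hg, rfl⟩
  exact h k ha hb g hg

theorem conjSpan_mono {t : Γ} {B : Set Γ} {a b a' b' : ℕ} (ha : a' ≤ a) (hb : b ≤ b') :
    conjSpan t B a b ≤ conjSpan t B a' b' :=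
  conjSpan_le fun _ h1 h2 _ hg => conj_mem_conjSpan (ha.trans h1) (h2.trans_le hb) hg

theorem conj_mem_of_mem_sup {t : Γ} {B : Set Γ} {U : Subgroup Γ} {j s : ℕ} (hs : 1 ≤ s)
    (hU : ∀ u ∈ U, t * u * t⁻¹ ∈ B) {x : Γ} (hx : x ∈ U ⊔ conjSpan t B 0 j) :
    t ^ s * x * (t ^ s)⁻¹ ∈ conjSpan t B 0 (s + j) := by
  suffices h : U ⊔ conjSpan t B 0 j ≤
      (conjSpan t B 0 (s + j)).comap (MulAut.conj (t ^ s)).toMonoidHom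
    from h hx
  refine sup_le (fun u hu => ?_) (conjSpan_le fun k _ hk g hg => ?_)
  · obtain ⟨s, rfl⟩ := Nat.exists_eq_add_of_le' hs
    change t ^ (s + 1) * u * (t ^ (s + 1))⁻¹ ∈ conjSpan t B 0 (s + 1 + j)
    have : t ^ (s + 1) * u * (t ^ (s + 1))⁻¹ = t ^ s * (t * u * t⁻¹) * (t ^ s)⁻¹ := by
      rw [pow_succ]; group
    rw [this]
    exact conj_mem_conjSpan (Nat.zero_le _) (by omega) (hU u hu)
  · change t ^ s * (t ^ k * g * (t ^ k)⁻¹) * (t ^ s)⁻¹ ∈ conjSpan t B 0 (s + j)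
    have : t ^ s * (t ^ k * g * (t ^ k)⁻¹) * (t ^ s)⁻¹ = t ^ (s + k) * g * (t ^ (s + k))⁻¹ := by
      rw [pow_add]; group
    rw [this]
    exact conj_mem_conjSpan (Nat.zero_le _) (by omega) hg

theorem IsLength.exists_separated (hl : IsLength ℓ) (t : Γ) {B : Set Γ} {f : Γ} (hf : f ∈ B)
    (n : ℕ)
    (h : ∀ j < n, t ^ j * f * (t ^ j)⁻¹ ∉ hl.ker ⊔ conjSpan t B 0 j) :
    ∃ W : Finset Γ, W.card = 2 ^ n ∧ (∀ w ∈ W, w ∈ hl.ker ⊔ conjSpan t B 0 n) ∧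
      (∀ w ∈ W, ℓ ((t ^ n)⁻¹ * w) ≤ n * (ℓ t + ℓ f)) ∧
      ∀ w ∈ W, ∀ w' ∈ W, ℓ (w⁻¹ * w') = 0 → w = w' := by
  classical
  induction n with
  | zero =>
    refine ⟨{1}, by simp, ?_, ?_, ?_⟩
    · simp [one_mem]
    · simp [hl.one]
    · simp
  | succ n ih =>
    obtain ⟨W, hc, hm, hlen, hsep⟩ := ih fun j hj => h j (Nat.lt_succ_of_lt hj)
    set F := t ^ n * f * (t ^ n)⁻¹ with hF
    have hFn : F ∉ hl.ker ⊔ conjSpan t B 0 n := h n (Nat.lt_succ_self n)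
    have hle : hl.ker ⊔ conjSpan t B 0 n ≤ hl.ker ⊔ conjSpan t B 0 (n + 1) :=
      sup_le_sup le_rfl (conjSpan_mono le_rfl (Nat.le_succ n))
    have hcross : ∀ w ∈ W, ∀ w' ∈ W, ℓ (w⁻¹ * (F * w')) ≠ 0 := by
      intro w hw w' hw' h0
      apply hFn
      have : F = w * (w⁻¹ * (F * w')) * w'⁻¹ := by group
      rw [this]
      exact mul_mem (mul_mem (hm w hw) (le_sup_left (a := hl.ker) (show _ ∈ hl.ker from h0)))
        (inv_mem (hm w' hw'))
    refine ⟨W ∪ W.image (F * ·), ?_, ?_, ?_, ?_⟩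
    · rw [card_union_of_disjoint, card_image_of_injective _ (mul_right_injective F), hc, pow_succ,
        mul_two]
      rw [disjoint_left]
      intro w hw hw'
      obtain ⟨w', hv', rfl⟩ := mem_image.1 hw'
      exact hcross _ hw _ hv' (by rw [inv_mul_cancel, hl.one])
    · intro w hw
      rcases mem_union.1 hw with hw | hw
      · exact hle (hm w hw)
      · obtain ⟨w, hv, rfl⟩ := mem_image.1 hw
        exact mul_mem (le_sup_right (a := hl.ker) (conj_mem_conjSpan (Nat.zero_le _)
          (Nat.lt_succ_self n) hf)) (hle (hm w hv))
    · intro w hw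
      rcases mem_union.1 hw with hw | hw
      · have : (t ^ (n + 1))⁻¹ * w = t⁻¹ * ((t ^ n)⁻¹ * w) := by rw [pow_succ]; group
        rw [this]
        have h1 := hl.mul_le t⁻¹ ((t ^ n)⁻¹ * w)
        rw [hl.inv] at h1
        have h2 := hlen w hw
        rw [add_mul, one_mul]
        omega
      · obtain ⟨w, hv, rfl⟩ := mem_image.1 hw
        have : (t ^ (n + 1))⁻¹ * (F * w) = t⁻¹ * (f * ((t ^ n)⁻¹ * w)) := by
          rw [pow_succ, hF]; group
        rw [this]
        have h1 := hl.mul_le t⁻¹ (f * ((t ^ n)⁻¹ * w))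
        have h3 := hl.mul_le f ((t ^ n)⁻¹ * w)
        rw [hl.inv] at h1
        have h2 := hlen w hv
        rw [add_mul, one_mul]
        omega
    · intro w hw w' hw' h0
      rcases mem_union.1 hw with hw | hw <;> rcases mem_union.1 hw' with hw' | hw'
      · exact hsep w hw w' hw' h0
      · obtain ⟨w', hv', rfl⟩ := mem_image.1 hw'
        exact absurd h0 (hcross w hw w' hv')
      · obtain ⟨w, hv, rfl⟩ := mem_image.1 hw
        refine absurd ?_ (hcross w' hw' w hv)
        rw [← hl.inv, mul_inv_rev, inv_inv]
        exact h0
      · obtain ⟨w, hv, rfl⟩ := mem_image.1 hw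
        obtain ⟨w', hv', rfl⟩ := mem_image.1 hw'
        rw [hsep w hv w' hv' (by rw [← h0]; congr 1; group)]

theorem exists_poly_lt_two_pow (C d : ℕ) : ∃ n, 1 ≤ n ∧ C * n ^ d < 2 ^ n := by
  by_contra! h
  have := le_of_pow_le_poly_mul_pow (a := 2) (b := 1) (C := C) (d := d) zero_le_one
    (fun n hn => by
      rw [one_pow, mul_one]
      exact_mod_cast h n hn)
  norm_num at this

theorem LenGroup.exists_conj_mem (hG : LenGroup ℓ d) (t : Γ) {B : Set Γ} {r : ℕ}
    (hr : ∀ g ∈ B, ℓ g ≤ r) (hU : ∀ u, ℓ u = 0 → t * u * t⁻¹ ∈ B) :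
    ∃ M₀, ∀ M, M₀ ≤ M → ∀ f ∈ B, t ^ M * f * (t ^ M)⁻¹ ∈ conjSpan t B 0 M := by
  obtain ⟨C, hC⟩ := hG.growth
  obtain ⟨n, hn1, hn⟩ := exists_poly_lt_two_pow (C * (2 * ℓ t + r + 1) ^ d) d
  refine ⟨n, fun M hM f hf => ?_⟩
  have : ∃ j < n, t ^ j * f * (t ^ j)⁻¹ ∈ hG.ker ⊔ conjSpan t B 0 j := by
    by_contra! h
    obtain ⟨W, hc, -, hlen, hsep⟩ := hG.exists_separated t hf n h
    have := hC (n * (2 * ℓ t + r + 1)) (Nat.mul_pos hn1 (Nat.succ_pos _)) W (fun w hw => ?_) hsep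
    · rw [hc, mul_pow, mul_comm (n ^ d), ← mul_assoc] at this
      omega
    · have h1 := hG.mul_le (t ^ n) ((t ^ n)⁻¹ * w)
      rw [mul_inv_cancel_left] at h1
      refine h1.trans ((add_le_add (hG.pow_le t n) (hlen w hw)).trans ?_)
      rw [← mul_add]
      have := hr f hf
      exact Nat.mul_le_mul_left _ (by omega)
  obtain ⟨j, hj, hmem⟩ := this
  have h := conj_mem_of_mem_sup (s := M - j) (by omega) hU hmem
  have e : t ^ (M - j) * (t ^ j * f * (t ^ j)⁻¹) * (t ^ (M - j))⁻¹ = t ^ M * f * (t ^ M)⁻¹ := by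
    have : t ^ M = t ^ (M - j) * t ^ j := by rw [← pow_add, Nat.sub_add_cancel (by omega)]
    rw [this]; group
  rwa [e, Nat.sub_add_cancel (by omega)] at h

theorem conj_zpow_mem {t : Γ} {A : Subgroup Γ} (h1 : ∀ a ∈ A, t * a * t⁻¹ ∈ A)
    (h2 : ∀ a ∈ A, t⁻¹ * a * t ∈ A) (k : ℤ) {a : Γ} (ha : a ∈ A) : t ^ k * a * (t ^ k)⁻¹ ∈ A := by
  have ht : t ∈ Subgroup.normalizer (A : Set Γ) := by
    refine Subgroup.mem_normalizer_iff.2 fun h => ⟨h1 h, fun hh => ?_⟩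
    have := h2 _ hh
    rwa [show t⁻¹ * (t * h * t⁻¹) * t = h by group] at this
  exact (Subgroup.mem_normalizer_iff.1 (zpow_mem ht k) a).1 ha

theorem LenGroup.ker_int (hG : LenGroup ℓ d) (φ : Γ →* Multiplicative ℤ)
    (hφ : Function.Surjective φ) (hU : ∀ g, ℓ g = 0 → φ g = 1) :
    ∃ e, d = e + 1 ∧ LenGroup (fun g : φ.ker => ℓ g) e := by
  classical
  obtain ⟨t, ht⟩ := hφ (Multiplicative.ofAdd 1)
  have htk : ∀ k : ℤ, φ (t ^ k) = Multiplicative.ofAdd k := fun k => by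
    rw [map_zpow, ht, ← ofAdd_zsmul, smul_eq_mul, mul_one]
  obtain ⟨C, hC⟩ := hG.growth
  have key : ∀ n, 1 ≤ n → ∀ T : Finset φ.ker, (∀ t ∈ T, ℓ t ≤ n) →
      (∀ s ∈ T, ∀ t ∈ T, ℓ ((s : Γ)⁻¹ * t) = 0 → s = t) →
      n * T.card ≤ C * (ℓ t + 1) ^ d * n ^ d := by
    intro n hn T hT hsep
    have hsep' : ∀ p ∈ range n ×ˢ T, ∀ q ∈ range n ×ˢ T,
        ℓ ((t ^ p.1 * (p.2 : Γ))⁻¹ * (t ^ q.1 * (q.2 : Γ))) = 0 → p = q := by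
      rintro ⟨k, l⟩ hp ⟨k', l'⟩ hq h
      rw [mem_product] at hp hq
      have h1 := hU _ h
      have hl : φ l = 1 := l.2
      have hl' : φ l' = 1 := l'.2
      simp only [map_mul, map_inv, map_pow, hl, hl', mul_one] at h1
      rw [inv_mul_eq_one, ht, ← ofAdd_nsmul, ← ofAdd_nsmul] at h1
      have h2 : k = k' := by simpa using Multiplicative.ofAdd.injective h1
      subst h2
      have h3 : l = l' := hsep _ hp.2 _ hq.2 (by
        dsimp only at h
        rwa [mul_inv_rev, mul_assoc, inv_mul_cancel_left] at h)
      rw [h3]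
    have hinj : Set.InjOn (fun p : ℕ × φ.ker => t ^ p.1 * (p.2 : Γ)) (range n ×ˢ T : Finset _) := by
      intro p hp q hq h
      refine hsep' p hp q hq ?_
      dsimp only at h
      rw [h, inv_mul_cancel, hG.one]
    have := hC ((ℓ t + 1) * n) (Nat.mul_pos (Nat.succ_pos _) hn)
      ((range n ×ˢ T).image fun p => t ^ p.1 * (p.2 : Γ)) ?_ ?_
    · rwa [card_image_of_injOn hinj, card_product, card_range, mul_pow, ← mul_assoc] at this
    · intro x hx
      obtain ⟨p, hp, rfl⟩ := mem_image.1 hx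
      rw [mem_product, mem_range] at hp
      refine (hG.mul_le _ _).trans ?_
      have h1 := hG.pow_le t p.1
      have h2 := Nat.mul_le_mul_right (ℓ t) hp.1.le
      have h3 := hT _ hp.2
      rw [add_mul, one_mul, mul_comm (ℓ t)]
      omega
    · intro x hx y hy h
      obtain ⟨p, hp, rfl⟩ := mem_image.1 hx
      obtain ⟨q, hq, rfl⟩ := mem_image.1 hy
      rw [hsep' p hp q hq h]
  obtain ⟨e, rfl⟩ : ∃ e, d = e + 1 := by
    rcases d with _ | e
    · have := key (C + 1) (Nat.le_add_left _ _) {1} (by simp [hG.one]) (by simp)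
      simp at this
    · exact ⟨e, rfl⟩
  refine ⟨e, rfl, { toIsLength := hG.toIsLength.comp φ.ker.subtype, growth := ?_, gen := ?_ }⟩
  · refine ⟨C * (ℓ t + 1) ^ (e + 1), fun n hn T hT hsep => ?_⟩
    have := key n hn T hT hsep
    rw [pow_succ n, ← mul_assoc, mul_comm n] at this
    exact Nat.le_of_mul_le_mul_right this hn
  · obtain ⟨m, hm⟩ := hG.gen
    have hfin : (φ '' {g | ℓ g ≤ m}).Finite := by
      refine hG.finite_image_of_finite_image_ker φ ((Set.finite_singleton 1).subset ?_) m
      rintro _ ⟨g, hg, rfl⟩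
      exact hU g hg
    obtain ⟨b, hb⟩ := (hfin.image fun x => ℓ (t ^ (-x.toAdd))).bddAbove
    have hb' : ∀ g, ℓ g ≤ m → ℓ (t ^ (-(φ g).toAdd)) ≤ b := fun g hg =>
      hb ⟨_, ⟨g, hg, rfl⟩, rfl⟩
    set r := m + b + 2 * ℓ t with hr
    set B : Set Γ := {g | φ g = 1 ∧ ℓ g ≤ r} with hB
    have hconj : ∀ s u : Γ, ℓ s = ℓ t → ℓ u = 0 → s * u * s⁻¹ ∈ B := fun s u hs hu => by
      refine ⟨by rw [map_mul, map_mul, hU u hu, mul_one, map_inv, mul_inv_cancel], ?_⟩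
      have h1 := hG.mul_le (s * u) s⁻¹
      have h2 := hG.mul_le s u
      rw [hG.inv] at h1
      omega
    obtain ⟨M₁, hM₁⟩ := hG.exists_conj_mem t (B := B) (r := r) (fun g hg => hg.2)
      fun u hu => hconj t u rfl hu
    obtain ⟨M₂, hM₂⟩ := hG.exists_conj_mem t⁻¹ (B := B) (r := r) (fun g hg => hg.2)
      fun u hu => hconj t⁻¹ u (hG.inv t) hu
    set M := M₁ + M₂ + 1 with hM
    set A := conjSpan t B 0 M with hA
    have hup : ∀ a ∈ A, t * a * t⁻¹ ∈ A := by
      suffices h : A ≤ A.comap (MulAut.conj t).toMonoidHom from fun a ha => h ha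
      refine conjSpan_le fun k _ hk g hg => ?_
      change t * (t ^ k * g * (t ^ k)⁻¹) * t⁻¹ ∈ A
      rw [show t * (t ^ k * g * (t ^ k)⁻¹) * t⁻¹ = t ^ (k + 1) * g * (t ^ (k + 1))⁻¹ by
        rw [pow_succ']; group]
      rcases Nat.lt_or_ge (k + 1) M with h | h
      · exact conj_mem_conjSpan (Nat.zero_le _) h hg
      · rw [show k + 1 = M by omega]
        exact hM₁ M (by omega) g hg
    have hdown : ∀ a ∈ A, t⁻¹ * a * t ∈ A := by
      suffices h : A ≤ A.comap (MulAut.conj t⁻¹).toMonoidHom from fun a ha => by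
        have := h ha
        change t⁻¹ * a * t⁻¹⁻¹ ∈ A at this
        rwa [inv_inv] at this
      refine conjSpan_le fun k _ hk g hg => ?_
      change t⁻¹ * (t ^ k * g * (t ^ k)⁻¹) * t⁻¹⁻¹ ∈ A
      rcases k with _ | k
      · have h1 := hM₂ M (by omega) g hg
        have h2 : conjSpan t⁻¹ B 0 M ≤ A.comap (MulAut.conj (t ^ (M - 1))).toMonoidHom := by
          refine conjSpan_le fun j _ hj g hg => ?_
          change t ^ (M - 1) * (t⁻¹ ^ j * g * (t⁻¹ ^ j)⁻¹) * (t ^ (M - 1))⁻¹ ∈ A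
          have e : t ^ (M - 1) = t ^ (M - 1 - j) * t ^ j := by
            rw [← pow_add, Nat.sub_add_cancel (by omega)]
          rw [show t ^ (M - 1) * (t⁻¹ ^ j * g * (t⁻¹ ^ j)⁻¹) * (t ^ (M - 1))⁻¹ =
            t ^ (M - 1 - j) * g * (t ^ (M - 1 - j))⁻¹ by rw [e, inv_pow]; group]
          exact conj_mem_conjSpan (Nat.zero_le _) (by omega) hg
        have h3 := h2 h1
        change t ^ (M - 1) * (t⁻¹ ^ M * g * (t⁻¹ ^ M)⁻¹) * (t ^ (M - 1))⁻¹ ∈ A at h3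
        have e : t ^ M = t ^ (M - 1) * t := by rw [← pow_succ, Nat.sub_add_cancel (by omega)]
        rwa [show t ^ (M - 1) * (t⁻¹ ^ M * g * (t⁻¹ ^ M)⁻¹) * (t ^ (M - 1))⁻¹ =
          t⁻¹ * (t ^ 0 * g * (t ^ 0)⁻¹) * t⁻¹⁻¹ by rw [inv_pow, e, pow_zero]; group] at h3
      · rw [show t⁻¹ * (t ^ (k + 1) * g * (t ^ (k + 1))⁻¹) * t⁻¹⁻¹ = t ^ k * g * (t ^ k)⁻¹ by
          rw [pow_succ']; group]
        exact conj_mem_conjSpan (Nat.zero_le _) (by omega) hg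
    let P : Subgroup Γ :=
      { carrier := {g | g * t ^ (-(φ g).toAdd) ∈ A}
        one_mem' := by simp [one_mem]
        mul_mem' := fun {g h} hg hh => by
          have := mul_mem hg (conj_zpow_mem hup hdown (φ g).toAdd hh)
          change g * h * t ^ (-(φ (g * h)).toAdd) ∈ A
          convert this using 1
          rw [map_mul, toAdd_mul]
          group
        inv_mem' := fun {g} hg => by
          have := inv_mem (conj_zpow_mem hup hdown (-(φ g).toAdd) hg)
          change g⁻¹ * t ^ (-(φ g⁻¹).toAdd) ∈ A
          convert this using 1
          rw [map_inv, toAdd_inv]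
          group }
    have hP : P = ⊤ := by
      refine eq_top_iff.2 (hm ▸ (Subgroup.closure_le _).2 fun g hg => ?_)
      change g * t ^ (-(φ g).toAdd) ∈ A
      have hmem : g * t ^ (-(φ g).toAdd) ∈ B := by
        refine ⟨?_, ?_⟩
        · rw [map_mul, htk, ofAdd_neg, ofAdd_toAdd, mul_inv_cancel]
        · have h1 := hG.mul_le g (t ^ (-(φ g).toAdd))
          have h2 := hb' g hg
          have h3 : ℓ g ≤ m := hg
          omega
      have := conj_mem_conjSpan (t := t) (Nat.le_refl 0) (show 0 < M by omega) hmem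
      simpa using this
    have hA' : A ≤ (Subgroup.closure {g : φ.ker | ℓ g ≤ r + 2 * (M * ℓ t)}).map φ.ker.subtype := by
      refine conjSpan_le fun k _ hk g hg => ?_
      have hmem : t ^ k * g * (t ^ k)⁻¹ ∈ φ.ker := by
        rw [MonoidHom.mem_ker, map_mul, map_mul, hg.1, mul_one, map_inv, mul_inv_cancel]
      refine ⟨⟨_, hmem⟩, Subgroup.subset_closure ?_, rfl⟩
      change ℓ (t ^ k * g * (t ^ k)⁻¹) ≤ _
      have h1 := hG.mul_le (t ^ k * g) (t ^ k)⁻¹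
      have h2 := hG.mul_le (t ^ k) g
      have h3 := hG.pow_le t k
      have h4 := Nat.mul_le_mul_right (ℓ t) hk.le
      have h5 := hg.2
      rw [hG.inv] at h1
      omega
    refine ⟨r + 2 * (M * ℓ t), eq_top_iff.2 fun g _ => ?_⟩
    have hg : (g : Γ) ∈ P := hP ▸ Subgroup.mem_top _
    have hg1 : φ g = 1 := g.2
    change (g : Γ) * t ^ (-(φ g).toAdd) ∈ A at hg
    rw [hg1, toAdd_one, neg_zero, zpow_zero, mul_one] at hg
    obtain ⟨g', hg', h⟩ := hA' hg
    rwa [← Subtype.ext h]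

section IntegerEndomorphisms

open Polynomial

theorem norm_lt_two_of_aeval_eq_zero {q : ℤ[X]} (hq : q ≠ 0) (hc : ∀ i, |q.coeff i| ≤ 1) {z : ℂ}
    (hz : aeval z q = 0) : ‖z‖ < 2 := by
  have hinj : Function.Injective (algebraMap ℤ ℂ) := Int.cast_injective
  have hq' : q.map (algebraMap ℤ ℂ) ≠ 0 := (Polynomial.map_ne_zero_iff hinj).2 hq
  have hroot : (q.map (algebraMap ℤ ℂ)).IsRoot z := by
    rw [IsRoot, eval_map_algebraMap, hz]
  have h := hroot.norm_lt_cauchyBound hq'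
  have hlead : ‖(q.map (algebraMap ℤ ℂ)).leadingCoeff‖₊ = 1 := by
    rw [leadingCoeff_map_of_injective hinj]
    have h1 : |q.leadingCoeff| = 1 :=
      le_antisymm (hc _) (Int.one_le_abs (leadingCoeff_ne_zero.2 hq))
    rw [← NNReal.coe_inj]
    change ‖((q.leadingCoeff : ℤ) : ℂ)‖ = 1
    rw [Complex.norm_intCast]
    exact_mod_cast h1
  have hb : (q.map (algebraMap ℤ ℂ)).cauchyBound ≤ 2 := by
    rw [cauchyBound, hlead, div_one, ← one_add_one_eq_two]
    refine add_le_add (Finset.sup_le fun i _ => ?_) le_rfl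
    rw [coeff_map, ← NNReal.coe_le_coe]
    change ‖((q.coeff i : ℤ) : ℂ)‖ ≤ 1
    rw [Complex.norm_intCast]
    exact_mod_cast hc i
  exact_mod_cast h.trans_le hb

variable {M : Type*} [AddCommGroup M]

theorem exists_prod_aeval_eq_zero [Module.Finite ℤ M] (f : Module.End ℤ M) (P : ℤ[X] → Prop)
    (h : ∀ z, ∃ q, P q ∧ aeval f q z = 0) :
    ∃ s : Finset ℤ[X], (∀ q ∈ s, P q) ∧ aeval f (∏ q ∈ s, q) = 0 := by
  classical
  obtain ⟨S, hS⟩ := Module.Finite.fg_top (R := ℤ) (M := M)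
  choose q hq hqz using h
  refine ⟨S.image q, ?_, ?_⟩
  · intro p hp
    obtain ⟨z, -, rfl⟩ := mem_image.1 hp
    exact hq z
  · rw [← LinearMap.ker_eq_top, eq_top_iff, ← hS, Submodule.span_le]
    intro z hz
    change aeval f _ z = 0
    obtain ⟨p, hp⟩ := dvd_prod_of_mem (fun q => q) (mem_image_of_mem q hz)
    rw [hp, mul_comm, map_mul, Module.End.mul_apply, hqz, map_zero]

theorem aeval_eq_zero_of_isRoot_charpoly [Module.Finite ℤ M] [Module.Free ℤ M]
    (f : Module.End ℤ M) {P : ℤ[X]} (hP : aeval f P = 0) {z : ℂ}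
    (hz : (f.charpoly.map (algebraMap ℤ ℂ)).IsRoot z) : aeval z P = 0 := by
  rw [← LinearMap.charpoly_baseChange, ← Module.End.hasEigenvalue_iff_isRoot_charpoly] at hz
  obtain ⟨v, hv⟩ := hz.exists_hasEigenvector
  have h1 := Module.End.aeval_apply_of_hasEigenvector (p := P.map (algebraMap ℤ ℂ)) hv
  have h2 : aeval (LinearMap.baseChange ℂ f) P = 0 := by
    have := aeval_algHom_apply (Module.End.baseChangeHom ℤ ℂ M) f P
    rw [hP, map_zero] at this
    exact this
  rw [aeval_map_algebraMap, h2, LinearMap.zero_apply, eval_map_algebraMap] at h1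
  exact (smul_eq_zero.1 h1.symm).resolve_right hv.2

theorem exists_pow_sub_one_pow_eq_zero_of_free [Module.Finite ℤ M] [Module.Free ℤ M]
    (f : Module.End ℤ M) (hf : Function.Injective f)
    (h : ∀ p, 1 ≤ p → ∀ z, ∃ q : ℤ[X], (q ≠ 0 ∧ ∀ i, |q.coeff i| ≤ 1) ∧ aeval (f ^ p) q z = 0) :
    ∃ k r, 1 ≤ k ∧ (f ^ k - 1) ^ r = 0 := by
  classical
  set χ := f.charpoly with hχ
  set χC := χ.map (algebraMap ℤ ℂ) with hχC
  have hmonic : χ.Monic := f.charpoly_monic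
  have hmonicC : χC.Monic := hmonic.map _
  have hnorm : ∀ z ∈ χC.roots, ‖z‖ ≤ 1 := by
    intro z hz
    have hz := isRoot_of_mem_roots hz
    have hlt : ∀ p, 1 ≤ p → ‖z‖ ^ p < 2 := by
      intro p hp
      obtain ⟨s, hs, hs0⟩ := exists_prod_aeval_eq_zero (f ^ p) _ (h p hp)
      have hex : aeval f (expand ℤ p (∏ q ∈ s, q)) = 0 := by rw [expand_aeval, hs0]
      have := aeval_eq_zero_of_isRoot_charpoly f hex hz
      rw [expand_aeval, map_prod, prod_eq_zero_iff] at this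
      obtain ⟨q, hq, hq0⟩ := this
      rw [← norm_pow]
      exact norm_lt_two_of_aeval_eq_zero (hs q hq).1 (hs q hq).2 hq0
    refine le_of_pow_le_poly_mul_pow (C := 2) (d := 0) zero_le_one fun n hn => ?_
    have := hlt n hn
    simp only [pow_zero, mul_one, one_pow]
    exact this.le
  have hmahler : (χ.map (Int.castRingHom ℂ)).mahlerMeasure = 1 := by
    change χC.mahlerMeasure = 1
    rw [mahlerMeasure_eq_leadingCoeff_mul_prod_roots, hmonicC.leadingCoeff, norm_one, one_mul]
    refine Multiset.prod_eq_one fun x hx => ?_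
    obtain ⟨z, hz, rfl⟩ := Multiset.mem_map.1 hx
    exact max_eq_left (hnorm z hz)
  have hroots : ∀ z ∈ χC.roots, ∃ n, 0 < n ∧ z ^ n = 1 := by
    intro z hz
    refine pow_eq_one_of_mahlerMeasure_eq_one hmahler ?_ hz
    rintro rfl
    have h0 : χ.IsRoot 0 := by
      have := isRoot_of_mem_roots hz
      rw [IsRoot, hχC, eval_map_algebraMap, aeval_def, eval₂_at_zero] at this
      rw [IsRoot, ← coeff_zero_eq_eval_zero]
      exact (Int.cast_injective : Function.Injective (Int.cast : ℤ → ℂ))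
        (this.trans Int.cast_zero.symm)
    rw [hχ, ← Module.End.hasEigenvalue_iff_isRoot_charpoly] at h0
    obtain ⟨v, hv⟩ := h0.exists_hasEigenvector
    refine hv.2 (hf ?_)
    rw [hv.apply_eq_smul, zero_smul, map_zero]
  choose! n hn hn1 using hroots
  set k := ∏ z ∈ χC.roots.toFinset, n z with hk
  have hk1 : 1 ≤ k := Finset.prod_pos fun z hz => hn z (Multiset.mem_toFinset.1 hz)
  have hzk : ∀ z ∈ χC.roots, z ^ k = 1 := by
    intro z hz
    obtain ⟨c, hc⟩ := dvd_prod_of_mem n (Multiset.mem_toFinset.2 hz)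
    rw [hk, hc, pow_mul, hn1 z hz, one_pow]
  have hdvd : χ ∣ (X ^ k - 1) ^ (Multiset.card χC.roots) := by
    rw [← map_dvd_map (algebraMap ℤ ℂ) Int.cast_injective hmonic, Polynomial.map_pow,
      Polynomial.map_sub, Polynomial.map_pow, map_X, Polynomial.map_one]
    change χC ∣ _
    rw [(IsAlgClosed.splits χC).eq_prod_roots, hmonicC.leadingCoeff, C_1, one_mul]
    have := Multiset.prod_dvd_prod_of_dvd (S := χC.roots) (fun z => X - C z)
      (fun _ => (X ^ k - 1 : ℂ[X])) (fun z hz => by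
        rw [dvd_iff_isRoot, IsRoot, eval_sub, eval_pow, eval_X, eval_one, hzk z hz, sub_self])
    rw [Multiset.map_const', Multiset.prod_replicate] at this
    rw [← (IsAlgClosed.splits χC).eq_prod_roots_of_monic hmonicC]
    rwa [← (IsAlgClosed.splits χC).eq_prod_roots_of_monic hmonicC] at this
  refine ⟨k, Multiset.card χC.roots, hk1, ?_⟩
  obtain ⟨c, hc⟩ := hdvd
  have := congrArg (aeval f) hc
  rw [map_mul, hχ, f.aeval_self_charpoly, zero_mul] at this
  simpa using this

theorem exists_pow_apply_eq_of_finite {X : Type*} [Finite X] {f : X → X}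
    (hf : Function.Injective f) : ∃ k, 1 ≤ k ∧ ∀ x, f^[k] x = x := by
  let e : Equiv.Perm X := Equiv.ofBijective f (Finite.injective_iff_bijective.1 hf)
  refine ⟨orderOf e, orderOf_pos e, fun x => ?_⟩
  have h := congrArg (fun g : Equiv.Perm X => g x) (pow_orderOf_eq_one e)
  rw [← Equiv.Perm.iterate_eq_pow] at h
  exact h

theorem exists_pow_sub_one_pow_eq_zero [Module.Finite ℤ M]
    (f : Module.End ℤ M) (hf : Function.Injective f)
    (h : ∀ p, 1 ≤ p → ∀ z, ∃ q : ℤ[X], (q ≠ 0 ∧ ∀ i, |q.coeff i| ≤ 1) ∧ aeval (f ^ p) q z = 0) :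
    ∃ k r, 1 ≤ k ∧ (f ^ k - 1) ^ r = 0 := by
  set T := Submodule.torsion ℤ M with hT
  have hTf : T ≤ T.comap f := by
    rintro x ⟨a, ha⟩
    refine ⟨a, ?_⟩
    rw [Submonoid.smul_def] at ha ⊢
    rw [← map_smul, ha, map_zero]
  have hinj : Function.Injective (T.mapQ T f hTf) := by
    rw [← LinearMap.ker_eq_bot, LinearMap.ker_eq_bot']
    intro x hx
    obtain ⟨x, rfl⟩ := T.mkQ_surjective x
    rw [Submodule.mkQ_apply, Submodule.mapQ_apply, Submodule.Quotient.mk_eq_zero] at hx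
    rw [Submodule.mkQ_apply, Submodule.Quotient.mk_eq_zero]
    obtain ⟨a, ha⟩ := hx
    refine ⟨a, hf ?_⟩
    rw [Submonoid.smul_def] at ha ⊢
    rw [map_smul, ha, map_zero]
  have hmap : ∀ q : ℤ[X], ∀ z, aeval (T.mapQ T f hTf) q (T.mkQ z) = T.mkQ (aeval f q z) := by
    intro q z
    induction q using Polynomial.induction_on' with
    | add p q hp hq => simp only [map_add, LinearMap.add_apply, hp, hq]
    | monomial n a =>
      have : ∀ n, ((T.mapQ T f hTf) ^ n) (T.mkQ z) = T.mkQ ((f ^ n) z) := by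
        intro n
        induction n with
        | zero => rfl
        | succ n ih => rw [pow_succ', pow_succ', Module.End.mul_apply, ih]; rfl
      rw [aeval_monomial, aeval_monomial, Module.End.mul_apply, Module.End.mul_apply, this,
        Module.algebraMap_end_apply, Module.algebraMap_end_apply, map_smul]
  have hfree : Module.Free ℤ (M ⧸ T) := Module.free_of_finite_type_torsion_free'
  obtain ⟨k, r, hk, hr⟩ := exists_pow_sub_one_pow_eq_zero_of_free (T.mapQ T f hTf) hinj (by
    intro p hp z
    obtain ⟨z, rfl⟩ := T.mkQ_surjective z
    obtain ⟨q, hq, hqz⟩ := h p hp z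
    refine ⟨q, hq, ?_⟩
    rw [← expand_aeval] at hqz ⊢
    rw [hmap, hqz, map_zero])
  have hTfin : Finite T := Module.finite_of_fg_torsion T Submodule.torsion_isTorsion
  obtain ⟨k', hk', hid⟩ := exists_pow_apply_eq_of_finite (X := T) (f := f.restrict hTf)
    fun x y hxy => Subtype.ext (hf (congrArg Subtype.val hxy))
  have hid' : ∀ x ∈ T, (f ^ (k * k')) x = x := by
    intro x hx
    have : ∀ m, (f ^ (m * k')) x = x := by
      intro m
      induction m with
      | zero => rw [zero_mul]; rfl
      | succ m ih =>
        have h1 := congrArg Subtype.val (hid ⟨x, hx⟩)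
        have h2 : ∀ n, (((f.restrict hTf)^[n] ⟨x, hx⟩ : T) : M) = (f ^ n) x := by
          intro n
          induction n with
          | zero => rfl
          | succ n ih =>
            rw [Function.iterate_succ_apply', pow_succ', Module.End.mul_apply, ← ih]; rfl
        rw [h2] at h1
        rw [add_mul, one_mul, pow_add, Module.End.mul_apply]
        change (f ^ (m * k')) ((f ^ k') x) = x
        rw [h1]
        exact ih
    exact this k
  have hpoly : ((X ^ (k * k') - 1 : ℤ[X])) = (X ^ k - 1) * ∑ i ∈ range k', (X ^ k) ^ i := by
    rw [mul_comm (X ^ k - 1), geom_sum_mul, ← pow_mul]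
  refine ⟨k * k', r + 1, Nat.mul_pos hk hk', ?_⟩
  ext z
  have hz : ((f ^ (k * k') - 1) ^ r) z ∈ T := by
    have e : (f ^ (k * k') - 1) ^ r = aeval f ((X ^ (k * k') - 1 : ℤ[X]) ^ r) := by simp
    rw [e, ← Submodule.Quotient.mk_eq_zero, ← Submodule.mkQ_apply, ← hmap, hpoly, mul_pow,
      mul_comm, map_mul, Module.End.mul_apply]
    have e2 : aeval (T.mapQ T f hTf) ((X ^ k - 1 : ℤ[X]) ^ r) = 0 := by
      rw [← hr]; simp
    rw [e2, LinearMap.zero_apply, map_zero]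
  rw [pow_succ', Module.End.mul_apply]
  change (f ^ (k * k')) _ - _ = 0
  rw [hid' _ hz]
  exact sub_self _

end IntegerEndomorphisms

section ConjEnd

open Polynomial
open scoped Pointwise IsMulCommutative

variable {G : Type*} [Group G] (Z : Subgroup G) [Z.Normal] [IsMulCommutative Z]

/-- The action of a group by conjugation on a normal abelian subgroup. -/
def conjEnd : G →* Module.End ℤ (Additive Z) where
  toFun s := (MonoidHom.toAdditive (MulAut.conjNormal (H := Z) s).toMonoidHom).toIntLinearMap
  map_one' := by
    refine LinearMap.ext fun z => ?_
    change (MulAut.conjNormal (H := Z) 1 z.toMul : Z) = z.toMul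
    rw [map_one]; rfl
  map_mul' s t := by
    refine LinearMap.ext fun z => ?_
    change (MulAut.conjNormal (H := Z) (s * t) z.toMul : Z) = _
    rw [map_mul]; rfl

theorem coe_conjEnd (s : G) (z : Additive Z) :
    (((conjEnd Z s z).toMul : Z) : G) = s * (z.toMul : Z) * s⁻¹ := rfl

theorem conjEnd_injective (s : G) : Function.Injective (conjEnd Z s) :=
  (MulAut.conjNormal (H := Z) s).injective

theorem exists_aeval_conjEnd_eq_zero {d : ℕ} (hd : GrowthLE G d) (s : G) (z : Additive Z) :
    ∃ q : ℤ[X], (q ≠ 0 ∧ ∀ i, |q.coeff i| ≤ 1) ∧ aeval (conjEnd Z s) q z = 0 := by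
  classical
  let S : Set G := {1, ((z.toMul : Z) : G), s⁻¹}
  have hSfin : S.Finite := by simp [S]
  obtain ⟨C, hC⟩ := hd S hSfin
  obtain ⟨n, hn1, hn⟩ := exists_poly_lt_two_pow (C * 2 ^ d) d
  let Q : Finset ℕ → ℕ → ℤ[X] := fun E n => ∑ i ∈ range n, if i ∈ E then X ^ i else 0
  have hcoeff : ∀ E n i, (Q E n).coeff i = if i < n ∧ i ∈ E then 1 else 0 := by
    intro E n i
    simp only [Q, finsetSum_coeff]
    have : ∀ j ∈ range n, (if j ∈ E then (X ^ j : ℤ[X]) else 0).coeff i =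
        if j = i then (if i ∈ E then 1 else 0) else 0 := by
      intro j _
      by_cases hji : j = i
      · subst hji; by_cases hj : j ∈ E <;> simp [hj]
      · by_cases hj : j ∈ E <;> simp [hj, hji, coeff_X_pow, Ne.symm hji]
    rw [sum_congr rfl this, sum_ite_eq' (range n) i]
    by_cases h1 : i < n <;> by_cases h2 : i ∈ E <;> simp [h1, h2]
  let v : Finset ℕ → ℕ → Additive Z := fun E n => aeval (conjEnd Z s) (Q E n) z
  have hv : ∀ E n, (s ^ n)⁻¹ * (((v E n).toMul : Z) : G) ∈ S ^ (2 * n) := by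
    intro E n
    induction n with
    | zero => simp [v, Q]
    | succ n ih =>
      obtain ⟨y, hy, hyv⟩ : ∃ y ∈ S, (((v E (n + 1)).toMul : Z) : G) =
          s ^ n * y * (s ^ n)⁻¹ * (((v E n).toMul : Z) : G) := by
        by_cases hE : n ∈ E
        · refine ⟨((z.toMul : Z) : G), by simp [S], ?_⟩
          have : v E (n + 1) = conjEnd Z (s ^ n) z + v E n := by
            simp only [v, Q, sum_range_succ, if_pos hE, map_add, map_pow, aeval_X,
              LinearMap.add_apply]
            exact add_comm _ _
          rw [this, toMul_add, Subgroup.coe_mul, coe_conjEnd]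
        · refine ⟨1, by simp [S], ?_⟩
          have : v E (n + 1) = v E n := by
            simp only [v, Q, sum_range_succ, if_neg hE, add_zero]
          rw [this]; group
      have e : (s ^ (n + 1))⁻¹ * (((v E (n + 1)).toMul : Z) : G) =
          (s⁻¹ * y) * ((s ^ n)⁻¹ * (((v E n).toMul : Z) : G)) := by
        rw [hyv, pow_succ]; group
      rw [e, show 2 * (n + 1) = 2 + 2 * n by ring, pow_add, pow_two]
      exact Set.mul_mem_mul (Set.mul_mem_mul (by simp [S]) hy) ih
  obtain ⟨E, hE, E', hE', hne, heq⟩ : ∃ E ∈ (range n).powerset, ∃ E' ∈ (range n).powerset,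
      E ≠ E' ∧ v E n = v E' n := by
    by_contra! h
    have hinj : Set.InjOn (fun E => (s ^ n)⁻¹ * (((v E n).toMul : Z) : G))
        ((range n).powerset : Finset (Finset ℕ)) := by
      intro E hE E' hE' hEE
      by_contra hne
      refine h E hE E' hE' hne ?_
      exact Additive.toMul.injective (Subtype.ext (mul_left_cancel hEE))
    have h1 := hC (2 * n) (by omega)
    have h2 : (((range n).powerset.image fun E => (s ^ n)⁻¹ * (((v E n).toMul : Z) : G) :
        Finset G) : Set G).ncard ≤ (S ^ (2 * n)).ncard := by
      refine Set.ncard_le_ncard ?_ (finite_pow hSfin _)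
      intro x hx
      obtain ⟨E, -, rfl⟩ := mem_image.1 (mem_coe.1 hx)
      exact hv E n
    rw [Set.ncard_coe_finset, card_image_of_injOn hinj, card_powerset, card_range] at h2
    rw [mul_pow, ← mul_assoc] at h1
    omega
  refine ⟨Q E n - Q E' n, ⟨fun h0 => hne ?_, fun i => ?_⟩, ?_⟩
  · ext i
    have h1 := congrArg (fun q => coeff q i) h0
    simp only [coeff_sub, hcoeff, coeff_zero] at h1
    have h2 : i ∈ E → i < n := fun hi => mem_range.1 (mem_powerset.1 hE hi)
    have h3 : i ∈ E' → i < n := fun hi => mem_range.1 (mem_powerset.1 hE' hi)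
    by_cases hi : i ∈ E <;> by_cases hi' : i ∈ E' <;> simp_all
  · rw [coeff_sub, hcoeff, hcoeff]
    split_ifs <;> simp
  · rw [map_sub, LinearMap.sub_apply]
    exact sub_eq_zero.2 heq

theorem exists_conjEnd_unipotent [Module.Finite ℤ (Additive Z)] {d : ℕ} (hd : GrowthLE G d)
    (s : G) : ∃ k r, 1 ≤ k ∧ (conjEnd Z (s ^ k) - 1) ^ r = 0 := by
  obtain ⟨k, r, hk, h⟩ := exists_pow_sub_one_pow_eq_zero (conjEnd Z s) (conjEnd_injective Z s)
    fun p _ z => by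
      rw [← map_pow]
      exact exists_aeval_conjEnd_eq_zero Z hd (s ^ p) z
  exact ⟨k, r, hk, by rw [map_pow]; exact h⟩

/-- The elements of `Z` killed by the `j`-th power of `u - 1`. -/
def unipKer (u : Module.End ℤ (Additive Z)) (j : ℕ) : Subgroup G :=
  (AddSubgroup.toSubgroup' (LinearMap.ker ((u - 1) ^ j)).toAddSubgroup).map Z.subtype

omit [Z.Normal] in
theorem mem_unipKer {u : Module.End ℤ (Additive Z)} {j : ℕ} {x : G} :
    x ∈ unipKer Z u j ↔ ∃ z : Additive Z, ((u - 1) ^ j) z = 0 ∧ ((z.toMul : Z) : G) = x := Iff.rfl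

theorem commutator_unipKer_le {E : Subgroup G} {s : G} {N : Subgroup G}
    (hZN : ∀ z ∈ Z, ∀ n ∈ N, n * z * n⁻¹ = z) (hE : E = N ⊔ Subgroup.zpowers s) (j : ℕ) :
    ⁅unipKer Z (conjEnd Z s) (j + 1), E⁆ ≤ unipKer Z (conjEnd Z s) j := by
  set u := conjEnd Z s with hu
  let Y : Subgroup G :=
    { carrier := {y | Commute (conjEnd Z y) u ∧ ∃ w, Commute w u ∧ conjEnd Z y - 1 = (u - 1) * w}
      one_mem' := ⟨by rw [map_one]; exact Commute.one_left _, 0, Commute.zero_left _, by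
        rw [map_one, sub_self, mul_zero]⟩
      mul_mem' := by
        rintro a b ⟨ha, wa, hwa, ha'⟩ ⟨hb, wb, hwb, hb'⟩
        refine ⟨by rw [map_mul]; exact ha.mul_left hb, conjEnd Z a * wb + wa,
          (ha.mul_left hwb).add_left hwa, ?_⟩
        have h1 : Commute (conjEnd Z a) (u - 1) := ha.sub_right (Commute.one_right _)
        rw [map_mul, mul_add, ← ha', ← mul_assoc, ← h1.eq, mul_assoc, ← hb']
        noncomm_ring
      inv_mem' := by
        rintro a ⟨ha, w, hw, ha'⟩
        have hc : Commute (conjEnd Z a⁻¹) u := by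
          have e1 : conjEnd Z a⁻¹ * conjEnd Z a = 1 := by rw [← map_mul, inv_mul_cancel, map_one]
          have e2 : conjEnd Z a * conjEnd Z a⁻¹ = 1 := by rw [← map_mul, mul_inv_cancel, map_one]
          calc conjEnd Z a⁻¹ * u = conjEnd Z a⁻¹ * (u * conjEnd Z a) * conjEnd Z a⁻¹ := by
                rw [mul_assoc, mul_assoc, e2, mul_one]
            _ = u * conjEnd Z a⁻¹ := by rw [← ha.eq, ← mul_assoc, e1, one_mul]
        refine ⟨hc, -(conjEnd Z a⁻¹ * w), (hc.mul_left hw).neg_left, ?_⟩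
        have h1 : Commute (conjEnd Z a⁻¹) (u - 1) := hc.sub_right (Commute.one_right _)
        rw [mul_neg, ← mul_assoc, ← h1.eq, mul_assoc, ← ha', mul_sub, ← map_mul, inv_mul_cancel,
          map_one]
        noncomm_ring }
  have hEY : E ≤ Y := by
    rw [hE]
    refine sup_le (fun n hn => ?_) (Subgroup.zpowers_le_of_mem ?_)
    · have : conjEnd Z n = 1 := by
        refine LinearMap.ext fun z => ?_
        exact Subtype.ext (hZN _ z.toMul.2 n hn)
      exact ⟨by rw [this]; exact Commute.one_left _, 0, Commute.zero_left _, by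
        rw [this, sub_self, mul_zero]⟩
    · exact ⟨Commute.refl _, 1, Commute.one_left _, by rw [mul_one]⟩
  rw [Subgroup.commutator_le]
  rintro _ ⟨z, hz, rfl⟩ y hy
  obtain ⟨-, w, hw, hyw⟩ := hEY hy
  let z' : Additive Z := Additive.ofMul z
  have hz' : ((u - 1) ^ (j + 1)) z' = 0 := hz
  refine (mem_unipKer Z).2 ⟨z' - conjEnd Z y z', ?_, ?_⟩
  · have e1 : z' - conjEnd Z y z' = -((u - 1) * w) z' := by
      rw [← hyw, LinearMap.sub_apply, neg_sub]; rfl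
    have hw' : Commute w ((u - 1) ^ (j + 1)) := (hw.sub_right (Commute.one_right _)).pow_right _
    rw [e1, map_neg, ← Module.End.mul_apply, ← mul_assoc, ← pow_succ, ← hw'.eq,
      Module.End.mul_apply, hz', map_zero, neg_zero]
  · rw [sub_eq_add_neg, toMul_add, toMul_neg, Subgroup.coe_mul, Subgroup.coe_inv, coe_conjEnd,
      commutatorElement_def]
    change (z : G) * (y * z * y⁻¹)⁻¹ = z * y * (z : G)⁻¹ * y⁻¹
    group

end ConjEnd

section NoetherianGroups

variable {G Q : Type*} [Group G] [Group Q]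

theorem wellFoundedGT_subgroup_of_surjective [WellFoundedGT (Subgroup G)] (f : G →* Q)
    (hf : Function.Surjective f) : WellFoundedGT (Subgroup Q) :=
  StrictMono.wellFoundedGT (f := Subgroup.comap f) fun _ _ h =>
    (Subgroup.comap_lt_comap_of_surjective hf).2 h

theorem wellFoundedGT_subgroup_of_injective [WellFoundedGT (Subgroup Q)] (f : G →* Q)
    (hf : Function.Injective f) : WellFoundedGT (Subgroup G) :=
  StrictMono.wellFoundedGT (f := Subgroup.map f) fun _ _ h =>
    (Subgroup.map_lt_map_iff_of_injective hf).2 h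

theorem wellFoundedGT_subgroup_of_ker (f : G →* Q) [WellFoundedGT (Subgroup f.ker)]
    [WellFoundedGT (Subgroup Q)] : WellFoundedGT (Subgroup G) := by
  refine StrictMono.wellFoundedGT (β := Subgroup f.ker × Subgroup Q)
    (f := fun H => (H.subgroupOf f.ker, H.map f)) fun A B h => ?_
  have hle : (A.subgroupOf f.ker, A.map f) ≤ (B.subgroupOf f.ker, B.map f) :=
    ⟨Subgroup.comap_mono h.le, Subgroup.map_mono h.le⟩
  refine lt_of_le_of_ne hle fun he => h.not_ge fun b hb => ?_
  obtain ⟨h1, h2⟩ := Prod.mk.inj he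
  have hb' : f b ∈ A.map f := by rw [h2]; exact Subgroup.mem_map_of_mem f hb
  obtain ⟨a, ha, hab⟩ := hb'
  have hk : a⁻¹ * b ∈ f.ker := by rw [MonoidHom.mem_ker, map_mul, map_inv, hab, inv_mul_cancel]
  have hB : (⟨a⁻¹ * b, hk⟩ : f.ker) ∈ B.subgroupOf f.ker :=
    Subgroup.mem_subgroupOf.2 (B.mul_mem (B.inv_mem (h.le ha)) hb)
  rw [← h1, Subgroup.mem_subgroupOf] at hB
  have := A.mul_mem ha hB
  rwa [mul_inv_cancel_left] at this

theorem wellFoundedGT_subgroup_of_finiteIndex (K : Subgroup G) [K.FiniteIndex]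
    [WellFoundedGT (Subgroup K)] : WellFoundedGT (Subgroup G) := by
  let f := QuotientGroup.mk' K.normalCore
  have hker : f.ker = K.normalCore := QuotientGroup.ker_mk' _
  have : WellFoundedGT (Subgroup f.ker) :=
    wellFoundedGT_subgroup_of_injective
      (Subgroup.inclusion (hker.le.trans K.normalCore_le)) (Subgroup.inclusion_injective _)
  exact wellFoundedGT_subgroup_of_ker f

instance wellFoundedGT_subgroup_int : WellFoundedGT (Subgroup (Multiplicative ℤ)) :=
  StrictMono.wellFoundedGT (β := Submodule ℤ ℤ)
    (f := fun H => AddSubgroup.toIntSubmodule (Subgroup.toAddSubgroup' H))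
    (AddSubgroup.toIntSubmodule.strictMono.comp Subgroup.toAddSubgroup'.strictMono)

theorem fg_of_wellFoundedGT_subgroup [hG : WellFoundedGT (Subgroup G)] : Group.FG G := by
  obtain ⟨m, hm, hmax⟩ := hG.wf.has_min {K : Subgroup G | K.FG} ⟨⊥, Subgroup.FG.bot⟩
  have : m = ⊤ := by
    refine eq_top_iff.2 fun g _ => ?_
    have h1 : (m ⊔ Subgroup.zpowers g).FG := by
      refine Subgroup.FG.sup hm ⟨{g}, by rw [coe_singleton, Subgroup.zpowers_eq_closure]⟩
    have h2 := hmax _ h1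
    have h3 : m ⊔ Subgroup.zpowers g = m :=
      ((eq_or_lt_of_le (le_sup_left : m ≤ m ⊔ Subgroup.zpowers g)).resolve_right h2).symm
    rw [← h3]
    exact le_sup_right (a := m) (Subgroup.mem_zpowers g)
  exact ⟨this ▸ hm⟩

open scoped IsMulCommutative in
theorem finite_additive_of_wellFoundedGT [WellFoundedGT (Subgroup G)] (Z : Subgroup G)
    [IsMulCommutative Z] : Module.Finite ℤ (Additive Z) := by
  have h1 : WellFoundedGT (Subgroup Z) :=
    wellFoundedGT_subgroup_of_injective Z.subtype Z.subtype_injective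
  have h2 : WellFoundedGT (Submodule ℤ (Additive Z)) :=
    StrictMono.wellFoundedGT (β := Subgroup Z)
      (f := fun p => AddSubgroup.toSubgroup' (AddSubgroup.toIntSubmodule.symm p))
      (AddSubgroup.toSubgroup'.strictMono.comp AddSubgroup.toIntSubmodule.symm.strictMono)
  have : IsNoetherian ℤ (Additive Z) := isNoetherian_iff'.2 h2
  infer_instance

theorem finite_monoidHom_of_fg [Group.FG G] [Finite Q] : Finite (G →* Q) := by
  obtain ⟨S, hS⟩ := (Group.fg_def.1 ‹Group.FG G›)
  refine Finite.of_injective (β := S → Q) (fun f x => f x) fun f g hfg => ?_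
  refine MonoidHom.eq_of_eqOn_dense hS fun x hx => ?_
  exact congrFun hfg ⟨x, hx⟩

end NoetherianGroups

section MilnorWolf

open scoped Pointwise

universe u

theorem GrowthLE.of_surjective {G Q : Type*} [Group G] [Group Q] {d : ℕ} (h : GrowthLE G d)
    (f : G →* Q) (hf : Function.Surjective f) : GrowthLE Q d := by
  intro S hS
  obtain ⟨C, hC⟩ := h (Function.surjInv hf '' S) (hS.image _)
  refine ⟨C, fun n hn => le_trans ?_ (hC n hn)⟩
  have : S ^ n = f '' (Function.surjInv hf '' S) ^ n := by
    rw [Set.image_pow, Set.image_image]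
    simp [Function.surjInv_eq]
  rw [this]
  exact Set.ncard_image_le (finite_pow (hS.image _) n)

theorem exists_sup_zpowers_lowerCentralSeries_eq_bot {d : ℕ} (n : ℕ) :
    ∀ {G : Type u} [Group G] [WellFoundedGT (Subgroup G)], GrowthLE G d →
      ∀ (N : Subgroup G) [N.Normal], N.lowerCentralSeries n = ⊥ → ∀ s : G,
        ∃ k m, 1 ≤ k ∧ (N ⊔ Subgroup.zpowers (s ^ k)).lowerCentralSeries m = ⊥ := by
  induction n with
  | zero =>
    intro G _ _ _ N _ hN s
    refine ⟨1, 1, le_rfl, ?_⟩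
    have hN' : N = ⊥ := hN
    rw [hN', bot_sup_eq, Subgroup.lowerCentralSeries_succ, Subgroup.lowerCentralSeries_zero,
      Subgroup.commutator_eq_bot_iff_le_centralizer]
    exact Subgroup.le_centralizer _
  | succ n ih =>
    intro G _ _ hd N _ hN s
    set Z := N.lowerCentralSeries n with hZ
    have hZN : ∀ z ∈ Z, ∀ y ∈ N, y * z * y⁻¹ = z := by
      rw [Subgroup.lowerCentralSeries_succ, Subgroup.commutator_eq_bot_iff_le_centralizer] at hN
      intro z hz y hy
      rw [Subgroup.mem_centralizer_iff.1 (hN hz) y hy, mul_inv_cancel_right]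
    have hZle : Z ≤ N := N.lowerCentralSeries_le_self n
    have hZc : IsMulCommutative Z := ⟨⟨fun a b => Subtype.ext
      (mul_inv_eq_iff_eq_mul.1 (hZN b b.2 a (hZle a.2)))⟩⟩
    have hZf := finite_additive_of_wellFoundedGT Z
    let π := QuotientGroup.mk' Z
    have hπ : Function.Surjective π := QuotientGroup.mk'_surjective Z
    have hker : π.ker = Z := QuotientGroup.ker_mk' Z
    have hQ : WellFoundedGT (Subgroup (G ⧸ Z)) := wellFoundedGT_subgroup_of_surjective π hπ
    have hNn : (N.map π).Normal := Subgroup.Normal.map ‹_› π hπ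
    obtain ⟨k₁, m₁, hk₁, h₁⟩ := ih (hd.of_surjective π hπ) (N.map π) (by
      rw [← Subgroup.map_lowerCentralSeries, Subgroup.map_eq_bot_iff, hker]) (π s)
    obtain ⟨k₂, r, hk₂, h₂⟩ := exists_conjEnd_unipotent Z hd (s ^ k₁)
    rw [← pow_mul] at h₂
    set E := N ⊔ Subgroup.zpowers (s ^ (k₁ * k₂)) with hE
    have hEZ : E.lowerCentralSeries m₁ ≤ Z := by
      rw [← hker, ← Subgroup.map_eq_bot_iff, Subgroup.map_lowerCentralSeries, eq_bot_iff, ← h₁]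
      refine Subgroup.lowerCentralSeries_mono m₁ ?_
      rw [hE, Subgroup.map_sup, MonoidHom.map_zpowers, map_pow, pow_mul]
      exact sup_le_sup le_rfl (Subgroup.zpowers_le_of_mem (Subgroup.npow_mem_zpowers _ _))
    have key : ∀ j i, j + i = r →
        E.lowerCentralSeries (m₁ + j) ≤ unipKer Z (conjEnd Z (s ^ (k₁ * k₂))) i := by
      intro j
      induction j with
      | zero =>
        intro i hi x hx
        rw [zero_add] at hi
        subst hi
        exact (mem_unipKer Z).2 ⟨Additive.ofMul ⟨x, hEZ hx⟩, by rw [h₂]; rfl, rfl⟩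
      | succ j ihj =>
        intro i hi
        rw [← add_assoc, Subgroup.lowerCentralSeries_succ]
        exact (Subgroup.commutator_mono (ihj (i + 1) (by omega)) le_rfl).trans
          (commutator_unipKer_le Z hZN hE i)
    refine ⟨k₁ * k₂, m₁ + r, Nat.mul_pos hk₁ hk₂, eq_bot_iff.2 ((key r 0 (add_zero r)).trans ?_)⟩
    rintro x ⟨z, hz, rfl⟩
    have hz' : Additive.ofMul z = 0 := hz
    have hz1 : z = 1 := hz'
    rw [hz1]
    exact Subgroup.mem_bot.2 rfl

/-- A finitely generated virtually nilpotent group has a characteristic nilpotent subgroup of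
finite index. -/
theorem exists_characteristic_nilpotent {P : Type*} [Group P] [Group.FG P]
    (h : Group.IsVirtuallyNilpotent P) :
    ∃ N : Subgroup P, N.Characteristic ∧ N.FiniteIndex ∧ Group.IsNilpotent N := by
  obtain ⟨N₀, hN₀, hfin⟩ := h
  let F := P ⧸ N₀.normalCore
  have hF : Finite (P →* F) := finite_monoidHom_of_fg
  refine ⟨⨅ f : P →* F, f.ker, ?_, ?_, ?_⟩
  · refine Subgroup.characteristic_iff_le_comap.2 fun α x hx => ?_
    rw [Subgroup.mem_comap, Subgroup.mem_iInf]
    intro f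
    exact (Subgroup.mem_iInf.1 hx) (f.comp α.toMonoidHom)
  · exact Subgroup.finiteIndex_iInf fun f => inferInstance
  · have hle : (⨅ f : P →* F, f.ker) ≤ N₀ := by
      refine (iInf_le _ (QuotientGroup.mk' N₀.normalCore)).trans ?_
      rw [QuotientGroup.ker_mk']
      exact N₀.normalCore_le
    rw [Subgroup.isNilpotent_iff_lowerCentralSeries] at hN₀ ⊢
    obtain ⟨n, hn⟩ := hN₀
    exact ⟨n, eq_bot_iff.2 (hn ▸ Subgroup.lowerCentralSeries_mono n hle)⟩

theorem isVirtuallyNilpotent_of_ker_int {G : Type*} [Group G] {d : ℕ} (hd : GrowthLE G d)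
    (φ : G →* Multiplicative ℤ) (hφ : Function.Surjective φ)
    [WellFoundedGT (Subgroup φ.ker)] (hP : Group.IsVirtuallyNilpotent φ.ker) :
    Group.IsVirtuallyNilpotent G ∧ WellFoundedGT (Subgroup G) := by
  have hG : WellFoundedGT (Subgroup G) := wellFoundedGT_subgroup_of_ker φ
  refine ⟨?_, hG⟩
  have hfg : Group.FG φ.ker := fg_of_wellFoundedGT_subgroup
  obtain ⟨N', hchar, hfin, hnil⟩ := exists_characteristic_nilpotent hP
  have hN : (N'.map φ.ker.subtype).Normal := inferInstance
  set N := N'.map φ.ker.subtype with hNdef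
  obtain ⟨n, hn⟩ := (Subgroup.isNilpotent_iff_lowerCentralSeries _).1 hnil
  have hn' : N.lowerCentralSeries n = ⊥ := by
    rw [hNdef, ← Subgroup.map_lowerCentralSeries, hn, Subgroup.map_bot]
  obtain ⟨t, ht⟩ := hφ (Multiplicative.ofAdd 1)
  obtain ⟨k, m, hk, hE⟩ := exists_sup_zpowers_lowerCentralSeries_eq_bot n hd N hn' t
  refine ⟨N ⊔ Subgroup.zpowers (t ^ k), (Subgroup.isNilpotent_iff_lowerCentralSeries _).2 ⟨m, hE⟩,
    ?_⟩
  have hφt : ∀ i : ℤ, φ (t ^ i) = Multiplicative.ofAdd i := by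
    intro i
    rw [map_zpow, ht, ← ofAdd_zsmul, smul_eq_mul, mul_one]
  have hmem : ∀ g : G, g * t ^ (-(φ g).toAdd) ∈ φ.ker := by
    intro g
    rw [MonoidHom.mem_ker, map_mul, hφt, ofAdd_neg, ofAdd_toAdd, mul_inv_cancel]
  have : NeZero k := ⟨by omega⟩
  refine finiteIndex_of_finite_range _
    (fun g => (((φ g).toAdd : ZMod k), (QuotientGroup.mk (⟨_, hmem g⟩ : φ.ker) : φ.ker ⧸ N')))
    (Set.toFinite _) fun a b hab => ?_
  obtain ⟨h1, h2⟩ := Prod.mk.inj hab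
  have h3 := QuotientGroup.eq.1 h2
  have h4 : (a * t ^ (-(φ a).toAdd))⁻¹ * (b * t ^ (-(φ b).toAdd)) ∈ N :=
    Subgroup.mem_map_of_mem φ.ker.subtype h3
  have h5 := hN.conj_mem _ h4 (t ^ (-(φ a).toAdd))
  obtain ⟨c, hc⟩ := (ZMod.intCast_eq_intCast_iff_dvd_sub _ _ k).1 h1
  have h6 : a⁻¹ * b = (t ^ (-(φ a).toAdd) * ((a * t ^ (-(φ a).toAdd))⁻¹ *
      (b * t ^ (-(φ b).toAdd))) * (t ^ (-(φ a).toAdd))⁻¹) * (t ^ k) ^ c := by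
    have : (t ^ k) ^ c = t ^ ((φ b).toAdd - (φ a).toAdd) := by
      rw [hc, zpow_mul, zpow_natCast]
    rw [this]
    group
  rw [h6]
  exact Subgroup.mul_mem_sup h5 (Subgroup.mem_zpowers_iff.2 ⟨c, rfl⟩)

end MilnorWolf

section VirtuallyNilpotent

theorem isVirtuallyNilpotent_of_hom {A B : Type*} [Group A] [Group B]
    (h : Group.IsVirtuallyNilpotent A) (f : A →* B) [hf : f.range.FiniteIndex] :
    Group.IsVirtuallyNilpotent B := by
  obtain ⟨N, hN, hfin⟩ := h
  refine ⟨N.map f, ?_, ⟨?_⟩⟩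
  · rw [Subgroup.isNilpotent_iff_lowerCentralSeries] at hN ⊢
    obtain ⟨n, hn⟩ := hN
    exact ⟨n, by rw [← Subgroup.map_lowerCentralSeries, hn, Subgroup.map_bot]⟩
  · rw [Subgroup.index_map]
    have : (N ⊔ f.ker).FiniteIndex := Subgroup.finiteIndex_of_le le_sup_left
    exact mul_ne_zero this.index_ne_zero hf.index_ne_zero

theorem isVirtuallyNilpotent_of_surjective {A B : Type*} [Group A] [Group B]
    (h : Group.IsVirtuallyNilpotent A) (f : A →* B) (hf : Function.Surjective f) :
    Group.IsVirtuallyNilpotent B := by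
  have : f.range.FiniteIndex := by
    rw [f.range_eq_top_of_surjective hf]; infer_instance
  exact isVirtuallyNilpotent_of_hom h f

end VirtuallyNilpotent

section Core

variable {Γ : Type*} [Group Γ] {ℓ : Γ → ℕ}

/-- A subgroup on which the length is bounded and modulo which balls are finite. -/
structure IsCore (ℓ : Γ → ℕ) (H : Subgroup Γ) : Prop where
  bdd : ∃ b, ∀ h ∈ H, ℓ h ≤ b
  finite : ∀ n, (QuotientGroup.mk (s := H) '' {g : Γ | ℓ g ≤ n}).Finite

theorem finite_mk_image_of_le {H K : Subgroup Γ} (h : H ≤ K) {S : Set Γ}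
    (hS : (QuotientGroup.mk (s := H) '' S).Finite) :
    (QuotientGroup.mk (s := K) '' S).Finite := by
  have := hS.image (Subgroup.quotientMapOfLE h)
  rwa [Set.image_image] at this

theorem exists_largest_core (hl : IsLength ℓ) (H₀ : Subgroup Γ) [H₀.Normal] (h₀ : IsCore ℓ H₀)
    [hw : WellFoundedGT (Subgroup (Γ ⧸ H₀))] :
    ∃ R : Subgroup Γ, R.Normal ∧ H₀ ≤ R ∧ IsCore ℓ R ∧
      ∀ H : Subgroup Γ, H.Normal → (∃ b, ∀ h ∈ H, ℓ h ≤ b) → H ≤ R := by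
  let π := QuotientGroup.mk' H₀
  have hπ : Function.Surjective π := QuotientGroup.mk'_surjective H₀
  have hker : π.ker = H₀ := QuotientGroup.ker_mk' H₀
  obtain ⟨K, ⟨hKn, b, hb⟩, hmax⟩ := hw.wf.has_min
    {K : Subgroup (Γ ⧸ H₀) | K.Normal ∧ ∃ b, ∀ h ∈ K.comap π, ℓ h ≤ b} ⟨⊥, inferInstance, by
      rw [MonoidHom.comap_bot, hker]; exact h₀.bdd⟩
  have hRn : (K.comap π).Normal := hKn.comap π
  have hle : H₀ ≤ K.comap π := hker.ge.trans (Subgroup.ker_le_comap π K)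
  refine ⟨K.comap π, hRn, hle, ⟨⟨b, hb⟩, fun n => finite_mk_image_of_le hle (h₀.finite n)⟩, ?_⟩
  rintro H hH ⟨c, hc⟩
  have hsup : ((K.comap π ⊔ H).map π).comap π = K.comap π ⊔ H := by
    rw [Subgroup.comap_map_eq, hker]
    exact sup_eq_left.2 (hle.trans le_sup_left)
  have h1 : K ≤ (K.comap π ⊔ H).map π := by
    rw [← Subgroup.map_comap_eq_self_of_surjective hπ K]
    exact Subgroup.map_mono (by
      rw [Subgroup.map_comap_eq_self_of_surjective hπ K]; exact le_sup_left)
  have h2 := hmax ((K.comap π ⊔ H).map π) ⟨Subgroup.Normal.map inferInstance π hπ, b + c, by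
    rw [hsup]
    intro x hx
    obtain ⟨y, hy, z, hz, rfl⟩ := Subgroup.mem_sup_of_normal_left.1 hx
    exact (hl.mul_le y z).trans (add_le_add (hb y hy) (hc z hz))⟩
  have h3 := (eq_or_lt_of_le h1).resolve_right h2
  rw [h3, hsup]
  exact le_sup_right

theorem exists_normal_core (hl : IsLength ℓ) (K : Subgroup Γ) [hK : K.Normal] (H₀ : Subgroup K)
    [H₀.Normal] (h₀ : IsCore (fun g : K => ℓ g) H₀) [hw : WellFoundedGT (Subgroup (K ⧸ H₀))]
    (hv : Group.IsVirtuallyNilpotent (K ⧸ H₀)) :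
    ∃ (R : Subgroup Γ) (_ : R.Normal), R ≤ K ∧ (∃ b, ∀ h ∈ R, ℓ h ≤ b) ∧
      (∀ n, (QuotientGroup.mk' R '' {g | g ∈ K ∧ ℓ g ≤ n}).Finite) ∧
      Group.IsVirtuallyNilpotent (K.map (QuotientGroup.mk' R)) ∧
      WellFoundedGT (Subgroup (K.map (QuotientGroup.mk' R))) := by
  obtain ⟨R, hRn, hle, hR, hmax⟩ := exists_largest_core (hl.comp K.subtype) H₀ h₀
  have hnorm : (R.map K.subtype).Normal := by
    refine ⟨?_⟩
    rintro _ ⟨k, hk, rfl⟩ γ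
    have hbd : ∃ b, ∀ h ∈ R.map (MulAut.conjNormal γ : MulAut K).toMonoidHom,
        ℓ (K.subtype h) ≤ b := by
      obtain ⟨b, hb⟩ := hR.bdd
      refine ⟨ℓ γ + b + ℓ γ, ?_⟩
      rintro _ ⟨h, hh, rfl⟩
      have h1 := hl.mul_le (γ * h) γ⁻¹
      have h2 := hl.mul_le γ h
      have h3 := hb h hh
      rw [hl.inv] at h1
      change ℓ (γ * h * γ⁻¹) ≤ _
      change ℓ h ≤ b at h3
      omega
    have := hmax _ (Subgroup.Normal.map hRn _ (MulAut.conjNormal γ : MulAut K).surjective) hbd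
    exact ⟨MulAut.conjNormal γ k, this ⟨k, hk, rfl⟩, MulAut.conjNormal_apply γ k⟩
  let p := QuotientGroup.mk' (R.map K.subtype)
  let q : K →* K.map p := p.subgroupMap K
  have hq : Function.Surjective q := p.subgroupMap_surjective K
  have hqR : ∀ h ∈ R, q h = 1 := fun h hh =>
    Subtype.ext ((QuotientGroup.eq_one_iff _).2 (Subgroup.mem_map_of_mem K.subtype hh))
  let f : K ⧸ H₀ →* K.map p := QuotientGroup.lift H₀ q fun h hh => hqR h (hle hh)
  have hf : Function.Surjective f := QuotientGroup.lift_surjective_of_surjective _ _ hq _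
  refine ⟨R.map K.subtype, hnorm, Subgroup.map_subtype_le R, ?_, fun n => ?_,
    isVirtuallyNilpotent_of_surjective hv f hf, wellFoundedGT_subgroup_of_surjective f hf⟩
  · obtain ⟨b, hb⟩ := hR.bdd
    refine ⟨b, ?_⟩
    rintro _ ⟨h, hh, rfl⟩
    exact hb h hh
  · refine ((h₀.finite n).image fun x => ((f x : K.map p) : Γ ⧸ R.map K.subtype)).subset ?_
    rintro _ ⟨g, ⟨hgK, hg⟩, rfl⟩
    exact ⟨QuotientGroup.mk ⟨g, hgK⟩, ⟨⟨g, hgK⟩, hg, rfl⟩, rfl⟩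

/-- The conclusion of the structure theorem for groups of polynomial growth with respect to a
length function. -/
def HasNilpotentCore (ℓ : Γ → ℕ) : Prop :=
  ∃ (R : Subgroup Γ) (_ : R.Normal), IsCore ℓ R ∧ Group.IsVirtuallyNilpotent (Γ ⧸ R) ∧
    WellFoundedGT (Subgroup (Γ ⧸ R))

theorem LenGroup.hasNilpotentCore_of_ker {d : ℕ} (hG : LenGroup ℓ d)
    (φ : Γ →* Multiplicative ℤ) (hφ : Function.Surjective φ) (hU : ∀ g, ℓ g = 0 → φ g = 1)
    (h : HasNilpotentCore fun g : φ.ker => ℓ g) : HasNilpotentCore ℓ := by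
  obtain ⟨H₀, _, h₀, hv, hw⟩ := h
  obtain ⟨R, hRn, hRK, hbd, hfin, hv', hw'⟩ :=
    exists_normal_core hG.toIsLength φ.ker H₀ h₀ hv
  let p := QuotientGroup.mk' R
  have hp : Function.Surjective p := QuotientGroup.mk'_surjective R
  have hpU : (p '' hG.ker).Finite :=
    (hfin 0).subset (Set.image_mono fun g hg => ⟨hU g hg, le_of_eq hg⟩)
  obtain ⟨hgr, -⟩ := hG.growthLE_of_surjective p hp hpU
  let ψ : Γ ⧸ R →* Multiplicative ℤ := QuotientGroup.lift R φ fun g hg => hRK hg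
  have hψ : Function.Surjective ψ := QuotientGroup.lift_surjective_of_surjective _ _ hφ _
  have hker : ψ.ker = φ.ker.map p := by
    ext x
    obtain ⟨g, rfl⟩ := hp x
    constructor
    · intro hx
      exact ⟨g, hx, rfl⟩
    · rintro ⟨k, hk, hkg⟩
      rw [← hkg]
      exact hk
  rw [← hker] at hv' hw'
  obtain ⟨h1, h2⟩ := isVirtuallyNilpotent_of_ker_int hgr ψ hψ hv'
  exact ⟨R, hRn, ⟨hbd, hG.finite_image_of_finite_image_ker p hpU⟩, h1, h2⟩

theorem LenGroup.hasNilpotentCore_of_finiteIndex {d : ℕ} (hG : LenGroup ℓ d) (K : Subgroup Γ)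
    [K.Normal] [hKfin : K.FiniteIndex] (h : HasNilpotentCore fun g : K => ℓ g) :
    HasNilpotentCore ℓ := by
  obtain ⟨H₀, _, h₀, hv, hw⟩ := h
  obtain ⟨R, hRn, hRK, hbd, hfin, hv', hw'⟩ := exists_normal_core hG.toIsLength K H₀ h₀ hv
  let p := QuotientGroup.mk' R
  have hp : Function.Surjective p := QuotientGroup.mk'_surjective R
  have hpU : (p '' hG.ker).Finite := by
    have : ∀ c : Γ ⧸ K, (p '' {u | ℓ u = 0 ∧ QuotientGroup.mk u = c}).Finite := by
      intro c
      rcases Set.eq_empty_or_nonempty {u | ℓ u = 0 ∧ QuotientGroup.mk u = c} with h | ⟨u₀, hu₀, hc⟩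
      · rw [h, Set.image_empty]; exact Set.finite_empty
      · refine ((hfin 0).image fun x => p u₀ * x).subset ?_
        rintro _ ⟨u, ⟨hu, huc⟩, rfl⟩
        refine ⟨p (u₀⁻¹ * u), ⟨_, ⟨QuotientGroup.eq.1 (hc.trans huc.symm), ?_⟩, rfl⟩, ?_⟩
        · exact le_of_eq ((hG.mul_right_eq _ hu).trans ((hG.inv _).trans hu₀))
        · change p u₀ * p (u₀⁻¹ * u) = p u
          rw [← map_mul, mul_inv_cancel_left]
    refine (Set.finite_iUnion this).subset ?_
    rintro _ ⟨u, hu, rfl⟩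
    exact Set.mem_iUnion.2 ⟨QuotientGroup.mk u, u, ⟨hu, rfl⟩, rfl⟩
  have hfi : (K.map p).FiniteIndex :=
    ⟨fun h => hKfin.index_ne_zero (Nat.eq_zero_of_zero_dvd (h ▸ K.index_map_dvd hp))⟩
  refine ⟨R, hRn, ⟨hbd, hG.finite_image_of_finite_image_ker p hpU⟩, ?_,
    wellFoundedGT_subgroup_of_finiteIndex (K.map p)⟩
  have : (K.map p).subtype.range.FiniteIndex := by rw [Subgroup.range_subtype]; exact hfi
  exact isVirtuallyNilpotent_of_hom hv' (K.map p).subtype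

universe u

/-- A group with a length function of polynomial growth is virtually nilpotent modulo a normal
subgroup of bounded length. -/
theorem LenGroup.hasNilpotentCore (d : ℕ) : ∀ {Γ : Type u} [Group Γ] {ℓ : Γ → ℕ},
    LenGroup ℓ d → HasNilpotentCore ℓ := by
  induction d using Nat.strong_induction_on with
  | _ d ih =>
    intro Γ _ ℓ hG
    rcases finite_or_infinite (Γ ⧸ hG.ker) with hfin | hinf
    · refine ⟨⊤, inferInstance, ⟨?_, fun n => Set.toFinite _⟩,
        ?_, inferInstance⟩
      swap
      · refine ⟨⊥, inferInstance, inferInstance⟩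
      obtain ⟨b, hb⟩ := (Set.finite_range fun x : Γ ⧸ hG.ker => ℓ x.out).bddAbove
      refine ⟨b, fun g _ => ?_⟩
      have h1 : ℓ g = ℓ (QuotientGroup.mk (s := hG.ker) g).out := by
        obtain ⟨u, hu⟩ := QuotientGroup.mk_out_eq_mul hG.ker g
        rw [hu]
        exact (hG.mul_right_eq g u.2).symm
      rw [h1]
      exact hb ⟨_, rfl⟩
    · obtain ⟨Γ₁, hn, hfi, φ, hφ, hU⟩ := hG.exists_hom_int
      have h₁ := hG.subgroup Γ₁
      obtain ⟨e, he, hK⟩ := h₁.ker_int φ hφ hU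
      exact hG.hasNilpotentCore_of_finiteIndex Γ₁
        (h₁.hasNilpotentCore_of_ker φ hφ hU (ih e (by omega) hK))

end Core

section TorsionFree

theorem eq_one_of_isOfFinOrder_of_center {N : Type*} [Group N] [Group.IsNilpotent N] :
    (∀ x ∈ Subgroup.center N, IsOfFinOrder x → x = 1) → ∀ x : N, IsOfFinOrder x → x = 1 := by
  refine Group.nilpotent_center_quotient_ind (P := fun N _ _ =>
    (∀ x ∈ Subgroup.center N, IsOfFinOrder x → x = 1) → ∀ x : N, IsOfFinOrder x → x = 1) N
    (fun N _ _ _ x _ => Subsingleton.elim _ _) fun N _ _ ih hc x hx => ?_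
  have hq : ∀ y ∈ Subgroup.center (N ⧸ Subgroup.center N), IsOfFinOrder y → y = 1 := by
    intro y hy hfin
    obtain ⟨y, rfl⟩ := QuotientGroup.mk_surjective y
    obtain ⟨n, hn, hyn⟩ := isOfFinOrder_iff_pow_eq_one.1 hfin
    rw [← QuotientGroup.mk_pow, QuotientGroup.eq_one_iff] at hyn
    rw [QuotientGroup.eq_one_iff, Subgroup.mem_center_iff]
    intro g
    have hcomm : y * g * y⁻¹ * g⁻¹ ∈ Subgroup.center N := by
      rw [← QuotientGroup.eq_one_iff]
      have := Subgroup.mem_center_iff.1 hy g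
      simp only [QuotientGroup.mk_mul, QuotientGroup.mk_inv]
      rw [← this]
      group
    set c := y * g * y⁻¹ * g⁻¹ with hcdef
    have hcc : ∀ z, z * c = c * z := Subgroup.mem_center_iff.1 hcomm
    have hpow : ∀ m : ℕ, y ^ m * g = c ^ m * g * y ^ m := by
      intro m
      induction m with
      | zero => simp
      | succ m ihm =>
        have h1 : y * g = c * g * y := by rw [hcdef]; group
        have h2 : y * c ^ m = c ^ m * y := (Commute.pow_right (hcc y) m).eq
        calc y ^ (m + 1) * g = y * (y ^ m * g) := by rw [pow_succ', mul_assoc]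
          _ = y * c ^ m * (g * y ^ m) := by rw [ihm]; simp only [mul_assoc]
          _ = c ^ m * (y * g) * y ^ m := by rw [h2]; simp only [mul_assoc]
          _ = c ^ (m + 1) * g * y ^ (m + 1) := by
            rw [h1, pow_succ, pow_succ']; simp only [mul_assoc]
    have hcn : c ^ n = 1 := by
      have h1 := hpow n
      rw [← Subgroup.mem_center_iff.1 hyn g, mul_assoc] at h1
      exact (mul_eq_right.1 h1.symm)
    have hc1 := hc c hcomm (isOfFinOrder_iff_pow_eq_one.2 ⟨n, hn, hcn⟩)
    have h1 : y * g = c * g * y := by rw [hcdef]; group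
    rw [h1, hc1, one_mul]
  have hxq := ih hq _ ((QuotientGroup.mk' (Subgroup.center N)).isOfFinOrder hx)
  exact hc x ((QuotientGroup.eq_one_iff x).1 hxq) hx

open scoped IsMulCommutative in
/-- A virtually nilpotent Noetherian group without nontrivial finite normal subgroups is virtually
torsion-free nilpotent. -/
theorem exists_torsionFree_nilpotent {Q : Type*} [Group Q] [WellFoundedGT (Subgroup Q)]
    (hv : Group.IsVirtuallyNilpotent Q)
    (hQ : ∀ T : Subgroup Q, T.Normal → Finite T → T = ⊥) :
    ∃ N : Subgroup Q, N.Normal ∧ N.FiniteIndex ∧ Group.IsNilpotent N ∧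
      ∀ x ∈ N, IsOfFinOrder x → x = 1 := by
  obtain ⟨N₀, hN₀, hfin⟩ := hv
  have hnil : Group.IsNilpotent N₀.normalCore := by
    rw [Subgroup.isNilpotent_iff_lowerCentralSeries] at hN₀ ⊢
    obtain ⟨n, hn⟩ := hN₀
    exact ⟨n, eq_bot_iff.2 (hn ▸ Subgroup.lowerCentralSeries_mono n N₀.normalCore_le)⟩
  have hNn : N₀.normalCore.Normal := inferInstance
  have hNf : N₀.normalCore.FiniteIndex := inferInstance
  set N := N₀.normalCore
  let T : Subgroup Q :=
    { carrier := {x | x ∈ N ∧ (∀ n ∈ N, Commute x n) ∧ IsOfFinOrder x}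
      one_mem' := ⟨N.one_mem, fun n _ => Commute.one_left n, IsOfFinOrder.one⟩
      mul_mem' := fun {a b} ha hb => ⟨N.mul_mem ha.1 hb.1,
        fun n hn => (ha.2.1 n hn).mul_left (hb.2.1 n hn),
          (ha.2.1 b hb.1).isOfFinOrder_mul ha.2.2 hb.2.2⟩
      inv_mem' := fun {a} ha => ⟨N.inv_mem ha.1, fun n hn => (ha.2.1 n hn).inv_left, ha.2.2.inv⟩ }
  have hTn : T.Normal := by
    refine ⟨fun x hx g => ⟨hNn.conj_mem x hx.1 g, fun n hn => ?_,
      (MulAut.conj g).toMonoidHom.isOfFinOrder hx.2.2⟩⟩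
    have h1 := hx.2.1 (g⁻¹ * n * g) (by simpa using hNn.conj_mem n hn g⁻¹)
    have h2 := h1.map (MulAut.conj g).toMonoidHom
    have h3 : (MulAut.conj g).toMonoidHom (g⁻¹ * n * g) = n := by
      change g * (g⁻¹ * n * g) * g⁻¹ = n
      group
    rw [h3] at h2
    exact h2
  have hTc : IsMulCommutative T := ⟨⟨fun a b => Subtype.ext (a.2.2.1 b b.2.1).eq⟩⟩
  have hTw : WellFoundedGT (Subgroup T) :=
    wellFoundedGT_subgroup_of_injective T.subtype T.subtype_injective
  have hTfg : Group.FG T := fg_of_wellFoundedGT_subgroup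
  have hTfin : Finite T := CommGroup.finite_of_fg_isMulTorsion T fun x =>
    (Submonoid.isOfFinOrder_coe (H := T.toSubmonoid) (x := x)).1 x.2.2.2
  have hT := hQ T hTn hTfin
  refine ⟨N, hNn, hNf, hnil, fun x hx hxf => ?_⟩
  have := eq_one_of_isOfFinOrder_of_center (N := N) (fun z hz hzf => ?_) ⟨x, hx⟩
    ((Submonoid.isOfFinOrder_coe (H := N.toSubmonoid) (x := ⟨x, hx⟩)).1 hxf)
  · exact congrArg Subtype.val this
  · have hzT : (z : Q) ∈ T := ⟨z.2, fun n hn =>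
      (congrArg Subtype.val (Subgroup.mem_center_iff.1 hz ⟨n, hn⟩)).symm,
      (Submonoid.isOfFinOrder_coe (H := N.toSubmonoid) (x := z)).2 hzf⟩
    rw [hT, Subgroup.mem_bot] at hzT
    exact Subtype.ext hzT

end TorsionFree

section Graph

variable {V Γ : Type*} [Group Γ] [MulAction Γ V] {G : SimpleGraph V}

theorem dist_smul_smul (haut : ∀ (g : Γ) (u v : V), G.Adj (g • u) (g • v) ↔ G.Adj u v)
    (hconn : G.Connected) (g : Γ) (u v : V) : G.dist (g • u) (g • v) = G.dist u v := by
  have key : ∀ (g : Γ) (u v : V), G.dist (g • u) (g • v) ≤ G.dist u v := by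
    intro g u v
    obtain ⟨p, hp⟩ := hconn.exists_walk_length_eq_dist u v
    let f : G →g G := ⟨fun x => g • x, fun h => (haut g _ _).2 h⟩
    rw [← hp, ← p.length_map f]
    exact SimpleGraph.dist_le _
  refine le_antisymm (key g u v) ?_
  have := key g⁻¹ (g • u) (g • v)
  rwa [inv_smul_smul, inv_smul_smul] at this

theorem exists_adj_dist_eq (hconn : G.Connected) {u v : V} {n : ℕ} (h : G.dist u v = n + 1) :
    ∃ w, G.Adj w v ∧ G.dist u w ≤ n := by
  obtain ⟨p, hp⟩ := hconn.exists_walk_length_eq_dist v u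
  rw [SimpleGraph.dist_comm, h] at hp
  cases p with
  | nil => simp at hp
  | cons hadj q =>
    refine ⟨_, hadj.symm, ?_⟩
    rw [SimpleGraph.Walk.length_cons] at hp
    rw [SimpleGraph.dist_comm]
    exact (SimpleGraph.dist_le q).trans (by omega)

theorem finite_setOf_dist_le (hconn : G.Connected) (hlf : ∀ v, (G.neighborSet v).Finite) (v : V)
    (n : ℕ) : {u | G.dist v u ≤ n}.Finite := by
  induction n with
  | zero =>
    refine (Set.finite_singleton v).subset fun u hu => ?_
    exact ((hconn.dist_eq_zero_iff).1 (Nat.le_zero.1 hu)).symm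
  | succ n ih =>
    refine (ih.union (ih.biUnion fun w _ => hlf w)).subset fun u hu => ?_
    rcases Nat.lt_or_ge n (G.dist v u) with h | h
    · obtain ⟨w, hw, hvw⟩ := exists_adj_dist_eq hconn (le_antisymm hu h)
      exact Or.inr (Set.mem_biUnion hvw hw)
    · exact Or.inl h

theorem isLength_dist (haut : ∀ (g : Γ) (u v : V), G.Adj (g • u) (g • v) ↔ G.Adj u v)
    (hconn : G.Connected) (v₀ : V) : IsLength fun g : Γ => G.dist v₀ (g • v₀) where
  one := by rw [one_smul, SimpleGraph.dist_self]
  mul_le g h := by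
    rw [mul_smul]
    refine (hconn.dist_triangle (v := g • v₀)).trans ?_
    rw [dist_smul_smul haut hconn]
  inv g := by
    rw [← dist_smul_smul haut hconn g, smul_inv_smul, SimpleGraph.dist_comm]

theorem lenGroup_dist (haut : ∀ (g : Γ) (u v : V), G.Adj (g • u) (g • v) ↔ G.Adj u v)
    (hconn : G.Connected) (hlf : ∀ v, (G.neighborSet v).Finite)
    (htrans : ∀ u v : V, ∃ g : Γ, g • u = v) (v₀ : V) {C d : ℕ}
    (hgr : ∀ n, 1 ≤ n → {u | G.dist v₀ u ≤ n}.ncard ≤ C * n ^ d) :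
    LenGroup (fun g : Γ => G.dist v₀ (g • v₀)) d where
  toIsLength := isLength_dist haut hconn v₀
  growth := by
    classical
    refine ⟨C, fun n hn T hT hinj => le_trans ?_ (hgr n hn)⟩
    have hi : Set.InjOn (fun g : Γ => g • v₀) T := by
      intro s hs t ht hst
      refine hinj s hs t ht ?_
      rw [mul_smul, ← show s • v₀ = t • v₀ from hst, inv_smul_smul, SimpleGraph.dist_self]
    rw [← card_image_of_injOn hi, ← Set.ncard_coe_finset]
    refine Set.ncard_le_ncard ?_ (finite_setOf_dist_le hconn hlf v₀ n)
    intro x hx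
    obtain ⟨t, ht, rfl⟩ := mem_image.1 (mem_coe.1 hx)
    exact hT t ht
  gen := by
    refine ⟨1, eq_top_iff.2 fun g _ => ?_⟩
    have key : ∀ n (g : Γ), G.dist v₀ (g • v₀) ≤ n →
        g ∈ Subgroup.closure {g : Γ | G.dist v₀ (g • v₀) ≤ 1} := by
      intro n
      induction n with
      | zero => exact fun g hg => Subgroup.subset_closure (hg.trans zero_le_one)
      | succ n ih =>
        intro g hg
        rcases Nat.lt_or_ge n (G.dist v₀ (g • v₀)) with h | h
        · obtain ⟨w, hw, hvw⟩ := exists_adj_dist_eq hconn (le_antisymm hg h)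
          obtain ⟨γ, rfl⟩ := htrans v₀ w
          have h1 : G.dist v₀ ((γ⁻¹ * g) • v₀) ≤ 1 := by
            rw [← dist_smul_smul haut hconn γ, mul_smul, smul_inv_smul]
            exact (SimpleGraph.dist_eq_one_iff_adj.2 hw).le
          have := Subgroup.mul_mem _ (ih γ hvw) (Subgroup.subset_closure h1)
          rwa [mul_inv_cancel_left] at this
        · exact ih g h
    exact key _ g le_rfl

end Graph

end TransGrowth

namespace PercStmt

open TransGrowth

variable {V : Type*} {Γ : Type*} [Group Γ] [MulAction Γ V]

/-- Trofimov-type theorem.  Let `G` be a connected, locally finite,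
vertex-transitive graph of polynomial growth and let `Γ ≤ Aut(G)` (a group acting faithfully
on `V` by graph automorphisms) act transitively.  Then there is a normal subgroup `H ⊴ Γ`
with all vertex-orbits finite such that `Γ_{G/H} = Γ ⧸ actionKernel V Γ H` contains a
normal, finite-index, torsion-free, nilpotent subgroup `N` acting freely on the vertex set
of `G/H` (the set of `H`-orbits). -/
theorem stmt4 {V Γ : Type*} [Group Γ] [MulAction Γ V] (G : SimpleGraph V) (v₀ : V)
    (hconn : G.Connected) (hlf : G.LocallyFinite)
    (htransG : VertexTransitive G)
    (hfaithful : ∀ g : Γ, (∀ v : V, g • v = v) → g = 1)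
    (haut : ∀ (g : Γ) (u v : V), G.Adj (g • u) (g • v) ↔ G.Adj u v)
    (htrans : ∀ u v : V, ∃ g : Γ, g • u = v)
    (hpoly : PolyGrowth G v₀) :
    ∃ (H : Subgroup Γ), H.Normal ∧ (∀ v : V, (MulAction.orbit H v).Finite) ∧
      ∃ hK : (actionKernel V Γ H).Normal,
        letI := hK
        ∃ N : Subgroup (Γ ⧸ actionKernel V Γ H),
          N.Normal ∧ N.FiniteIndex ∧ Group.IsNilpotent N ∧
          (∀ x : Γ ⧸ actionKernel V Γ H, x ∈ N → x ≠ 1 → ¬ IsOfFinOrder x) ∧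
          (∀ g : Γ, (QuotientGroup.mk g : Γ ⧸ actionKernel V Γ H) ∈ N →
            (∃ v : V, Quotient.mk (MulAction.orbitRel H V) (g • v) =
                Quotient.mk (MulAction.orbitRel H V) v) →
            (QuotientGroup.mk g : Γ ⧸ actionKernel V Γ H) = 1) := by
  have hnb : ∀ v, (G.neighborSet v).Finite := fun v =>
    @Set.toFinite _ _ (@Finite.of_fintype _ (hlf v))
  obtain ⟨C, d, hC, -, hgr⟩ := hpoly
  have hgr' : ∀ n, 1 ≤ n → {u | G.dist v₀ u ≤ n}.ncard ≤ ⌈C⌉₊ * n ^ ⌈d⌉₊ := by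
    intro n hn
    have h1 := hgr n hn
    have h2 : ballCard G v₀ n = {u | G.dist v₀ u ≤ n}.ncard := by
      rw [ballCard, Nat.card_coe_set_eq]
      simp only [hconn v₀ _, true_and]
    rw [h2] at h1
    have h3 : (n : ℝ) ^ d ≤ (n : ℝ) ^ (⌈d⌉₊ : ℕ) := by
      rw [← Real.rpow_natCast]
      exact Real.rpow_le_rpow_of_exponent_le (by exact_mod_cast hn) (Nat.le_ceil d)
    have h4 : C * (n : ℝ) ^ d ≤ ⌈C⌉₊ * (n : ℝ) ^ (⌈d⌉₊ : ℕ) :=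
      mul_le_mul (Nat.le_ceil C) h3 (by positivity) (by positivity)
    exact_mod_cast h1.trans h4
  have hG := lenGroup_dist haut hconn hnb htrans v₀ hgr'
  obtain ⟨R₀, hR₀n, hR₀, hv, hw⟩ := hG.hasNilpotentCore
  obtain ⟨R, hRn, hle, hR, hmax⟩ := exists_largest_core hG.toIsLength R₀ hR₀
  obtain ⟨b, hb⟩ := hR.bdd
  have horb : ∀ {g : Γ} {v : V}, Quotient.mk (MulAction.orbitRel R V) (g • v) =
      Quotient.mk (MulAction.orbitRel R V) v ↔ ∃ r ∈ R, r • v = g • v := by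
    intro g v
    rw [Quotient.eq, MulAction.orbitRel_apply, MulAction.mem_orbit_iff]
    exact ⟨fun ⟨r, hr⟩ => ⟨r, r.2, hr⟩, fun ⟨r, hr, h⟩ => ⟨⟨r, hr⟩, h⟩⟩
  have hdist : ∀ (γ : Γ), ∀ r ∈ R, G.dist (γ • v₀) (r • γ • v₀) ≤ b := by
    intro γ r hr
    have h1 := hb (γ⁻¹ * r * γ) (by simpa using hRn.conj_mem r hr γ⁻¹)
    rw [← dist_smul_smul haut hconn γ, smul_smul] at h1
    rwa [smul_smul, show r * γ = γ * (γ⁻¹ * r * γ) by group]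
  have hK : (actionKernel V Γ R).Normal := by
    refine ⟨fun k hk g v => horb.2 ?_⟩
    obtain ⟨r, hr, h⟩ := horb.1 (hk (g⁻¹ • v))
    refine ⟨g * r * g⁻¹, hRn.conj_mem r hr g, ?_⟩
    rw [mul_smul, mul_smul, h, mul_smul, mul_smul]
  set K := actionKernel V Γ R with hKdef
  have hRK : R ≤ K := fun r hr v => horb.2 ⟨r, hr, rfl⟩
  have hKb : ∀ k ∈ K, G.dist v₀ (k • v₀) ≤ b := by
    intro k hk
    obtain ⟨r, hr, h⟩ := horb.1 (hk v₀)
    rw [← h]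
    exact hb r hr
  let f : Γ ⧸ R₀ →* Γ ⧸ K :=
    QuotientGroup.map R₀ K (MonoidHom.id Γ) fun x hx => hRK (hle hx)
  have hf : Function.Surjective f := by
    intro x
    obtain ⟨g, rfl⟩ := QuotientGroup.mk_surjective x
    exact ⟨QuotientGroup.mk g, rfl⟩
  have hwK := wellFoundedGT_subgroup_of_surjective f hf
  obtain ⟨N, hNn, hNf, hNnil, hNt⟩ := exists_torsionFree_nilpotent
    (isVirtuallyNilpotent_of_surjective hv f hf) fun T hTn hTf => by
      have hbd : ∃ c, ∀ g ∈ T.comap (QuotientGroup.mk' K), G.dist v₀ (g • v₀) ≤ c := by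
        obtain ⟨c, hc⟩ := (Set.finite_range fun t : T =>
          G.dist v₀ ((t : Γ ⧸ K).out • v₀)).bddAbove
        refine ⟨c + b, fun g hg => ?_⟩
        obtain ⟨k, hk⟩ := QuotientGroup.mk_out_eq_mul K g
        have h1 : G.dist v₀ ((QuotientGroup.mk g : Γ ⧸ K).out • v₀) ≤ c := hc ⟨⟨_, hg⟩, rfl⟩
        have h2 := hG.mul_le (QuotientGroup.mk g : Γ ⧸ K).out (k⁻¹ : K)
        have h3 := hKb _ (k⁻¹ : K).2
        rw [hk, Subgroup.coe_inv, mul_inv_cancel_right, ← hk] at h2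
        rw [Subgroup.coe_inv] at h3
        exact h2.trans (add_le_add h1 h3)
      have h1 := (hmax _ (hTn.comap _) hbd).trans hRK
      refine eq_bot_iff.2 fun x hx => ?_
      obtain ⟨g, rfl⟩ := QuotientGroup.mk_surjective x
      exact (QuotientGroup.eq_one_iff g).2 (h1 hx)
  refine ⟨R, hRn, fun v => ?_, hK, N, hNn, hNf, hNnil, fun x hx hne hfin => hne (hNt x hx hfin), ?_⟩
  · obtain ⟨γ, rfl⟩ := htrans v₀ v
    refine (finite_setOf_dist_le hconn hnb (γ • v₀) b).subset ?_
    rintro _ ⟨r, rfl⟩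
    exact hdist γ r r.2
  · rintro g hg ⟨v, hv⟩
    refine hNt _ hg ?_
    obtain ⟨γ, rfl⟩ := htrans v₀ v
    have hpow : ∀ n : ℕ, ∃ r ∈ R, r • γ • v₀ = g ^ n • γ • v₀ := by
      intro n
      obtain ⟨s, hs, hsg⟩ := horb.1 hv
      induction n with
      | zero => exact ⟨1, R.one_mem, by rw [pow_zero]⟩
      | succ n ih =>
        obtain ⟨r, hr, h⟩ := ih
        refine ⟨g * r * g⁻¹ * s, R.mul_mem (hRn.conj_mem r hr g) hs, ?_⟩
        rw [mul_smul, hsg, mul_smul, inv_smul_smul, mul_smul, h, pow_succ', mul_smul]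
    have hball := (finite_mk_image_of_le hRK
      (hR.finite (G.dist v₀ (γ • v₀) + b + G.dist v₀ (γ • v₀))))
    refine finite_powers.1 (hball.subset ?_)
    rintro _ ⟨n, rfl⟩
    refine ⟨g ^ n, ?_, rfl⟩
    obtain ⟨r, hr, h⟩ := hpow n
    have h1 := hdist γ r hr
    rw [h] at h1
    have h2 : G.dist v₀ (g ^ n • v₀) ≤ G.dist v₀ (γ • v₀) + G.dist (γ • v₀) (g ^ n • γ • v₀) +
        G.dist (g ^ n • γ • v₀) (g ^ n • v₀) :=
      (hconn.dist_triangle (v := g ^ n • γ • v₀)).trans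
        (Nat.add_le_add_right (hconn.dist_triangle (v := γ • v₀)) _)
    rw [dist_smul_smul haut hconn (g ^ n), SimpleGraph.dist_comm (u := γ • v₀) (v := v₀)] at h2
    change G.dist v₀ (g ^ n • v₀) ≤ _
    omega

end PercStmt
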